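/- Fix δ > 0. There exist η, c₀ > 0 and, for each sufficiently small pair (η, c) with c < c₀, an index j₀ = j₀(η, c), such that the following holds for A chosen large enough depending on δ, n, η, and for N larger than a dimensional constant. Let Q ⊂ ℝⁿ be a cube, u harmonic on a sufficiently large neighborhood of Q with N(Q) ≤ (1+c)N, and let q be a cube of side length (2A+1)^{-j}·ℓ(Q) with j ≥ j₀ obtained from Q by j successive subdivisions into (2A+1)ⁿ congruent subcubes, where 2A+1 is a power of 3. Then at most (1/2)·(2A+1)^{n-2+δ} of the (2A+1)ⁿ children subcubes of q have maximal doubling index greater than N. -/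

import Mathlib

open MeasureTheory Metric Set ENNReal Matrix RealInnerProductSpace

/-- `sup` of `|∇u|` over a set. -/
noncomputable def supGrad {n : ℕ} (u : EuclideanSpace ℝ (Fin n) → ℝ)
    (s : Set (EuclideanSpace ℝ (Fin n))) : ℝ :=
  sSup ((fun x => ‖fderiv ℝ u x‖) '' s)

/-- `u` is harmonic on `U`: smooth on `U` and its Laplacian vanishes on `U`. -/
def IsHarmonicOn {n : ℕ} (u : EuclideanSpace ℝ (Fin n) → ℝ)
    (U : Set (EuclideanSpace ℝ (Fin n))) : Prop :=
  ContDiffOn ℝ (⊤ : ℕ∞) u U ∧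
    ∀ x ∈ U, ∑ i : Fin n,
      fderiv ℝ (fun y => fderiv ℝ u y (EuclideanSpace.single i 1)) x (EuclideanSpace.single i 1) = 0

/-- normalized doubling index of the gradient on `B(x,r)`:
`N(x,r) = log ( sup_{B(x,2r)} |∇u| / sup_{B(x,r)} |∇u| )`. -/
noncomputable def doublingIndex {n : ℕ} (u : EuclideanSpace ℝ (Fin n) → ℝ)
    (x : EuclideanSpace ℝ (Fin n)) (r : ℝ) : ℝ :=
  Real.log (supGrad u (ball x (2 * r)) / supGrad u (ball x r))

/-- the closed axis-parallel cube with center `c` and side length `ℓ` -/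
def cube {n : ℕ} (c : EuclideanSpace ℝ (Fin n)) (ℓ : ℝ) : Set (EuclideanSpace ℝ (Fin n)) :=
  {x | ∀ i, |x i - c i| ≤ ℓ / 2}

/-- maximal normalized doubling index of the cube of center `c` and side `ℓ`:
`N(Q) = sup_{x ∈ Q, 0 < r ≤ ℓ(Q)} log ( sup_{B(x,10nr)} |∇u| / sup_{B(x,r)} |∇u| )`. -/
noncomputable def cubeDoublingIndex {n : ℕ} (u : EuclideanSpace ℝ (Fin n) → ℝ)
    (c : EuclideanSpace ℝ (Fin n)) (ℓ : ℝ) : ℝ :=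
  sSup {t | ∃ x ∈ cube c ℓ, ∃ r : ℝ, 0 < r ∧ r ≤ ℓ ∧
    t = Real.log (supGrad u (ball x (10 * n * r)) / supGrad u (ball x r))}

/-- `s`-dimensional Hausdorff content -/
noncomputable def hausdorffContent {n : ℕ} (s : ℝ) (E : Set (EuclideanSpace ℝ (Fin n))) : ℝ≥0∞ :=
  ⨅ (U : ℕ → Set (EuclideanSpace ℝ (Fin n))) (_ : E ⊆ ⋃ i, U i), ∑' i, EMetric.diam (U i) ^ s

/-- Riesz `s`-energy of a measure: `I_s(μ) = ∬ |x-y|^{-s} dμ(x) dμ(y)`. -/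
noncomputable def rieszEnergy {n : ℕ} (s : ℝ) (μ : Measure (EuclideanSpace ℝ (Fin n))) : ℝ≥0∞ :=
  ∫⁻ x, ∫⁻ y, edist x y ^ (-s) ∂μ ∂μ

/-- Riesz `s`-capacity of a set: the sup of `I_s(μ)⁻¹` over probability measures compactly
supported in `E`. -/
noncomputable def rieszCapacity {n : ℕ} (s : ℝ) (E : Set (EuclideanSpace ℝ (Fin n))) : ℝ≥0∞ :=
  ⨆ (μ : Measure (EuclideanSpace ℝ (Fin n)))
    (_ : μ E = 1 ∧ ∃ K, IsCompact K ∧ K ⊆ E ∧ μ Kᶜ = 0), (rieszEnergy s μ)⁻¹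

/-- a function `Fin n → ℝ` regarded as a point of `EuclideanSpace ℝ (Fin n)` -/
noncomputable def vec {n : ℕ} (f : Fin n → ℝ) : EuclideanSpace ℝ (Fin n) :=
  (EuclideanSpace.equiv (Fin n) ℝ).symm f

/-- center of the subcube indexed by `k` when the cube of center `c` and side `ℓ` is divided
into `M^n` congruent subcubes -/
noncomputable def subCenter {n : ℕ} (c : EuclideanSpace ℝ (Fin n)) (ℓ : ℝ) (M : ℕ)
    (k : Fin n → Fin M) : EuclideanSpace ℝ (Fin n) :=
  vec (fun i => c i + (((k i : ℝ) + 1 / 2) / M - 1 / 2) * ℓ)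

/-- the last coordinate index of `Fin n` -/
def lastIdx (n : ℕ) (hn : 0 < n) : Fin n := ⟨n - 1, Nat.sub_lt hn Nat.one_pos⟩

/-- the hyperplane `{xₙ = 0}` -/
def lastHyperplane (n : ℕ) (hn : 0 < n) : Set (EuclideanSpace ℝ (Fin n)) :=
  {x | x (lastIdx n hn) = 0}

section DD
variable {E : Type*} [NormedAddCommGroup E] [NormedSpace ℝ E]

/-- iterated directional derivatives along a list of directions -/
noncomputable def dd (u : E → ℝ) : List E → E → ℝ
  | [] => u
  | v :: l => fun x => fderiv ℝ (dd u l) x v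

lemma dd_nil (u : E → ℝ) : dd u [] = u := rfl

lemma dd_cons (u : E → ℝ) (v : E) (l : List E) :
    dd u (v :: l) = fun x => fderiv ℝ (dd u l) x v := rfl

lemma dd_append (u : E → ℝ) (l l' : List E) : dd u (l ++ l') = dd (dd u l') l := by
  induction l with
  | nil => rfl
  | cons v l ih => simp only [List.cons_append, dd_cons, ih]

lemma dd_smooth {U : Set E} (hU : IsOpen U) {u : E → ℝ} (hu : ContDiffOn ℝ (⊤ : ℕ∞) u U)
    (l : List E) : ContDiffOn ℝ (⊤ : ℕ∞) (dd u l) U := by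
  induction l with
  | nil => exact hu
  | cons v l ih =>
    rw [dd_cons]
    have h := ih.fderiv_of_isOpen (m := (⊤ : ℕ∞)) hU (by simp)
    exact h.clm_apply contDiffOn_const

lemma dd_diffAt {U : Set E} (hU : IsOpen U) {u : E → ℝ} (hu : ContDiffOn ℝ (⊤ : ℕ∞) u U)
    (l : List E) {x : E} (hx : x ∈ U) : DifferentiableAt ℝ (dd u l) x :=
  ((dd_smooth hU hu l).contDiffAt (hU.mem_nhds hx)).differentiableAt (by simp)

lemma fderiv_eqOn {U : Set E} (hU : IsOpen U) {f g : E → ℝ} (h : EqOn f g U) {x : E}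
    (hx : x ∈ U) : fderiv ℝ f x = fderiv ℝ g x :=
  Filter.EventuallyEq.fderiv_eq (Filter.eventuallyEq_of_mem (hU.mem_nhds hx) h)

lemma dd_congr {U : Set E} (hU : IsOpen U) {f g : E → ℝ} (h : EqOn f g U) (l : List E) :
    EqOn (dd f l) (dd g l) U := by
  induction l with
  | nil => exact h
  | cons v l ih =>
    intro x hx
    simp only [dd_cons]
    rw [fderiv_eqOn hU ih hx]

lemma dd_swap {U : Set E} (hU : IsOpen U) {u : E → ℝ} (hu : ContDiffOn ℝ (⊤ : ℕ∞) u U)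
    (v w : E) {x : E} (hx : x ∈ U) :
    dd u [v, w] x = dd u [w, v] x := by
  have hc : ContDiffAt ℝ (⊤ : ℕ∞) u x := hu.contDiffAt (hU.mem_nhds hx)
  have hs : IsSymmSndFDerivAt ℝ u x := hc.isSymmSndFDerivAt
    (by simpa using (show ((2 : ℕ∞) : WithTop ℕ∞) ≤ ((⊤ : ℕ∞) : WithTop ℕ∞) from by exact_mod_cast le_top))
  have hd : DifferentiableAt ℝ (fderiv ℝ u) x :=
    (hc.fderiv_right (m := ((1 : ℕ∞) : WithTop ℕ∞))
      (by exact_mod_cast (le_top : ((1 : ℕ∞) + 1) ≤ ⊤))).differentiableAt (by simp)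
  have key : ∀ a b : E, dd u [a, b] x = fderiv ℝ (fderiv ℝ u) x a b := by
    intro a b
    simp only [dd_cons, dd_nil]
    rw [fderiv_clm_apply hd (differentiableAt_const b)]
    simp
  rw [key, key]
  exact hs v w

lemma dd_perm {U : Set E} (hU : IsOpen U) {u : E → ℝ} (hu : ContDiffOn ℝ (⊤ : ℕ∞) u U)
    {l l' : List E} (h : l.Perm l') : EqOn (dd u l) (dd u l') U := by
  induction h with
  | nil => exact fun _ _ => rfl
  | cons a _ ih =>
    intro x hx
    simp only [dd_cons]
    rw [fderiv_eqOn hU ih hx]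
  | swap a b l =>
    intro x hx
    exact dd_swap hU (dd_smooth hU hu l) b a hx
  | trans _ _ h1 h2 => exact h1.trans h2

lemma dd_eq_iter {U : Set E} (hU : IsOpen U) {u : E → ℝ} (hu : ContDiffOn ℝ (⊤ : ℕ∞) u U)
    (l : List E) : ∀ x ∈ U, dd u l x = iteratedFDeriv ℝ l.length u x l.get := by
  induction l with
  | nil => intro x hx; simp [dd_nil]
  | cons v l ih =>
    intro x hx
    simp only [dd_cons, List.length_cons]
    rw [fderiv_eqOn hU (g := fun y => iteratedFDeriv ℝ l.length u y l.get) ih hx,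
      iteratedFDeriv_succ_apply_left]
    have hd : DifferentiableAt ℝ (iteratedFDeriv ℝ l.length u) x := by
      have hc : ContDiffAt ℝ (⊤ : ℕ∞) u x := hu.contDiffAt (hU.mem_nhds hx)
      refine hc.differentiableAt_iteratedFDeriv ?_
      exact_mod_cast ENat.natCast_lt_top _
    have := (hd.hasFDerivAt.continuousMultilinear_apply_const l.get).fderiv
    rw [this]
    rfl

/-- normalised norm of the k-th derivative; zero for k = 0 -/
noncomputable def bc (u : E → ℝ) (x : E) (k : ℕ) : ℝ :=
  if k = 0 then 0 else ‖iteratedFDeriv ℝ k u x‖ / (k.factorial : ℝ)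

lemma bc_nonneg (u : E → ℝ) (x : E) (k : ℕ) : 0 ≤ bc u x k := by
  unfold bc; split_ifs <;> positivity

lemma bc_zero (u : E → ℝ) (x : E) : bc u x 0 = 0 := by simp [bc]

lemma dd_le_bc {U : Set E} (hU : IsOpen U) {u : E → ℝ} (hu : ContDiffOn ℝ (⊤ : ℕ∞) u U)
    {x : E} (hx : x ∈ U) (l : List E) (hl : l ≠ []) {r : ℝ} (hr : ∀ v ∈ l, ‖v‖ ≤ r) :
    |dd u l x| ≤ (l.length.factorial : ℝ) * (bc u x l.length * r ^ l.length) := by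
  have h0 : l.length ≠ 0 := by simpa using hl
  rw [dd_eq_iter hU hu l x hx, bc, if_neg h0]
  have h1 := (iteratedFDeriv ℝ l.length u x).le_opNorm_mul_pow_of_le (m := l.get) (b := r)
    ((pi_norm_le_iff_of_nonneg ?_).2 fun i => hr _ (List.get_mem l i))
  · rw [Real.norm_eq_abs] at h1
    refine h1.trans (le_of_eq ?_)
    have : (l.length.factorial : ℝ) ≠ 0 := by positivity
    field_simp
  · obtain ⟨v, hv⟩ := List.exists_mem_of_ne_nil l hl
    exact (norm_nonneg v).trans (hr v hv)

lemma bc_le_of_dd {U : Set E} (hU : IsOpen U) {u : E → ℝ} (hu : ContDiffOn ℝ (⊤ : ℕ∞) u U)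
    {x : E} (hx : x ∈ U) {k : ℕ} {r B : ℝ} (hr : 0 < r) (hB : 0 ≤ B)
    (h : ∀ l : List E, l.length = k → (∀ v ∈ l, ‖v‖ ≤ r) → |dd u l x| ≤ (k.factorial : ℝ) * B) :
    bc u x k * r ^ k ≤ B := by
  unfold bc
  split_ifs with h0
  · simpa using hB
  have hb : ‖iteratedFDeriv ℝ k u x‖ ≤ (k.factorial : ℝ) * B / r ^ k := by
    refine ContinuousMultilinearMap.opNorm_le_bound (by positivity) fun m => ?_
    by_cases hz : ∃ i, m i = 0
    · obtain ⟨i, hi⟩ := hz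
      rw [(iteratedFDeriv ℝ k u x).map_coord_zero i hi]
      simp only [norm_zero]
      positivity
    push Not at hz
    have hm : m = fun i => (‖m i‖ / r) • ((r / ‖m i‖) • m i) := by
      funext i
      have := norm_ne_zero_iff.2 (hz i)
      rw [smul_smul]
      field_simp
      simp
    rw [hm, (iteratedFDeriv ℝ k u x).map_smul_univ, norm_smul, ← hm]
    have h2 := h (List.ofFn fun i => (r / ‖m i‖) • m i) (by simp) (by
      intro v hv
      rw [List.mem_ofFn] at hv
      obtain ⟨i, rfl⟩ := hv
      have := norm_pos_iff.2 (hz i)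
      rw [norm_smul, Real.norm_eq_abs, abs_of_pos (by positivity)]
      field_simp
      exact le_rfl)
    rw [dd_eq_iter hU hu _ x hx] at h2
    have h3 : iteratedFDeriv ℝ (List.ofFn fun i => (r / ‖m i‖) • m i).length u x
        (List.ofFn fun i => (r / ‖m i‖) • m i).get =
        iteratedFDeriv ℝ k u x (fun i => (r / ‖m i‖) • m i) := by
      have : ∀ (a : ℕ) (ha : a = k) (f : Fin a → E) (g : Fin k → E)
          (_ : ∀ i, f i = g (Fin.cast ha i)),
          iteratedFDeriv ℝ a u x f = iteratedFDeriv ℝ k u x g := by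
        intro a ha f g hfg
        subst ha
        congr 1
        funext i
        simpa using hfg i
      refine this _ (by simp) _ _ ?_
      intro i
      rw [List.get_ofFn]
    rw [h3] at h2
    rw [Real.norm_eq_abs, Real.norm_eq_abs, Finset.abs_prod]
    have h4 : ∏ i, |‖m i‖ / r| = (∏ i, ‖m i‖) / r ^ k := by
      simp only [abs_div, abs_norm, Finset.prod_div_distrib, abs_of_pos hr]
      simp
    rw [h4]
    calc (∏ i, ‖m i‖) / r ^ k * |_| ≤ (∏ i, ‖m i‖) / r ^ k * ((k.factorial : ℝ) * B) := by
          gcongr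
      _ = _ := by ring
  have hf : (0 : ℝ) < k.factorial := by positivity
  have hrk : 0 < r ^ k := by positivity
  rw [div_mul_eq_mul_div, div_le_iff₀ hf]
  rw [le_div_iff₀ hrk] at hb
  linarith

end DD

lemma harm_fderiv {n : ℕ} {U : Set (EuclideanSpace ℝ (Fin n))} (hU : IsOpen U)
    {u : EuclideanSpace ℝ (Fin n) → ℝ} (hu : IsHarmonicOn u U) (v : EuclideanSpace ℝ (Fin n)) :
    IsHarmonicOn (fun x => fderiv ℝ u x v) U := by
  refine ⟨dd_smooth hU hu.1 [v], fun x hx => ?_⟩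
  have h1 : ∀ i : Fin n, fderiv ℝ (fun y => fderiv ℝ (fun x => fderiv ℝ u x v) y
      (EuclideanSpace.single i 1)) x (EuclideanSpace.single i 1) =
      fderiv ℝ (dd u [EuclideanSpace.single i 1, EuclideanSpace.single i 1]) x v := by
    intro i
    have := dd_perm hU hu.1 (l := [EuclideanSpace.single i 1, EuclideanSpace.single i 1, v])
      (l' := [v, EuclideanSpace.single i 1, EuclideanSpace.single i 1])
      (List.perm_append_comm (l₁ := [EuclideanSpace.single i (1:ℝ), EuclideanSpace.single i 1])
        (l₂ := [v])) hx
    exact this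
  rw [Finset.sum_congr rfl fun i _ => h1 i]
  have h2 : fderiv ℝ (fun y => ∑ i : Fin n,
      dd u [EuclideanSpace.single i 1, EuclideanSpace.single i 1] y) x = 0 := by
    have h3 : EqOn (fun y => ∑ i : Fin n,
      dd u [EuclideanSpace.single i 1, EuclideanSpace.single i 1] y) (fun _ => (0:ℝ)) U :=
      fun y hy => hu.2 y hy
    rw [fderiv_eqOn hU h3 hx]
    simp
  rw [fderiv_fun_sum (fun i _ => dd_diffAt hU hu.1 _ hx)] at h2
  have := congrArg (fun f => f v) h2
  simpa [_root_.sum_apply] using this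

lemma harm_dd {n : ℕ} {U : Set (EuclideanSpace ℝ (Fin n))} (hU : IsOpen U)
    {u : EuclideanSpace ℝ (Fin n) → ℝ} (hu : IsHarmonicOn u U)
    (l : List (EuclideanSpace ℝ (Fin n))) : IsHarmonicOn (dd u l) U := by
  induction l with
  | nil => exact hu
  | cons v l ih => exact harm_fderiv hU ih v

lemma max_1d {φ φ' : ℝ → ℝ} {s : ℝ} (h1 : ∀ᶠ t in nhds 0, HasDerivAt φ (φ' t) t)
    (h2 : HasDerivAt φ' s 0) (hmax : IsLocalMax φ 0) : s ≤ 0 := by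
  by_contra hs
  push Not at hs
  have e1 : deriv φ =ᶠ[nhds 0] φ' := h1.mono fun t ht => ht.deriv
  have e2 : deriv (deriv φ) 0 = s := by rw [e1.deriv_eq]; exact h2.deriv
  have e3 : deriv φ 0 = 0 := hmax.deriv_eq_zero
  have hmin : IsLocalMin φ 0 := isLocalMin_of_deriv_deriv_pos (by rw [e2]; exact hs) e3
    h1.self_of_nhds.continuousAt
  have hc : φ =ᶠ[nhds 0] fun _ => φ 0 := by
    filter_upwards [hmax, hmin] with t ha hb
    exact le_antisymm ha hb
  have hc2 : deriv φ =ᶠ[nhds 0] fun _ => 0 := by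
    have := hc.deriv
    simpa using this
  have : deriv (deriv φ) 0 = 0 := by rw [hc2.deriv_eq]; simp
  linarith

lemma max_principle {n : ℕ} (hn : 0 < n) {K Ω : Set (EuclideanSpace ℝ (Fin n))}
    (hK : IsCompact K) (hO : IsOpen Ω) (hOK : Ω ⊆ K)
    {v : EuclideanSpace ℝ (Fin n) → ℝ} (hv : ContinuousOn v K)
    (d1 d2 : Fin n → EuclideanSpace ℝ (Fin n) → ℝ)
    (h1 : ∀ x ∈ Ω, ∀ i, HasDerivAt (fun t : ℝ => v (x + t • EuclideanSpace.single i 1)) (d1 i x) 0)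
    (h2 : ∀ x ∈ Ω, ∀ i,
      HasDerivAt (fun t : ℝ => d1 i (x + t • EuclideanSpace.single i 1)) (d2 i x) 0)
    (h3 : ∀ x ∈ Ω, 0 ≤ ∑ i, d2 i x)
    (hb : ∀ x ∈ K, x ∉ Ω → v x ≤ 0) : ∀ x ∈ K, v x ≤ 0 := by
  intro x0 hx0
  by_contra hpos
  push Not at hpos
  obtain ⟨D, hD⟩ : ∃ D : ℝ, ∀ x ∈ K, ∑ j, (x j - x0 j) ^ 2 ≤ D := by
    have hc : ContinuousOn (fun x : EuclideanSpace ℝ (Fin n) => ∑ j, (x j - x0 j) ^ 2) K := by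
      fun_prop
    obtain ⟨D, hD⟩ := (hK.image_of_continuousOn hc).bddAbove
    exact ⟨D, fun x hx => hD (mem_image_of_mem _ hx)⟩
  have hD0 : 0 ≤ D := by
    have := hD x0 hx0
    simpa using this
  set ε : ℝ := v x0 / (2 * (D + 1)) with hε
  have hε0 : 0 < ε := by positivity
  have hεD : ε * D < v x0 := by
    rw [hε, div_mul_eq_mul_div, div_lt_iff₀ (by positivity)]
    nlinarith
  set g : EuclideanSpace ℝ (Fin n) → ℝ := fun x => v x + ε * ∑ j, (x j - x0 j) ^ 2 with hg
  have hgc : ContinuousOn g K := by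
    apply hv.add
    fun_prop
  obtain ⟨z, hzK, hz⟩ := hK.exists_isMaxOn ⟨x0, hx0⟩ hgc
  have hzO : z ∈ Ω := by
    by_contra hzn
    have a1 := hb z hzK hzn
    have a2 : g x0 ≤ g z := hz hx0
    have a3 := hD z hzK
    simp only [hg, sub_self] at a2
    have : ε * ∑ j, (z j - x0 j) ^ 2 ≤ ε * D := by gcongr
    simp at a2
    linarith
  have key : ∀ i, d2 i z + 2 * ε ≤ 0 := by
    intro i
    have line : ∀ t : ℝ, ∀ j, (z + t • EuclideanSpace.single i (1:ℝ)) j = z j + if j = i then t else 0 := by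
      intro t j
      by_cases h : j = i <;> simp [h]
    have hcont : Continuous fun t : ℝ => z + t • EuclideanSpace.single i (1:ℝ) := by fun_prop
    have hev : ∀ᶠ t : ℝ in nhds 0, z + t • EuclideanSpace.single i (1:ℝ) ∈ Ω := by
      apply hcont.continuousAt.eventually_mem
      apply hO.mem_nhds
      simpa using hzO
    have hq : ∀ t : ℝ, HasDerivAt
        (fun t : ℝ => ε * ∑ j, ((z + t • EuclideanSpace.single i (1:ℝ)) j - x0 j) ^ 2)
        (ε * (2 * (z i + t - x0 i))) t := by
      intro t
      apply HasDerivAt.const_mul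
      simp only [line]
      have : ∀ j ∈ Finset.univ, HasDerivAt (fun t : ℝ => (z j + (if j = i then t else 0) - x0 j) ^ 2)
          (if j = i then 2 * (z j + t - x0 j) else 0) t := by
        intro j _
        by_cases h : j = i
        · simp only [h, if_true]
          have := (((hasDerivAt_id' t).const_add (z i)).sub_const (x0 i)).fun_pow 2
          exact this.congr_deriv (by simp)
        · simp only [h, if_false]
          exact hasDerivAt_const _ _
      have := HasDerivAt.fun_sum this
      simpa using this
    refine max_1d (φ := fun t : ℝ => g (z + t • EuclideanSpace.single i (1:ℝ)))
      (φ' := fun t => d1 i (z + t • EuclideanSpace.single i (1:ℝ)) + ε * (2 * (z i + t - x0 i)))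
      ?_ ?_ ?_
    · filter_upwards [hev] with t ht
      have a := h1 _ ht i
      have b : HasDerivAt (fun s : ℝ => v (z + s • EuclideanSpace.single i (1:ℝ)))
          (d1 i (z + t • EuclideanSpace.single i (1:ℝ))) t := by
        have a' : HasDerivAt (fun s : ℝ => v (z + t • EuclideanSpace.single i (1:ℝ)
            + s • EuclideanSpace.single i (1:ℝ)))
          (d1 i (z + t • EuclideanSpace.single i (1:ℝ))) (t - t) := by simpa using a
        have := a'.comp_sub_const t t
        have e : (fun s : ℝ => v (z + s • EuclideanSpace.single i (1:ℝ))) =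
            fun x => v (z + t • EuclideanSpace.single i (1:ℝ)
              + (x - t) • EuclideanSpace.single i (1:ℝ)) := by
          funext s
          rw [add_assoc, ← add_smul, add_sub_cancel]
        rw [e]
        exact this
      exact b.add (hq t)
    · have a := h2 z hzO i
      refine a.add ?_
      have := ((((hasDerivAt_id' (0:ℝ)).const_add (z i)).sub_const (x0 i)).const_mul 2).const_mul ε
      exact this.congr_deriv (by ring)
    · have : ∀ᶠ t : ℝ in nhds 0, g (z + t • EuclideanSpace.single i (1:ℝ)) ≤ g z := by
        filter_upwards [hev] with t ht
        exact hz (hOK ht)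
      simpa [IsLocalMax, IsMaxFilter] using this
  have hs : ∑ i, (d2 i z + 2 * ε) ≤ 0 := Finset.sum_nonpos fun i _ => key i
  rw [Finset.sum_add_distrib] at hs
  have := h3 z hzO
  have hn' : (0:ℝ) < n := by exact_mod_cast hn
  simp at hs
  nlinarith [mul_pos hn' hε0]

lemma line_hasDeriv {E : Type*} [NormedAddCommGroup E] [NormedSpace ℝ E] {f : E → ℝ} {y : E}
    (hf : DifferentiableAt ℝ f y) (c : ℝ) (e : E) :
    HasDerivAt (fun t : ℝ => f (y + (c * t) • e)) (c * fderiv ℝ f y e) 0 := by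
  have h1 : HasDerivAt (fun t : ℝ => y + (c * t) • e) (c • e) 0 := by
    have := ((((hasDerivAt_id' (0:ℝ)).const_mul c).smul_const e)).const_add y
    exact this.congr_deriv (by simp)
  have h2 : HasFDerivAt f (fderiv ℝ f y) (y + (c * 0) • e) := by
    simpa using hf.hasFDerivAt
  have := h2.comp_hasDerivAt (0:ℝ) h1
  exact this.congr_deriv (by simp)

lemma norm_le_of_coord {n : ℕ} {x : EuclideanSpace ℝ (Fin n)} {d : ℝ} (h : ∀ j, |x j| ≤ d) :
    ‖x‖ ≤ n * d := by
  have hx : x = ∑ j, x j • EuclideanSpace.single j (1:ℝ) := by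
    ext k
    simp [Finset.sum_apply, Pi.single_apply]
  calc ‖x‖ = ‖∑ j, x j • EuclideanSpace.single j (1:ℝ)‖ := by rw [← hx]
    _ ≤ ∑ j, ‖x j • EuclideanSpace.single j (1:ℝ)‖ := norm_sum_le _ _
    _ ≤ ∑ _j : Fin n, d := by
        refine Finset.sum_le_sum fun j _ => ?_
        rw [norm_smul]
        simpa using h j
    _ = n * d := by simp

lemma grad_est0 {n : ℕ} (hn : 0 < n) {p : EuclideanSpace ℝ (Fin n)} {d M : ℝ} (hd : 0 < d)
    (hM : 0 ≤ M) {U : Set (EuclideanSpace ℝ (Fin n))} (hU : IsOpen U)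
    (hKU : ∀ x : EuclideanSpace ℝ (Fin n), (∀ j, |x j - p j| ≤ d) → x ∈ U)
    {h : EuclideanSpace ℝ (Fin n) → ℝ} (hh : IsHarmonicOn h U) (hb : ∀ x ∈ U, |h x| ≤ M)
    (i : Fin n) {t : ℝ} (ht0 : 0 < t) (htd : t < d) :
    (1 / 2) * (h (p + t • EuclideanSpace.single i 1) - h (p + (-t) • EuclideanSpace.single i 1))
      ≤ n * M / d * t := by
  set R : EuclideanSpace ℝ (Fin n) → EuclideanSpace ℝ (Fin n) := fun x =>
    x - (2 * (x i - p i)) • EuclideanSpace.single i (1:ℝ) with hR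
  set s : Fin n → ℝ := fun j => if j = i then -1 else 1 with hs
  have Rcoord : ∀ x j, R x j - p j = s j * (x j - p j) := by
    intro x j
    by_cases hj : j = i
    · subst hj; simp [hR, hs]; ring
    · simp [hR, hs, hj]
  have sabs : ∀ j, |s j| = 1 := by
    intro j; by_cases hj : j = i <;> simp [hs, hj]
  have ssq : ∀ j, s j * s j = 1 := by
    intro j; by_cases hj : j = i <;> simp [hs, hj]
  have Rline : ∀ x (t : ℝ) j, R (x + t • EuclideanSpace.single j (1:ℝ)) =
      R x + (s j * t) • EuclideanSpace.single j (1:ℝ) := by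
    intro x t j
    ext k
    have e1 := Rcoord (x + t • EuclideanSpace.single j (1:ℝ)) k
    have e2 := Rcoord x k
    have e3 : (R x + (s j * t) • EuclideanSpace.single j (1:ℝ)) k = R x k + s j * t *
        (EuclideanSpace.single j (1:ℝ)) k := by simp
    have e4 : (x + t • EuclideanSpace.single j (1:ℝ)) k = x k + t *
        (EuclideanSpace.single j (1:ℝ)) k := by simp
    rw [e3]
    rw [e4] at e1
    by_cases hk : k = j
    · subst hk
      simp at e1 ⊢
      linarith
    · simp [hk] at e1 ⊢
      linarith
  set K : Set (EuclideanSpace ℝ (Fin n)) := {x | (∀ j, |x j - p j| ≤ d) ∧ p i ≤ x i} with hK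
  set Ω : Set (EuclideanSpace ℝ (Fin n)) := {x | (∀ j, |x j - p j| < d) ∧ p i < x i} with hΩ
  have hRU : ∀ x ∈ K, R x ∈ U := by
    intro x hx
    apply hKU
    intro j
    rw [Rcoord, abs_mul, sabs, one_mul]
    exact hx.1 j
  have hKU' : K ⊆ U := fun x hx => hKU x hx.1
  have hΩK : Ω ⊆ K := fun x hx => ⟨fun j => (hx.1 j).le, hx.2.le⟩
  have hKc : IsCompact K := by
    apply Metric.isCompact_of_isClosed_isBounded
    · have : K = (⋂ j, {x : EuclideanSpace ℝ (Fin n) | |x j - p j| ≤ d}) ∩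
          {x : EuclideanSpace ℝ (Fin n) | p i ≤ x i} := by
        ext x; simp [hK]
      rw [this]
      refine IsClosed.inter (isClosed_iInter fun j => isClosed_le (by fun_prop) continuous_const)
        (isClosed_le continuous_const (by fun_prop))
    · refine (Metric.isBounded_closedBall (x := p) (r := n * d)).subset ?_
      intro x hx
      rw [mem_closedBall, dist_eq_norm]
      exact norm_le_of_coord fun j => by simpa using hx.1 j
  have hΩo : IsOpen Ω := by
    have : Ω = (⋂ j, {x : EuclideanSpace ℝ (Fin n) | |x j - p j| < d}) ∩
          {x : EuclideanSpace ℝ (Fin n) | p i < x i} := by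
        ext x; simp [hΩ]
    rw [this]
    refine IsOpen.inter (isOpen_iInter_of_finite fun j => isOpen_lt (by fun_prop) continuous_const)
        (isOpen_lt continuous_const (by fun_prop))
  have hRc : Continuous R := by
    simp only [hR]; fun_prop
  set v : EuclideanSpace ℝ (Fin n) → ℝ := fun x => 1 / 2 * (h x - h (R x)) -
    M / d ^ 2 * (∑ j, (x j - p j) ^ 2 + n * ((x i - p i) * (d - (x i - p i)))) with hv
  have hvc : ContinuousOn v K := by
    have c1 : ContinuousOn h K := hh.1.continuousOn.mono hKU'
    have c2 : ContinuousOn (fun x => h (R x)) K :=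
      hh.1.continuousOn.comp hRc.continuousOn hRU
    exact ((c1.sub c2).const_smul (1/2 : ℝ)).sub (by fun_prop)
  have hdiff : ∀ l : List (EuclideanSpace ℝ (Fin n)), ∀ x ∈ U, DifferentiableAt ℝ (dd h l) x :=
    fun l x hx => dd_diffAt hU hh.1 l hx
  have key := max_principle hn hKc hΩo hΩK hvc
    (fun j x => 1 / 2 * (dd h [EuclideanSpace.single j 1] x
        - s j * dd h [EuclideanSpace.single j 1] (R x)) -
      M / d ^ 2 * (2 * (x j - p j) + if j = i then n * (d - 2 * (x i - p i)) else 0))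
    (fun j x => 1 / 2 * (dd h [EuclideanSpace.single j 1, EuclideanSpace.single j 1] x
        - dd h [EuclideanSpace.single j 1, EuclideanSpace.single j 1] (R x)) -
      M / d ^ 2 * (2 + if j = i then - 2 * (n : ℝ) else 0)) ?_ ?_ ?_ ?_
  · -- conclusion
    have hx : p + t • EuclideanSpace.single i (1:ℝ) ∈ K := by
      refine ⟨fun j => ?_, ?_⟩
      · by_cases hj : j = i
        · subst hj; simp [abs_of_pos ht0, htd.le]
        · simp [hj, hd.le]
      · simp [ht0.le]
    have := key _ hx
    simp only [hv] at this
    have hRt : R (p + t • EuclideanSpace.single i (1:ℝ)) =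
        p + (-t) • EuclideanSpace.single i (1:ℝ) := by
      rw [Rline]
      congr 1
      · simp [hR]
      · simp [hs]
    rw [hRt] at this
    have hsum : ∑ j, ((p + t • EuclideanSpace.single i (1:ℝ)) j - p j) ^ 2 = t ^ 2 := by
      rw [Finset.sum_eq_single i]
      · simp
      · intro j _ hj; simp [hj]
      · simp
    rw [hsum] at this
    have e5 : (p + t • EuclideanSpace.single i (1:ℝ)) i - p i = t := by simp
    rw [e5] at this
    have hn1 : (1:ℝ) ≤ n := by exact_mod_cast hn
    have e6 : M / d ^ 2 * (t ^ 2 + n * (t * (d - t))) ≤ n * M / d * t := by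
      have : n * M / d * t = M / d ^ 2 * (n * d * t) := by field_simp
      rw [this]
      apply mul_le_mul_of_nonneg_left _ (by positivity)
      nlinarith [mul_nonneg (sub_nonneg.2 hn1) (sq_nonneg t)]
    linarith
  · intro x hx j
    have hxU := hKU' (hΩK hx)
    have a1 := line_hasDeriv (hdiff [] x hxU) 1 (EuclideanSpace.single j (1:ℝ))
    have a2 := line_hasDeriv (hdiff [] _ (hRU x (hΩK hx))) (s j) (EuclideanSpace.single j (1:ℝ))
    simp only [one_mul, dd_nil] at a1 a2
    have a3 : HasDerivAt (fun t : ℝ => ∑ k, ((x + t • EuclideanSpace.single j (1:ℝ)) k - p k) ^ 2)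
        (2 * (x j - p j)) 0 := by
      have : ∀ k ∈ Finset.univ, HasDerivAt (fun t : ℝ =>
          ((x + t • EuclideanSpace.single j (1:ℝ)) k - p k) ^ 2)
          (if k = j then 2 * (x j - p j) else 0) 0 := by
        intro k _
        by_cases hk : k = j
        · subst hk
          have := (((hasDerivAt_id' (0:ℝ)).const_add (x k)).sub_const (p k)).fun_pow 2
          simpa using this.congr_deriv (by simp : _ = 2 * (x k - p k))
        · simp [hk]
          exact hasDerivAt_const _ _
      have := HasDerivAt.fun_sum this
      simpa using this
    have a4 : HasDerivAt (fun t : ℝ => (n:ℝ) * (((x + t • EuclideanSpace.single j (1:ℝ)) i - p i) *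
        (d - ((x + t • EuclideanSpace.single j (1:ℝ)) i - p i))))
        (if j = i then n * (d - 2 * (x i - p i)) else 0) 0 := by
      by_cases hk : j = i
      · subst hk
        have b1 := (((hasDerivAt_id' (0:ℝ)).const_add (x j)).sub_const (p j))
        have := (b1.fun_mul (b1.const_sub d)).const_mul (n:ℝ)
        simp only [if_true]
        have e : (fun t : ℝ => (n:ℝ) * (((x + t • EuclideanSpace.single j (1:ℝ)) j - p j) *
          (d - ((x + t • EuclideanSpace.single j (1:ℝ)) j - p j)))) =
          fun t : ℝ => (n:ℝ) * ((x j + t - p j) * (d - (x j + t - p j))) := by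
          funext t; simp
        rw [e]
        exact this.congr_deriv (by ring)
      · have hk' : ¬ i = j := fun h => hk h.symm
        simp [hk, hk']
        exact hasDerivAt_const _ _
    have e7 : (fun t : ℝ => h (R (x + t • EuclideanSpace.single j (1:ℝ)))) =
        fun t : ℝ => h (R x + (s j * t) • EuclideanSpace.single j (1:ℝ)) := by
      funext t; rw [Rline]
    have a2' : HasDerivAt (fun t : ℝ => h (R (x + t • EuclideanSpace.single j (1:ℝ))))
      (s j * dd h [EuclideanSpace.single j 1] (R x)) 0 := by rw [e7]; exact a2
    exact ((a1.fun_sub a2').const_mul (1/2)).fun_sub ((a3.fun_add a4).const_mul (M / d ^ 2))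
  · intro x hx j
    have hxU := hKU' (hΩK hx)
    have a1 := line_hasDeriv (hdiff [EuclideanSpace.single j (1:ℝ)] x hxU) 1
      (EuclideanSpace.single j (1:ℝ))
    have a2 := line_hasDeriv (hdiff [EuclideanSpace.single j (1:ℝ)] _ (hRU x (hΩK hx))) (s j)
      (EuclideanSpace.single j (1:ℝ))
    simp only [one_mul] at a1
    have e7 : (fun t : ℝ => dd h [EuclideanSpace.single j (1:ℝ)]
        (R (x + t • EuclideanSpace.single j (1:ℝ)))) =
        fun t : ℝ => dd h [EuclideanSpace.single j (1:ℝ)]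
          (R x + (s j * t) • EuclideanSpace.single j (1:ℝ)) := by
      funext t; rw [Rline]
    have a2' : HasDerivAt (fun t : ℝ => s j * dd h [EuclideanSpace.single j (1:ℝ)]
        (R (x + t • EuclideanSpace.single j (1:ℝ))))
      (dd h [EuclideanSpace.single j 1, EuclideanSpace.single j 1] (R x)) 0 := by
      apply HasDerivAt.congr_deriv (f' := s j * (s j *
        dd h [EuclideanSpace.single j 1, EuclideanSpace.single j 1] (R x)))
      · apply HasDerivAt.const_mul
        rw [e7]; exact a2
      · rw [← mul_assoc, ssq, one_mul]
    have a3 : HasDerivAt (fun t : ℝ => 2 * ((x + t • EuclideanSpace.single j (1:ℝ)) j - p j)) 2 0 := by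
      have := ((((hasDerivAt_id' (0:ℝ)).const_add (x j)).sub_const (p j))).const_mul 2
      simpa using this.congr_deriv (by simp : _ = (2:ℝ))
    have a4 : HasDerivAt (fun t : ℝ => if j = i then
        (n:ℝ) * (d - 2 * ((x + t • EuclideanSpace.single j (1:ℝ)) i - p i)) else 0)
        (if j = i then - 2 * (n:ℝ) else 0) 0 := by
      by_cases hk : j = i
      · subst hk
        have b1 := (((hasDerivAt_id' (0:ℝ)).const_add (x j)).sub_const (p j))
        have := ((b1.const_mul 2).const_sub d).const_mul (n:ℝ)
        simp only [if_true]
        have e : (fun t : ℝ => (n:ℝ) * (d - 2 * ((x + t • EuclideanSpace.single j (1:ℝ)) j - p j))) =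
          fun t : ℝ => (n:ℝ) * (d - 2 * (x j + t - p j)) := by
          funext t; simp
        rw [e]
        exact this.congr_deriv (by ring)
      · simp only [hk, if_false]
        exact hasDerivAt_const _ _
    exact ((a1.fun_sub a2').const_mul (1/2)).fun_sub ((a3.fun_add a4).const_mul (M / d ^ 2))
  · intro x hx
    have hxU := hKU' (hΩK hx)
    have b1 := hh.2 x hxU
    have b2 := hh.2 _ (hRU x (hΩK hx))
    have b1' : ∑ j, dd h [EuclideanSpace.single j 1, EuclideanSpace.single j 1] x = 0 := b1
    have b2' : ∑ j, dd h [EuclideanSpace.single j 1, EuclideanSpace.single j 1] (R x) = 0 := b2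
    rw [Finset.sum_sub_distrib, ← Finset.mul_sum, Finset.sum_sub_distrib, b1', b2',
      ← Finset.mul_sum, Finset.sum_add_distrib]
    simp
    apply le_of_eq
    ring
  · intro x hx hxn
    have hxi : 0 ≤ x i - p i := sub_nonneg.2 hx.2
    have hxd : x i - p i ≤ d := (le_abs_self _).trans (hx.1 i)
    have hnn : (0:ℝ) ≤ n * ((x i - p i) * (d - (x i - p i))) := by
      have : 0 ≤ d - (x i - p i) := by linarith
      positivity
    have hsq : 0 ≤ ∑ j, (x j - p j) ^ 2 := Finset.sum_nonneg fun j _ => sq_nonneg _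
    simp only [hv]
    by_cases hz : x i = p i
    · have : R x = x := by simp [hR, hz]
      rw [this]
      have : 0 ≤ M / d ^ 2 * (∑ j, (x j - p j) ^ 2 + n * ((x i - p i) * (d - (x i - p i)))) := by
        positivity
      linarith
    · have : ∃ j, d ≤ |x j - p j| := by
        by_contra hcon
        push Not at hcon
        exact hxn ⟨hcon, lt_of_le_of_ne hx.2 (Ne.symm hz)⟩
      obtain ⟨j, hj⟩ := this
      have c1 : d ^ 2 ≤ ∑ j, (x j - p j) ^ 2 := by
        calc d ^ 2 ≤ |x j - p j| ^ 2 := by gcongr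
          _ = (x j - p j) ^ 2 := sq_abs _
          _ ≤ _ := Finset.single_le_sum (f := fun j => (x j - p j) ^ 2)
            (fun j _ => sq_nonneg _) (Finset.mem_univ j)
      have c2 : M ≤ M / d ^ 2 * (∑ j, (x j - p j) ^ 2 + n * ((x i - p i) * (d - (x i - p i)))) := by
        calc M = M / d ^ 2 * d ^ 2 := by field_simp
          _ ≤ _ := by
            apply mul_le_mul_of_nonneg_left _ (by positivity)
            linarith
      have c3 := abs_le.1 (hb x (hKU' hx))
      have c4 := abs_le.1 (hb _ (hRU x hx))
      linarith

lemma harm_neg {n : ℕ} {U : Set (EuclideanSpace ℝ (Fin n))}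
    {u : EuclideanSpace ℝ (Fin n) → ℝ} (hu : IsHarmonicOn u U) :
    IsHarmonicOn (fun x => - u x) U := by
  refine ⟨hu.1.neg, fun x hx => ?_⟩
  have := hu.2 x hx
  simp only [fderiv_fun_neg, _root_.neg_apply]
  rw [Finset.sum_neg_distrib, this, neg_zero]

lemma harm_mono {n : ℕ} {U V : Set (EuclideanSpace ℝ (Fin n))} (h : V ⊆ U)
    {u : EuclideanSpace ℝ (Fin n) → ℝ} (hu : IsHarmonicOn u U) : IsHarmonicOn u V :=
  ⟨hu.1.mono h, fun x hx => hu.2 x (h hx)⟩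

lemma grad_est1 {n : ℕ} (hn : 0 < n) {p : EuclideanSpace ℝ (Fin n)} {r M : ℝ} (hr : 0 < r)
    (hM : 0 ≤ M) {h : EuclideanSpace ℝ (Fin n) → ℝ} (hh : IsHarmonicOn h (ball p r))
    (hb : ∀ x ∈ ball p r, |h x| ≤ M) (i : Fin n) :
    fderiv ℝ h p (EuclideanSpace.single i 1) ≤ 2 * n ^ 2 * M / r := by
  have hn1 : (1:ℝ) ≤ n := by exact_mod_cast hn
  have hn0 : (0:ℝ) < n := by linarith
  have hd : 0 < r / (2 * n) := by positivity
  have hdiff : DifferentiableAt ℝ h p :=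
    (hh.1.contDiffAt (isOpen_ball.mem_nhds (mem_ball_self hr))).differentiableAt (by simp)
  have key : ∀ t, 0 < t → t < r / (2 * n) → 
      (1 / 2) * (h (p + t • EuclideanSpace.single i 1) - h (p + (-t) • EuclideanSpace.single i 1))
      ≤ n * M / (r / (2 * n)) * t := by
    intro t h1 h2
    refine grad_est0 hn hd hM isOpen_ball ?_ hh hb i h1 h2
    intro x hx
    rw [mem_ball, dist_eq_norm]
    have := norm_le_of_coord (x := x - p) (d := r / (2 * n)) (fun j => by simpa using hx j)
    have e : n * (r / (2 * n)) = r / 2 := by field_simp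
    linarith
  have l1 := line_hasDeriv hdiff 1 (EuclideanSpace.single i (1:ℝ))
  have l2 := line_hasDeriv hdiff (-1) (EuclideanSpace.single i (1:ℝ))
  have l3 := (l1.fun_sub l2).const_mul (1/2)
  have e3 : (1:ℝ)/2 * (1 * fderiv ℝ h p (EuclideanSpace.single i 1) -
    -1 * fderiv ℝ h p (EuclideanSpace.single i 1)) = fderiv ℝ h p (EuclideanSpace.single i 1) := by
    ring
  rw [e3] at l3
  have l4 := l3.tendsto_slope_zero_right
  have e4 : 2 * n ^ 2 * M / r = n * M / (r / (2 * n)) := by field_simp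
  rw [e4]
  refine le_of_tendsto l4 ?_
  filter_upwards [Ioo_mem_nhdsGT hd] with t ht
  have := key t ht.1 ht.2
  simp only [zero_add, one_mul, neg_mul, mul_zero, neg_zero, zero_smul, add_zero, sub_self, sub_zero,
    smul_eq_mul]
  rw [inv_mul_le_iff₀ ht.1]
  linarith

lemma grad_est {n : ℕ} (hn : 0 < n) {p : EuclideanSpace ℝ (Fin n)} {r M : ℝ} (hr : 0 < r)
    (hM : 0 ≤ M) {h : EuclideanSpace ℝ (Fin n) → ℝ} (hh : IsHarmonicOn h (ball p r))
    (hb : ∀ x ∈ ball p r, |h x| ≤ M) (v : EuclideanSpace ℝ (Fin n)) (hv : ‖v‖ ≤ 1) :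
    |fderiv ℝ h p v| ≤ 2 * n ^ 3 * M / r := by
  have key : ∀ i, |fderiv ℝ h p (EuclideanSpace.single i 1)| ≤ 2 * n ^ 2 * M / r := by
    intro i
    rw [abs_le]
    constructor
    · have := grad_est1 hn hr hM (harm_neg hh) (by simpa using hb) i
      rw [fderiv_fun_neg, _root_.neg_apply] at this
      linarith
    · exact grad_est1 hn hr hM hh hb i
  have hx : v = ∑ j, v j • EuclideanSpace.single j (1:ℝ) := by
    ext k
    simp [Finset.sum_apply, Pi.single_apply]
  have hvj : ∀ j, |v j| ≤ 1 := fun j => (EuclideanSpace.norm_eq v ▸ by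
    have := PiLp.norm_apply_le v j
    rw [Real.norm_eq_abs, EuclideanSpace.norm_eq] at this
    exact this : |v j| ≤ ‖v‖).trans hv
  calc |fderiv ℝ h p v| = |∑ j, v j * fderiv ℝ h p (EuclideanSpace.single j (1:ℝ))| := by
        conv_lhs => rw [hx]
        rw [map_sum]; simp
    _ ≤ ∑ j, |v j * fderiv ℝ h p (EuclideanSpace.single j (1:ℝ))| := Finset.abs_sum_le_sum_abs _ _
    _ ≤ ∑ _j : Fin n, 2 * n ^ 2 * M / r := by
        refine Finset.sum_le_sum fun j _ => ?_
        rw [abs_mul]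
        calc |v j| * _ ≤ 1 * (2 * n ^ 2 * M / r) :=
              mul_le_mul (hvj j) (key j) (abs_nonneg _) zero_le_one
          _ = _ := one_mul _
    _ = 2 * n ^ 3 * M / r := by simp; ring

/-- iterated gradient estimate with step `s` -/
lemma cauchy_iter {n : ℕ} (hn : 0 < n) {s G : ℝ} (hs : 0 < s) (hG : 0 ≤ G)
    {u : EuclideanSpace ℝ (Fin n) → ℝ} (k : ℕ) : ∀ (p : EuclideanSpace ℝ (Fin n)) (r : ℝ),
    k * s < r → IsHarmonicOn u (ball p r) → (∀ x ∈ ball p r, ‖fderiv ℝ u x‖ ≤ G) →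
    ∀ l : List (EuclideanSpace ℝ (Fin n)), l.length = k + 1 → (∀ v ∈ l, ‖v‖ ≤ 1) →
    |dd u l p| ≤ (2 * n ^ 3 / s) ^ k * G := by
  induction k with
  | zero =>
    intro p r hr hu hb l hl hv
    obtain ⟨v, rfl⟩ := List.length_eq_one_iff.1 hl
    simp only [dd_cons, dd_nil, pow_zero, one_mul]
    have h1 := (fderiv ℝ u p).le_opNorm v
    have h2 := hb p (mem_ball_self (by simpa using hr))
    have h3 := hv v (by simp)
    rw [Real.norm_eq_abs] at h1
    refine h1.trans ?_
    calc _ ≤ G * 1 := mul_le_mul h2 h3 (norm_nonneg _) hG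
      _ = G := mul_one _
  | succ k ih =>
    intro p r hr hu hb l hl hv
    match l, hl with
    | v :: l, hl =>
      simp only [dd_cons]
      have hl' : l.length = k + 1 := by simpa using hl
      push_cast at hr
      have hks : (0:ℝ) ≤ k * s := by positivity
      have hsr : s < r := by nlinarith
      have := grad_est hn (p := p) hs (M := (2 * n ^ 3 / s) ^ k * G) (by positivity)
        (harm_mono (ball_subset_ball hsr.le) (harm_dd isOpen_ball hu l)) ?_ v (hv v (by simp))
      · calc _ ≤ _ := this
          _ = _ := by rw [pow_succ]; ring
      · intro x hx
        refine ih x (r - s) (by linarith) (harm_mono ?_ hu) ?_ l hl' (fun w hw => hv w (by simp [hw]))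
        · intro y hy
          rw [mem_ball] at *
          linarith [dist_triangle y x p]
        · intro y hy
          apply hb
          rw [mem_ball] at *
          linarith [dist_triangle y x p]

/-- the Cauchy constant -/
noncomputable def Lam (n : ℕ) : ℝ := 12 * n ^ 3

lemma cauchy {n : ℕ} (hn : 0 < n) {r G : ℝ} (hr : 0 < r) (hG : 0 ≤ G)
    {u : EuclideanSpace ℝ (Fin n) → ℝ} {p : EuclideanSpace ℝ (Fin n)}
    (hu : IsHarmonicOn u (ball p r)) (hb : ∀ x ∈ ball p r, ‖fderiv ℝ u x‖ ≤ G) (k : ℕ) :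
    bc u p k * (r / Lam n) ^ k ≤ (r / Lam n) * G := by
  have hn1 : (1:ℝ) ≤ n := by exact_mod_cast hn
  have hn0 : (0:ℝ) < n := by linarith
  have hL : 0 < Lam n := by unfold Lam; positivity
  rcases k with _ | k
  · simp [bc_zero]; positivity
  have hk1 : (0:ℝ) < k + 1 := by positivity
  have hs : 0 < r / (k + 1) := by positivity
  have h1 : bc u p (k+1) * 1 ^ (k+1) ≤ (2 * n ^ 3 / (r / (k+1))) ^ k * G / (k+1).factorial := by
    refine bc_le_of_dd isOpen_ball hu.1 (mem_ball_self hr) one_pos (by positivity) ?_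
    intro l hl hv
    have h2 := cauchy_iter hn hs hG k p r ?_ hu hb l hl hv
    · refine h2.trans (le_of_eq ?_)
      field_simp
    · rw [← mul_div_assoc, div_lt_iff₀ hk1]; nlinarith
  rw [one_pow, mul_one] at h1
  have h3 : ((k:ℝ) + 1) ^ k / (k+1).factorial ≤ 6 ^ k := by
    rcases Nat.eq_zero_or_pos k with rfl | hkp
    · simp
    have := Real.pow_div_factorial_le_exp ((k:ℝ) + 1) (by positivity) k
    have h4 : Real.exp ((k:ℝ)+1) ≤ 3 ^ (k+1) := by
      have : ((k:ℝ)+1) = ((k+1:ℕ):ℝ) * 1 := by push_cast; ring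
      rw [this, Real.exp_nat_mul]
      gcongr
      linarith [Real.exp_one_lt_d9]
    have h5 : ((k+1).factorial : ℝ) = (k+1) * k.factorial := by
      rw [Nat.factorial_succ]; push_cast; ring
    rw [h5]
    have h6 : (0:ℝ) < k.factorial := by positivity
    have h7 : (3:ℝ) ^ (k+1) ≤ (k+1) * 6 ^ k := by
      have h8 : (3:ℝ) ≤ (k+1) * 2 ^ k := by
        have a1 : (1:ℝ) ≤ k := by exact_mod_cast hkp
        have a2 : (2:ℝ) ^ 1 ≤ 2 ^ k := pow_le_pow_right₀ (by norm_num) hkp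
        nlinarith
      have h9 : (6:ℝ) ^ k = 2 ^ k * 3 ^ k := by rw [← mul_pow]; norm_num
      rw [h9, pow_succ, ← mul_assoc, mul_comm]
      gcongr
    rw [div_le_iff₀ (by positivity)]
    rw [div_le_iff₀ h6] at this
    nlinarith
  calc bc u p (k+1) * (r / Lam n) ^ (k+1)
      ≤ (2 * n ^ 3 / (r / (k+1))) ^ k * G / (k+1).factorial * (r / Lam n) ^ (k+1) := by gcongr
    _ = (2 * n ^ 3 / r * (r / Lam n)) ^ k * (((k:ℝ) + 1) ^ k / (k+1).factorial) *
          ((r / Lam n) * G) := by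
        rw [show 2 * (n:ℝ) ^ 3 / (r / (k+1)) = 2 * n ^ 3 / r * (k+1) by field_simp, mul_pow,
          mul_pow, pow_succ]
        ring
    _ ≤ (2 * n ^ 3 / r * (r / Lam n)) ^ k * 6 ^ k * ((r / Lam n) * G) := by gcongr
    _ = (r / Lam n) * G := by
        rw [← mul_pow]
        have : 2 * (n:ℝ) ^ 3 / r * (r / Lam n) * 6 = 1 := by
          unfold Lam; field_simp; norm_num
        rw [this, one_pow, one_mul]

lemma taylor1d (J : ℕ) : ∀ (g : ℕ → ℝ → ℝ) (B : ℝ),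
    (∀ j < J, ∀ t ∈ Icc (0:ℝ) 1, HasDerivAt (g j) (g (j+1) t) t) →
    (∀ t ∈ Icc (0:ℝ) 1, |g J t| ≤ B) → ∀ t ∈ Icc (0:ℝ) 1,
    |g 0 t - ∑ j ∈ Finset.range J, g j 0 * t ^ j / (j.factorial : ℝ)| ≤ B * t ^ J / (J.factorial : ℝ) := by
  induction J with
  | zero => intro g B _ h t ht; simpa using h t ht
  | succ J ih =>
    intro g B h1 h2 t ht
    have ih' := ih (fun j => g (j+1)) B (fun j hj => h1 (j+1) (by omega)) h2
    have hder : ∀ x ∈ Icc (0:ℝ) 1, HasDerivAt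
        (fun t => g 0 t - ∑ j ∈ Finset.range (J+1), g j 0 * t ^ j / (j.factorial : ℝ))
        (g 1 x - ∑ j ∈ Finset.range J, g (j+1) 0 * x ^ j / (j.factorial : ℝ)) x := by
      intro x hx
      refine (h1 0 (by omega) x hx).fun_sub ?_
      have : ∀ j ∈ Finset.range (J+1), HasDerivAt (fun t : ℝ => g j 0 * t ^ j / (j.factorial : ℝ))
          (g j 0 * (j * x ^ (j-1)) / (j.factorial : ℝ)) x := fun j _ =>
        ((hasDerivAt_pow j x).const_mul (g j 0)).div_const _
      refine (HasDerivAt.fun_sum this).congr_deriv ?_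
      rw [Finset.sum_range_succ']
      simp only [CharP.cast_eq_zero, zero_mul, mul_zero, zero_div, add_zero]
      refine Finset.sum_congr rfl fun j _ => ?_
      rw [Nat.factorial_succ]
      have : ((j:ℝ)+1) ≠ 0 := by positivity
      push_cast
      field_simp
    have hB : ∀ x, HasDerivAt (fun t : ℝ => B * t ^ (J+1) / ((J+1).factorial : ℝ))
        (B * x ^ J / (J.factorial : ℝ)) x := by
      intro x
      refine (((hasDerivAt_pow (J+1) x).const_mul B).div_const _).congr_deriv ?_
      rw [Nat.factorial_succ]
      push_cast
      field_simp
    have key := image_norm_le_of_norm_deriv_right_le_deriv_boundary (a := 0) (b := 1)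
      (f := fun t => g 0 t - ∑ j ∈ Finset.range (J+1), g j 0 * t ^ j / (j.factorial : ℝ))
      (f' := fun x => g 1 x - ∑ j ∈ Finset.range J, g (j+1) 0 * x ^ j / (j.factorial : ℝ))
      (B := fun t : ℝ => B * t ^ (J+1) / ((J+1).factorial : ℝ))
      (B' := fun x : ℝ => B * x ^ J / (J.factorial : ℝ))
      (fun x hx => (hder x hx).continuousAt.continuousWithinAt)
      (fun x hx => (hder x ⟨hx.1, hx.2.le⟩).hasDerivWithinAt)
      (by simp [Finset.sum_range_succ']) hB
      (fun x hx => ih' x ⟨hx.1, hx.2.le⟩) ht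
    exact key

structure TS {E : Type*} [NormedAddCommGroup E] [NormedSpace ℝ E] (u : E → ℝ) (U V : Set E)
    (G S : ℝ) : Prop where
  hU : IsOpen U
  hu : ContDiffOn ℝ (⊤ : ℕ∞) u U
  hVU : V ⊆ U
  hV : Convex ℝ V
  hG : 0 ≤ G
  hS : 0 < S
  hb : ∀ y ∈ V, ∀ k, bc u y k ≤ G * S ^ k

section
variable {E : Type*} [NormedAddCommGroup E] [NormedSpace ℝ E] {u : E → ℝ} {U V : Set E} {G S : ℝ}

lemma fac_choose_le (l b : ℕ) : ((l+b).factorial : ℝ) / (l.factorial : ℝ) ≤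
    2 ^ (l+b) * (b.factorial : ℝ) := by
  rw [div_le_iff₀ (by positivity)]
  have h1 : ((l+b).choose b) ≤ 2 ^ (l+b) := Nat.choose_le_two_pow _ _
  have h2 : (l+b).choose b * b.factorial * l.factorial = (l+b).factorial := by
    have := Nat.choose_mul_factorial_mul_factorial (n := l+b) (k := b) (by omega)
    simpa using this
  have h3 : ((l+b).factorial) ≤ 2 ^ (l+b) * b.factorial * l.factorial := by
    rw [← h2]; gcongr
  exact_mod_cast h3

lemma rep_bound {p : E} (hU : IsOpen U) (hu : ContDiffOn ℝ (⊤ : ℕ∞) u U) (hp : p ∈ U) {L : List E}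
    (hL : L ≠ []) {d : ℝ} {e : E} (he : ‖e‖ ≤ d) (hLd : ∀ v ∈ L, ‖v‖ ≤ d) (l : ℕ) :
    |dd u (List.replicate l e ++ L) p| / (l.factorial : ℝ) ≤
      (L.length.factorial : ℝ) * (2 ^ (l + L.length) * (bc u p (l + L.length) * d ^ (l + L.length))) := by
  have hd : 0 ≤ d := (norm_nonneg _).trans he
  have h1 := dd_le_bc hU hu hp (List.replicate l e ++ L) (by simp [hL]) (r := d) (by
    intro v hv
    rw [List.mem_append] at hv
    rcases hv with hv | hv
    · rw [List.eq_of_mem_replicate hv]; exact he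
    · exact hLd v hv)
  simp only [List.length_append, List.length_replicate] at h1
  have h2 := fac_choose_le l L.length
  have h3 : 0 ≤ bc u p (l + L.length) * d ^ (l + L.length) :=
    mul_nonneg (bc_nonneg _ _ _) (by positivity)
  calc _ ≤ ((l + L.length).factorial : ℝ) * (bc u p (l + L.length) * d ^ (l + L.length)) /
        (l.factorial : ℝ) := by gcongr
    _ = ((l + L.length).factorial : ℝ) / (l.factorial : ℝ) *
        (bc u p (l + L.length) * d ^ (l + L.length)) := by ring
    _ ≤ 2 ^ (l + L.length) * (L.length.factorial : ℝ) *
        (bc u p (l + L.length) * d ^ (l + L.length)) := by gcongr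
    _ = _ := by ring

lemma TS.rep_bound' (H : TS u U V G S) {p : E} (hp : p ∈ V) {L : List E}
    (hL : L ≠ []) {d : ℝ} {e : E} (he : ‖e‖ ≤ d) (hLd : ∀ v ∈ L, ‖v‖ ≤ d) (hd : S * d ≤ 1/4) (l : ℕ) :
    |dd u (List.replicate l e ++ L) p| / (l.factorial : ℝ) ≤
      (L.length.factorial : ℝ) * G * (1/2) ^ l := by
  have hd0 : 0 ≤ d := (norm_nonneg _).trans he
  have h1 := rep_bound H.hU H.hu (H.hVU hp) hL he hLd l
  refine h1.trans ?_
  have h2 := H.hb p hp (l + L.length)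
  have hS := H.hS
  have hG := H.hG
  rw [mul_assoc]
  apply mul_le_mul_of_nonneg_left _ (by positivity)
  calc _ ≤ 2 ^ (l + L.length) * (G * S ^ (l + L.length) * d ^ (l + L.length)) := by gcongr
    _ = G * (2 * (S * d)) ^ (l + L.length) := by rw [mul_pow, mul_pow]; ring
    _ ≤ G * (1/2) ^ (l + L.length) := by
        gcongr
        linarith
    _ ≤ G * (1/2) ^ l := by
        apply mul_le_mul_of_nonneg_left _ hG
        exact pow_le_pow_of_le_one (by norm_num) (by norm_num) (by omega)

lemma TS.taylor (H : TS u U V G S) {p y : E} (hp : p ∈ V) (hy : y ∈ V) {L : List E}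
    (hL : L ≠ []) {d : ℝ} (he : ‖y - p‖ ≤ d) (hLd : ∀ v ∈ L, ‖v‖ ≤ d) (hd : S * d ≤ 1/4) :
    HasSum (fun l : ℕ => dd u (List.replicate l (y - p) ++ L) p / (l.factorial : ℝ)) (dd u L y) := by
  have hline : ∀ t ∈ Icc (0:ℝ) 1, p + t • (y - p) ∈ V := fun t ht =>
    H.hV.add_smul_sub_mem hp hy ht
  have hG := H.hG
  have hsum : Summable (fun l : ℕ => dd u (List.replicate l (y - p) ++ L) p / (l.factorial : ℝ)) := by
    refine Summable.of_norm_bounded (g := fun l => (L.length.factorial : ℝ) * G * (1/2) ^ l) ?_ ?_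
    · exact (summable_geometric_of_lt_one (by norm_num) (by norm_num)).mul_left _
    · intro l
      rw [norm_div, Real.norm_eq_abs, Real.norm_of_nonneg (by positivity)]
      exact H.rep_bound' hp hL he hLd hd l
  rw [hsum.hasSum_iff_tendsto_nat]
  have key : ∀ J, |dd u L y - ∑ j ∈ Finset.range J,
      dd u (List.replicate j (y - p) ++ L) p / (j.factorial : ℝ)| ≤
      (L.length.factorial : ℝ) * G * (1/2) ^ J := by
    intro J
    have := taylor1d J (fun j t => dd u (List.replicate j (y - p) ++ L) (p + t • (y - p)))
      ((J.factorial : ℝ) * ((L.length.factorial : ℝ) * G * (1/2) ^ J)) ?_ ?_ 1 (by simp)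
    · simp only [List.replicate_zero, List.nil_append, one_smul, zero_smul, add_zero, one_pow,
        mul_one, add_sub_cancel] at this
      refine this.trans (le_of_eq ?_)
      field_simp
    · intro j _ t ht
      have h1 := dd_diffAt H.hU H.hu (List.replicate j (y - p) ++ L) (H.hVU (hline t ht))
      have h2 : HasDerivAt (fun t : ℝ => p + t • (y - p)) (y - p) t := by
        have := ((hasDerivAt_id' t).smul_const (y - p)).const_add p
        exact this.congr_deriv (by simp)
      exact h1.hasFDerivAt.comp_hasDerivAt t h2
    · intro t ht
      have := H.rep_bound' (hline t ht) hL he hLd hd J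
      rw [div_le_iff₀ (by positivity)] at this
      linarith
  have h0 : Filter.Tendsto (fun J : ℕ => (L.length.factorial : ℝ) * G * (1/2 : ℝ) ^ J) Filter.atTop (nhds 0) := by
    have := (tendsto_pow_atTop_nhds_zero_of_lt_one (r := (1/2:ℝ)) (by norm_num) (by norm_num)).const_mul
      ((L.length.factorial : ℝ) * G)
    simpa using this
  rw [tendsto_iff_dist_tendsto_zero]
  refine squeeze_zero (fun _ => dist_nonneg) (fun J => ?_) h0
  rw [dist_comm, Real.dist_eq]
  exact key J

/-- weighted maximum of Taylor coefficients -/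
noncomputable def ww (u : E → ℝ) (x : E) (r : ℝ) : ℝ := ⨆ k, bc u x k * r ^ k

lemma TS.bdd (H : TS u U V G S) {x : E} (hx : x ∈ V) {r : ℝ} (hr : 0 ≤ r) (hrS : S * r ≤ 1) :
    BddAbove (range fun k => bc u x k * r ^ k) := by
  refine ⟨G, ?_⟩
  rintro _ ⟨k, rfl⟩
  have hG := H.hG
  have hS := H.hS
  calc bc u x k * r ^ k ≤ G * S ^ k * r ^ k := by gcongr; exact H.hb x hx k
    _ = G * (S * r) ^ k := by rw [mul_pow]; ring
    _ ≤ G * 1 := by gcongr; exact pow_le_one₀ (by positivity) hrS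
    _ = G := mul_one _

lemma TS.le_ww (H : TS u U V G S) {x : E} (hx : x ∈ V) {r : ℝ} (hr : 0 ≤ r) (hrS : S * r ≤ 1) (k : ℕ) :
    bc u x k * r ^ k ≤ ww u x r := le_ciSup (H.bdd hx hr hrS) k

lemma ww_nonneg {x : E} {r : ℝ} (hr : 0 ≤ r) : 0 ≤ ww u x r :=
  Real.iSup_nonneg fun k => mul_nonneg (bc_nonneg _ _ _) (by positivity)

lemma ww_le {x : E} {r B : ℝ} (h : ∀ k, bc u x k * r ^ k ≤ B) : ww u x r ≤ B := ciSup_le h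

lemma TS.ww_le_G (H : TS u U V G S) {x : E} (hx : x ∈ V) {r : ℝ} (hr : 0 ≤ r) (hrS : S * r ≤ 1) :
    ww u x r ≤ G := by
  apply ww_le
  intro k
  have hG := H.hG
  have hS := H.hS
  calc bc u x k * r ^ k ≤ G * S ^ k * r ^ k := by gcongr; exact H.hb x hx k
    _ = G * (S * r) ^ k := by rw [mul_pow]; ring
    _ ≤ G * 1 := by gcongr; exact pow_le_one₀ (by positivity) hrS
    _ = G := mul_one _

lemma TS.ww_mono (H : TS u U V G S) {x : E} (hx : x ∈ V) {r r' : ℝ} (hr : 0 ≤ r) (hrr : r ≤ r')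
    (hrS : S * r' ≤ 1) : ww u x r ≤ ww u x r' := by
  apply ww_le
  intro k
  refine le_trans ?_ (H.le_ww hx (hr.trans hrr) hrS k)
  have := bc_nonneg u x k
  gcongr

/-- core comparison: derivative bound at `p` via data at `q` -/
lemma TS.dd_compare (H : TS u U V G S) {p q : E} (hp : p ∈ V) (hq : q ∈ V) {d : ℝ}
    (hd : ‖p - q‖ ≤ d) (hdS : S * (4 * d) ≤ 1) {L : List E} (hL : L ≠ []) (hLd : ∀ v ∈ L, ‖v‖ ≤ d) :
    |dd u L p| ≤ (L.length.factorial : ℝ) * (2 * ww u q (4 * d)) := by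
  have hd0 : 0 ≤ d := (norm_nonneg _).trans hd
  have h1 := H.taylor hq hp hL hd hLd (by linarith)
  have h2 : ∀ l : ℕ, ‖dd u (List.replicate l (p - q) ++ L) q / (l.factorial : ℝ)‖ ≤
      (L.length.factorial : ℝ) * ww u q (4 * d) * (1/2) ^ l := by
    intro l
    rw [norm_div, Real.norm_eq_abs, Real.norm_of_nonneg (by positivity)]
    refine (rep_bound H.hU H.hu (H.hVU hq) hL hd hLd l).trans ?_
    rw [mul_assoc]
    refine mul_le_mul_of_nonneg_left ?_ (by positivity)
    have h3 := H.le_ww hq (by positivity : 0 ≤ 4 * d) hdS (l + L.length)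
    have h4 : (2:ℝ) ^ (l + L.length) * (bc u q (l + L.length) * d ^ (l + L.length)) =
        (bc u q (l + L.length) * (4 * d) ^ (l + L.length)) * (1/2) ^ (l + L.length) := by
      rw [mul_pow, show (4:ℝ) = 2 * 2 by norm_num, mul_pow, one_div, inv_pow]
      field_simp
    rw [h4]
    have h5 := bc_nonneg u q (l + L.length)
    have h6 : (1/2:ℝ) ^ (l + L.length) ≤ (1/2) ^ l :=
      pow_le_pow_of_le_one (by norm_num) (by norm_num) (by omega)
    exact mul_le_mul h3 h6 (by positivity) (ww_nonneg (by positivity))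
  have h3 : HasSum (fun l : ℕ => (L.length.factorial : ℝ) * ww u q (4 * d) * (1/2) ^ l)
      ((L.length.factorial : ℝ) * ww u q (4 * d) * 2) := by
    have := (hasSum_geometric_of_lt_one (r := (1/2:ℝ)) (by norm_num) (by norm_num)).mul_left
      ((L.length.factorial : ℝ) * ww u q (4 * d))
    have e : (1 - (1/2:ℝ))⁻¹ = 2 := by norm_num
    rwa [e] at this
  have := tsum_of_norm_bounded h3 h2
  rw [h1.tsum_eq, Real.norm_eq_abs] at this
  linarith

lemma TS.ww_compare (H : TS u U V G S) {p q : E} (hp : p ∈ V) (hq : q ∈ V) {d : ℝ} (hd0 : 0 < d)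
    (hd : ‖p - q‖ ≤ d) (hdS : S * (4 * d) ≤ 1) : ww u p d ≤ 2 * ww u q (4 * d) := by
  have h0 : 0 ≤ ww u q (4 * d) := ww_nonneg (by positivity)
  apply ww_le
  intro k
  rcases Nat.eq_zero_or_pos k with rfl | hk
  · simp [bc_zero]; positivity
  refine bc_le_of_dd H.hU H.hu (H.hVU hp) hd0 (by positivity) ?_
  intro l hl hv
  have := H.dd_compare hp hq hd hdS (L := l) (by rintro rfl; simp at hl; omega) hv
  rwa [hl] at this

end

lemma sum_choose_le (m j : ℕ) : ∑ l ∈ Finset.range m, (l.choose j : ℝ) ≤ 2 ^ m := by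
  have h : ∑ l ∈ Finset.range m, l.choose j = m.choose (j+1) := by
    induction m with
    | zero => simp
    | succ m ih => rw [Finset.sum_range_succ, ih, Nat.choose_succ_succ]; ring
  have h2 : m.choose (j+1) ≤ 2 ^ m := Nat.choose_le_two_pow _ _
  rw [← h] at h2
  exact_mod_cast h2

/-- weighted sums under Pascal steps -/
lemma pascal_step (m : ℕ) (T T' : ℕ → ℝ) (h0 : T' 0 = T 0) (h1 : ∀ j, T' (j+1) = T j + T (j+1)) :
    ∑ j ∈ Finset.range m, |T j| * (1/2) ^ j ≤ 2 * ∑ j ∈ Finset.range m, |T' j| * (1/2) ^ j := by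
  have key : ∀ m, ∑ j ∈ Finset.range (m+1), |T j| * (1/2) ^ j ≤
      ∑ j ∈ Finset.range (m+1), |T' j| * (1/2) ^ j +
      (1/2) * ∑ j ∈ Finset.range m, |T j| * (1/2) ^ j := by
    intro m
    induction m with
    | zero => simp [h0]
    | succ m ih =>
      rw [Finset.sum_range_succ _ (m+1), Finset.sum_range_succ (fun j => |T' j| * (1/2) ^ j) (m+1),
        Finset.sum_range_succ (fun j => |T j| * (1/2) ^ j) m]
      have h2 : |T (m+1)| ≤ |T' (m+1)| + |T m| := by
        have : T (m+1) = T' (m+1) - T m := by rw [h1]; ring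
        rw [this]; exact abs_sub _ _
      have h3 : |T (m+1)| * (1/2) ^ (m+1) ≤ |T' (m+1)| * (1/2) ^ (m+1) + (1/2) * (|T m| * (1/2) ^ m) := by
        calc _ ≤ (|T' (m+1)| + |T m|) * (1/2) ^ (m+1) := by gcongr
          _ = _ := by rw [pow_succ]; ring
      rw [Finset.sum_range_succ (fun j => |T j| * (1/2) ^ j) m] at ih
      linarith
  rcases m with _ | m
  · simp
  have := key m
  have h4 : ∑ j ∈ Finset.range m, |T j| * (1/2) ^ j ≤ ∑ j ∈ Finset.range (m+1), |T j| * (1/2) ^ j := by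
    rw [Finset.sum_range_succ]
    have : 0 ≤ |T m| * (1/2) ^ m := by positivity
    linarith
  linarith

lemma taylor_mon (r c : ℝ) (i j : ℕ) :
    (Polynomial.taylor r (Polynomial.monomial i c)).coeff j = (i.choose j : ℝ) * r ^ (i - j) * c := by
  rw [Polynomial.taylor_monomial, Polynomial.coeff_C_mul, Polynomial.coeff_X_add_C_pow]
  ring

lemma binom_inv (m : ℕ) (x : ℕ → ℝ) (B : ℝ)
    (h : ∀ j < m, |∑ i ∈ Finset.range m, (i.choose j : ℝ) * x i| ≤ B) (hB : 0 ≤ B) :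
    ∀ i < m, |x i| ≤ 2 ^ m * B := by
  intro i hi
  let P : Polynomial ℝ := ∑ i ∈ Finset.range m, Polynomial.C (x i) * Polynomial.X ^ i
  have hPc : ∀ i, P.coeff i = if i < m then x i else 0 := by
    intro i
    simp [P, Polynomial.coeff_X_pow]
  have hPd : P.natDegree < m ∨ P = 0 := by
    by_cases hP : P = 0
    · right; exact hP
    left
    by_contra hcon
    push Not at hcon
    have h1 := hPc P.natDegree
    rw [if_neg (by omega)] at h1
    exact hP (Polynomial.leadingCoeff_eq_zero.1 h1)
  have hm : 0 < m := by omega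
  have hPd' : P.natDegree < m := by
    rcases hPd with h | h
    · exact h
    · rw [h]; simpa using hm
  have hT : ∀ j, (Polynomial.taylor 1 P).coeff j = ∑ i ∈ Finset.range m, (i.choose j : ℝ) * x i := by
    intro j
    simp only [P, Polynomial.C_mul_X_pow_eq_monomial, map_sum, Polynomial.finsetSum_coeff, taylor_mon,
      one_pow, mul_one]
  have hdeg : (Polynomial.taylor 1 P).natDegree < m := by
    rw [Polynomial.natDegree_taylor]; exact hPd'
  have hback : P = Polynomial.taylor (-1) (Polynomial.taylor 1 P) := by
    rw [Polynomial.taylor_taylor]; simp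
  have h2 : x i = ∑ j ∈ Finset.range m, (j.choose i : ℝ) * (-1) ^ (j - i) *
      (Polynomial.taylor 1 P).coeff j := by
    have h3 : x i = P.coeff i := by rw [hPc, if_pos hi]
    rw [h3]
    conv_lhs => rw [hback, (Polynomial.taylor 1 P).as_sum_range' m hdeg]
    simp only [map_sum, Polynomial.finsetSum_coeff, taylor_mon]
  rw [h2]
  calc _ ≤ ∑ j ∈ Finset.range m, |(j.choose i : ℝ) * (-1) ^ (j - i) *
        (Polynomial.taylor 1 P).coeff j| := Finset.abs_sum_le_sum_abs _ _
    _ ≤ ∑ j ∈ Finset.range m, (j.choose i : ℝ) * B := by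
        refine Finset.sum_le_sum fun j hj => ?_
        rw [abs_mul, abs_mul, abs_pow, abs_neg, abs_one, one_pow, mul_one, Nat.abs_cast, hT]
        exact mul_le_mul_of_nonneg_left (h j (Finset.mem_range.1 hj)) (by positivity)
    _ = (∑ j ∈ Finset.range m, (j.choose i : ℝ)) * B := by rw [Finset.sum_mul]
    _ ≤ _ := by gcongr; exact sum_choose_le m i

lemma two_jet (m : ℕ) (a a' : ℕ → ℝ) (η : ℝ) (hη : 0 ≤ η) (h1 : ∀ l < m, |a l| ≤ η)
    (h2 : ∀ j < m, |a' j| ≤ η) (h3 : ∀ l, 2 * m ≤ l → |a l| ≤ η * (1/4) ^ l)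
    (hs : ∀ j < m, HasSum (fun l => (l.choose j : ℝ) * a l) (a' j)) :
    ∀ l < 2 * m, |a l| ≤ 8 * 16 ^ m * η := by
  -- tail
  have htail : ∀ j < m, |a' j - ∑ l ∈ Finset.range (2 * m), (l.choose j : ℝ) * a l| ≤ 2 * η := by
    intro j hj
    have h4 := (hasSum_nat_add_iff' (2 * m)).2 (hs j hj)
    have h5 : ∀ l, ‖((l + 2 * m).choose j : ℝ) * a (l + 2 * m)‖ ≤ η * (1/2) ^ l := by
      intro l
      rw [norm_mul, Real.norm_eq_abs, Real.norm_eq_abs, Nat.abs_cast]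
      have h6 : ((l + 2 * m).choose j : ℝ) ≤ 2 ^ (l + 2 * m) := by
        exact_mod_cast Nat.choose_le_two_pow _ _
      calc _ ≤ 2 ^ (l + 2 * m) * (η * (1/4) ^ (l + 2 * m)) :=
            mul_le_mul h6 (h3 _ (by omega)) (abs_nonneg _) (by positivity)
        _ = η * (1/2) ^ (l + 2 * m) := by
            rw [mul_left_comm, ← mul_pow]; norm_num
        _ ≤ η * (1/2) ^ l := by
            gcongr η * ?_
            exact pow_le_pow_of_le_one (by norm_num) (by norm_num) (by omega)
    have h6 : HasSum (fun l : ℕ => η * (1/2 : ℝ) ^ l) (η * 2) := by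
      have := (hasSum_geometric_of_lt_one (r := (1/2:ℝ)) (by norm_num) (by norm_num)).mul_left η
      have e : (1 - (1/2:ℝ))⁻¹ = 2 := by norm_num
      rwa [e] at this
    have := tsum_of_norm_bounded h6 h5
    rw [h4.tsum_eq, Real.norm_eq_abs] at this
    linarith
  let T : ℕ → ℕ → ℝ := fun r j => ∑ i ∈ Finset.range m, ((r + i).choose j : ℝ) * a (m + i)
  have hb : ∀ j < m, |T m j| ≤ 4 * 2 ^ m * η := by
    intro j hj
    have h4 := htail j hj
    have h5 : ∑ l ∈ Finset.range (2 * m), (l.choose j : ℝ) * a l =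
        ∑ l ∈ Finset.range m, (l.choose j : ℝ) * a l + T m j := by
      rw [two_mul, Finset.sum_range_add]
    rw [h5] at h4
    have h6 : |∑ l ∈ Finset.range m, (l.choose j : ℝ) * a l| ≤ 2 ^ m * η := by
      calc _ ≤ ∑ l ∈ Finset.range m, |(l.choose j : ℝ) * a l| := Finset.abs_sum_le_sum_abs _ _
        _ ≤ ∑ l ∈ Finset.range m, (l.choose j : ℝ) * η := by
            refine Finset.sum_le_sum fun l hl => ?_
            rw [abs_mul, Nat.abs_cast]
            exact mul_le_mul_of_nonneg_left (h1 l (Finset.mem_range.1 hl)) (by positivity)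
        _ = (∑ l ∈ Finset.range m, (l.choose j : ℝ)) * η := by rw [Finset.sum_mul]
        _ ≤ _ := by gcongr; exact sum_choose_le m j
    have h7 := h2 j hj
    have h8 : (1:ℝ) ≤ 2 ^ m := one_le_pow₀ (by norm_num)
    have h9 : η ≤ 2 ^ m * η := by nlinarith
    rw [abs_le] at *
    constructor <;> linarith [h4.1, h4.2, h6.1, h6.2, h7.1, h7.2]
  have hstep : ∀ r, ∑ j ∈ Finset.range m, |T r j| * (1/2) ^ j ≤
      2 * ∑ j ∈ Finset.range m, |T (r+1) j| * (1/2) ^ j := by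
    intro r
    apply pascal_step
    · simp [T]
    · intro j
      simp only [T, ← Finset.sum_add_distrib, ← add_mul]
      refine Finset.sum_congr rfl fun i _ => ?_
      rw [show r + 1 + i = (r + i) + 1 by ring, Nat.choose_succ_succ]
      push_cast; rfl
  have hiter : ∀ r, ∑ j ∈ Finset.range m, |T 0 j| * (1/2) ^ j ≤
      2 ^ r * ∑ j ∈ Finset.range m, |T r j| * (1/2) ^ j := by
    intro r
    induction r with
    | zero => simp
    | succ r ih =>
      have := hstep r
      calc _ ≤ _ := ih
        _ ≤ 2 ^ r * (2 * ∑ j ∈ Finset.range m, |T (r+1) j| * (1/2) ^ j) := by gcongr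
        _ = _ := by rw [pow_succ]; ring
  have hTm : ∑ j ∈ Finset.range m, |T m j| * (1/2) ^ j ≤ 8 * 2 ^ m * η := by
    calc _ ≤ ∑ j ∈ Finset.range m, 4 * 2 ^ m * η * (1/2) ^ j := by
          refine Finset.sum_le_sum fun j hj => ?_
          gcongr; exact hb j (Finset.mem_range.1 hj)
      _ = 4 * 2 ^ m * η * ∑ j ∈ Finset.range m, (1/2) ^ j := by rw [Finset.mul_sum]
      _ ≤ 4 * 2 ^ m * η * 2 := by gcongr; exact sum_geometric_two_le m
      _ = _ := by ring
  have hT0 : ∀ j < m, |T 0 j| ≤ 8 * 8 ^ m * η := by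
    intro j hj
    have h4 : |T 0 j| * (1/2) ^ j ≤ 2 ^ m * (8 * 2 ^ m * η) := by
      calc _ ≤ ∑ j ∈ Finset.range m, |T 0 j| * (1/2) ^ j :=
            Finset.single_le_sum (f := fun j => |T 0 j| * (1/2) ^ j) (fun i _ => by positivity)
              (Finset.mem_range.2 hj)
        _ ≤ _ := hiter m
        _ ≤ _ := by gcongr
    calc |T 0 j| = |T 0 j| * (1/2) ^ j * 2 ^ j := by rw [mul_assoc, ← mul_pow]; norm_num
      _ ≤ 2 ^ m * (8 * 2 ^ m * η) * 2 ^ m := by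
          gcongr
          norm_num
      _ = 8 * (2 * 2 * 2) ^ m * η := by rw [mul_pow, mul_pow]; ring
      _ = _ := by norm_num
  have hfin := binom_inv m (fun i => a (m + i)) (8 * 8 ^ m * η) (by
    intro j hj
    have := hT0 j hj
    simpa [T] using this) (by positivity)
  intro l hl
  rcases lt_or_ge l m with h | h
  · refine (h1 l h).trans ?_
    have : (1:ℝ) ≤ 16 ^ m := one_le_pow₀ (by norm_num)
    nlinarith
  · have := hfin (l - m) (by omega)
    simp only [Nat.add_sub_cancel' h] at this
    refine this.trans (le_of_eq ?_)
    rw [show (16:ℝ) = 2 * 8 by norm_num, mul_pow]; ring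

section
variable {E : Type*} [NormedAddCommGroup E] [NormedSpace ℝ E] {u : E → ℝ} {U : Set E}

lemma dd_sum_head {ι : Type*} [Fintype ι] (c : ι → ℝ) (g : ι → E) (l : List E) (p : E) :
    dd u ((∑ i, c i • g i) :: l) p = ∑ i, c i * dd u (g i :: l) p := by
  simp [dd_cons, map_sum]

lemma dd_expand (hU : IsOpen U) (hu : ContDiffOn ℝ (⊤ : ℕ∞) u U) {p : E} (hp : p ∈ U)
    {ι : Type*} [Fintype ι] (g : ι → E) (A : List E → Prop) (hA : ∀ i l, A l → A (g i :: l))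
    {k : ℕ} {X Λ : ℝ} (hΛ : 0 ≤ Λ) (hX0 : 0 ≤ X) (hX : ∀ l, A l → l.length = k → |dd u l p| ≤ X) (l : List E) :
    (∀ v ∈ l, ∃ c : ι → ℝ, v = ∑ i, c i • g i ∧ ∑ i, |c i| ≤ Λ) →
    ∀ l2, A l2 → l.length + l2.length = k → |dd u (l ++ l2) p| ≤ Λ ^ l.length * X := by
  induction l with
  | nil => intro _ l2 h2 h3; simpa using hX l2 h2 (by simpa using h3)
  | cons v l ih =>
    intro hl l2 h2 h3
    obtain ⟨c, hv, hc⟩ := hl v (by simp)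
    rw [List.cons_append, hv, dd_sum_head]
    have h4 : ∀ i, |dd u (g i :: (l ++ l2)) p| ≤ Λ ^ l.length * X := by
      intro i
      have h5 : (g i :: (l ++ l2)).Perm (l ++ (g i :: l2)) := List.perm_middle.symm
      rw [dd_perm hU hu h5 hp]
      refine ih (fun w hw => hl w (by simp [hw])) _ (hA i l2 h2) ?_
      simp at h3 ⊢; omega
    calc _ ≤ ∑ i, |c i * dd u (g i :: (l ++ l2)) p| := Finset.abs_sum_le_sum_abs _ _
      _ ≤ ∑ i, |c i| * (Λ ^ l.length * X) := by
          refine Finset.sum_le_sum fun i _ => ?_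
          rw [abs_mul]; gcongr; exact h4 i
      _ = (∑ i, |c i|) * (Λ ^ l.length * X) := by rw [Finset.sum_mul]
      _ ≤ Λ * (Λ ^ l.length * X) := by gcongr
      _ = _ := by rw [List.length_cons, pow_succ]; ring

end

lemma lap_basis {n : ℕ} {U : Set (EuclideanSpace ℝ (Fin n))} (hU : IsOpen U)
    {u : EuclideanSpace ℝ (Fin n) → ℝ} (hu : IsHarmonicOn u U) {x : EuclideanSpace ℝ (Fin n)}
    (hx : x ∈ U) {ι : Type*} [Fintype ι] (b : OrthonormalBasis ι ℝ (EuclideanSpace ℝ (Fin n))) :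
    ∑ i, dd u [b i, b i] x = 0 := by
  have h1 := hu.2 x hx
  have key : ∀ v, dd u [v, v] x = iteratedFDeriv ℝ 2 u x ![v, v] := by
    intro v
    rw [dd_eq_iter hU hu.1 _ x hx]
    congr 1
    funext i
    fin_cases i <;> rfl
  have h2 := congrFun (InnerProductSpace.laplacian_eq_iteratedFDeriv_orthonormalBasis u b) x
  have h3 := congrFun (InnerProductSpace.laplacian_eq_iteratedFDeriv_orthonormalBasis u
    (EuclideanSpace.basisFun (Fin n) ℝ)) x
  rw [h2] at h3
  simp only [key, h3]
  rw [← h1]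
  refine Finset.sum_congr rfl fun i _ => ?_
  rw [← key]
  simp [dd_cons, dd_nil]

lemma dd_smul_head {E : Type*} [NormedAddCommGroup E] [NormedSpace ℝ E] {u : E → ℝ} (c : ℝ) (v : E) (l : List E) (p : E) :
    dd u ((c • v) :: l) p = c * dd u (v :: l) p := by
  simp [dd_cons]

lemma dd_smul_head2 {E : Type*} [NormedAddCommGroup E] [NormedSpace ℝ E] {u : E → ℝ} {U : Set E}
    (hU : IsOpen U) (hu : ContDiffOn ℝ (⊤ : ℕ∞) u U) {p : E} (hp : p ∈ U) (c : ℝ) (v : E) (l : List E) :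
    dd u ((c • v) :: (c • v) :: l) p = c * c * dd u (v :: v :: l) p := by
  rw [dd_smul_head, dd_perm hU hu (List.Perm.swap (c • v) v l) hp, dd_smul_head]
  ring

section
variable {m : ℕ} {U : Set (EuclideanSpace ℝ (Fin (m+1)))}
    {u : EuclideanSpace ℝ (Fin (m+1)) → ℝ}

lemma normal_reduce (hU : IsOpen U) (hu : IsHarmonicOn u U) {p : EuclideanSpace ℝ (Fin (m+1))} (hp : p ∈ U)
    (b : OrthonormalBasis (Fin (m+1)) ℝ (EuclideanSpace ℝ (Fin (m+1)))) (r : ℝ) {X : ℝ} (hX : 0 ≤ X)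
    {k : ℕ} (h1 : ∀ li : List (Fin (m+1)), li.length = k → li.count (Fin.last m) ≤ 1 →
      |dd u (li.map fun i => r • b i) p| ≤ X) (c : ℕ) :
    ∀ li : List (Fin (m+1)), li.length = k → li.count (Fin.last m) ≤ c →
      |dd u (li.map fun i => r • b i) p| ≤ (m+1) ^ c * X := by
  induction c with
  | zero => intro li h2 h3; simpa using h1 li h2 (by omega)
  | succ c ih =>
    intro li h2 h3
    have hpow : (1:ℝ) ≤ (m+1) ^ (c+1) := one_le_pow₀ (by linarith [Nat.cast_nonneg (α := ℝ) m])
    by_cases h4 : li.count (Fin.last m) ≤ 1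
    · refine (h1 li h2 h4).trans ?_
      nlinarith
    push Not at h4
    obtain ⟨l', hl'⟩ : ∃ l', li.Perm (Fin.last m :: Fin.last m :: l') := by
      have h5 : Fin.last m ∈ li := List.count_pos_iff.1 (by omega)
      have h6 := List.perm_cons_erase h5
      have h7 : Fin.last m ∈ li.erase (Fin.last m) := by
        apply List.count_pos_iff.1
        rw [List.count_erase_self]; omega
      exact ⟨_, h6.trans ((List.perm_cons_erase h7).cons _)⟩
    have hlen : l'.length + 2 = k := by
      have := hl'.length_eq; simp at this; omega
    have hcnt : l'.count (Fin.last m) + 2 = li.count (Fin.last m) := by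
      rw [hl'.count_eq]; simp
    rw [dd_perm hU hu.1 (hl'.map _) hp]
    simp only [List.map_cons]
    have h8 := lap_basis hU (harm_dd hU hu (l'.map fun i => r • b i)) hp b
    simp only [← dd_append, List.cons_append, List.nil_append] at h8
    rw [Fin.sum_univ_castSucc] at h8
    have h9 : dd u (r • b (Fin.last m) :: r • b (Fin.last m) :: l'.map fun i => r • b i) p =
        - ∑ i : Fin m, dd u (r • b i.castSucc :: r • b i.castSucc :: l'.map fun i => r • b i) p := by
      simp only [dd_smul_head2 hU hu.1 hp]
      rw [← Finset.mul_sum, ← mul_neg]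
      congr 1
      linarith
    rw [h9, abs_neg]
    calc _ ≤ ∑ i : Fin m, |dd u (r • b i.castSucc :: r • b i.castSucc :: l'.map fun i => r • b i) p| :=
          Finset.abs_sum_le_sum_abs _ _
      _ ≤ ∑ i : Fin m, (m+1) ^ c * X := by
          refine Finset.sum_le_sum fun i _ => ?_
          have := ih (i.castSucc :: i.castSucc :: l') (by simp; omega) (by
            have : i.castSucc ≠ Fin.last m := (Fin.castSucc_lt_last i).ne
            simp [List.count_cons, this]; omega)
          simpa using this
      _ = m * ((m+1) ^ c * X) := by simp
      _ ≤ _ := by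
          rw [pow_succ]
          have : 0 ≤ ((m:ℝ)+1) ^ c * X := by positivity
          nlinarith

/-- full expansion: from lists of `e`'s with at most one normal to all vectors of norm at most `r`. -/
lemma full_expand (hU : IsOpen U) (hu : IsHarmonicOn u U) {p : EuclideanSpace ℝ (Fin (m+1))} (hp : p ∈ U)
    (b : OrthonormalBasis (Fin (m+1)) ℝ (EuclideanSpace ℝ (Fin (m+1)))) {r : ℝ} (hr : 0 < r) {X Λ : ℝ}
    (hX : 0 ≤ X) (hΛ : 1 ≤ Λ) (e : Fin m → EuclideanSpace ℝ (Fin (m+1)))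
    (hc : ∀ i, i ≠ Fin.last m → ∃ c : Fin m → ℝ, r • b i = ∑ j, c j • e j ∧ ∑ j, |c j| ≤ Λ)
    {k : ℕ} (h1 : ∀ le : List (Fin m), le.length = k → |dd u (le.map e) p| ≤ X)
    (h2 : ∀ le : List (Fin m), le.length + 1 = k → |dd u (r • b (Fin.last m) :: le.map e) p| ≤ X) :
    ∀ l : List (EuclideanSpace ℝ (Fin (m+1))), l.length = k → (∀ v ∈ l, ‖v‖ ≤ r) →
      |dd u l p| ≤ (m+1) ^ k * ((m+1) ^ k * (Λ ^ k * X)) := by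
  have hΛ0 : 0 ≤ Λ := by linarith
  -- stage one
  have s1 := dd_expand hU hu.1 hp e (fun l2 => ∃ le : List (Fin m), l2.Perm (le.map e) ∨
      l2.Perm (r • b (Fin.last m) :: le.map e)) (by
        rintro i l ⟨le, h | h⟩
        · exact ⟨i :: le, Or.inl (by simpa using h)⟩
        · refine ⟨i :: le, Or.inr ?_⟩
          exact (h.cons (e i)).trans (List.Perm.swap _ _ _)) (k := k) (X := X) hΛ0 hX (by
        rintro l ⟨le, h | h⟩ hl
        · rw [dd_perm hU hu.1 h hp]
          apply h1
          have := h.length_eq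
          simp at this; omega
        · rw [dd_perm hU hu.1 h hp]
          apply h2
          have := h.length_eq
          simp at this; omega)
  have s1a : ∀ li : List (Fin (m+1)), li.count (Fin.last m) = 0 → ∀ v ∈ (li.map fun i => r • b i),
      ∃ c : Fin m → ℝ, v = ∑ i, c i • e i ∧ ∑ i, |c i| ≤ Λ := by
    intro li h3 v hv
    rw [List.mem_map] at hv
    obtain ⟨i, hi, rfl⟩ := hv
    apply hc
    rintro rfl
    exact (List.count_eq_zero.1 h3) hi
  have s2 : ∀ li : List (Fin (m+1)), li.length = k → li.count (Fin.last m) ≤ 1 →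
      |dd u (li.map fun i => r • b i) p| ≤ Λ ^ k * X := by
    intro li h3 h4
    by_cases h5 : li.count (Fin.last m) = 0
    · have := s1 _ (s1a li h5) [] ⟨[], Or.inl (by simp)⟩ (by simpa using h3)
      simpa [h3] using this
    · have h6 : Fin.last m ∈ li := List.count_pos_iff.1 (by omega)
      have h7 := List.perm_cons_erase h6
      have h8 : (li.erase (Fin.last m)).count (Fin.last m) = 0 := by
        rw [List.count_erase_self]; omega
      have h9 : (li.erase (Fin.last m)).length + 1 = k := by
        have := h7.length_eq; simp only [List.length_cons] at this; omega
      have h10 := s1 _ (s1a _ h8) [r • b (Fin.last m)] ⟨[], Or.inr (by simp)⟩ (by simpa using h9)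
      have h11 : (li.map fun i => r • b i).Perm
          (((li.erase (Fin.last m)).map fun i => r • b i) ++ [r • b (Fin.last m)]) := by
        refine (h7.map _).trans ?_
        simp only [List.map_cons]
        exact (List.perm_append_singleton _ _).symm
      rw [dd_perm hU hu.1 h11 hp]
      refine h10.trans ?_
      gcongr
      rw [List.length_map]; omega
  have s3 := normal_reduce hU hu hp b r (X := Λ ^ k * X) (by positivity) s2 k
  intro l hl hv
  have s4 := dd_expand hU hu.1 hp (fun i => r • b i) (fun l2 => ∃ li : List (Fin (m+1)),
    l2 = li.map fun i => r • b i) (by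
      rintro i l ⟨li, rfl⟩
      exact ⟨i :: li, by simp⟩) (k := k) (X := (m+1) ^ k * (Λ ^ k * X)) (Λ := (m:ℝ)+1) (by positivity)
      (by positivity) (by
      rintro l ⟨li, rfl⟩ h3
      rw [List.length_map] at h3
      exact s3 li h3 (h3 ▸ List.count_le_length)) l (by
      intro v hvl
      refine ⟨fun i => b.repr v i / r, ?_, ?_⟩
      · conv_lhs => rw [← b.sum_repr v]
        refine Finset.sum_congr rfl fun i _ => ?_
        rw [smul_smul]; congr 1; field_simp
      · calc ∑ i, |b.repr v i / r| ≤ ∑ _i : Fin (m+1), (1:ℝ) := by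
              refine Finset.sum_le_sum fun i _ => ?_
              rw [abs_div, abs_of_pos hr, div_le_one hr]
              have h5 : |b.repr v i| ≤ ‖b.repr v‖ := by
                have := PiLp.norm_apply_le (b.repr v) i
                rwa [Real.norm_eq_abs] at this
              rw [LinearIsometryEquiv.norm_map] at h5
              exact h5.trans (hv v hvl)
          _ = (m:ℝ)+1 := by simp) [] ⟨[], by simp⟩ (by simpa using hl)
  simpa [hl] using s4

end

section
variable {E : Type*} [NormedAddCommGroup E] [NormedSpace ℝ E] {u : E → ℝ} {U V : Set E} {G S : ℝ}

lemma TS.rep_est (H : TS u U V G S) {p0 p1 : E} (hp0 : p0 ∈ V) (hp1 : p1 ∈ V) {r : ℝ}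
    (hr : ‖p1 - p0‖ ≤ r) (hrS : S * r ≤ 1/4) {L : List E} (hL : L ≠ []) (hLr : ∀ v ∈ L, ‖v‖ ≤ r)
    (m J : ℕ) {η : ℝ} (hη : 0 ≤ η)
    (h1 : ∀ l < m, 2 ^ (l + L.length) * (bc u p0 (l + L.length) * r ^ (l + L.length)) ≤ η)
    (h2 : ∀ l < m, 2 ^ (l + L.length) * (bc u p1 (l + L.length) * r ^ (l + L.length)) ≤ η)
    (h3 : ∀ l, 2 * m ≤ l → 2 ^ (l + L.length) * (bc u p0 (l + L.length) * r ^ (l + L.length)) ≤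
      η * (1/4) ^ l) (hJ : J < 2 * m) :
    |dd u (List.replicate J (p1 - p0) ++ L) p0| ≤
      ((J + L.length).factorial : ℝ) * (8 * 16 ^ m * η) := by
  have habs : ∀ p l, |dd u (List.replicate l (p1 - p0) ++ L) p / (l.factorial : ℝ)| =
      |dd u (List.replicate l (p1 - p0) ++ L) p| / (l.factorial : ℝ) := by
    intro p l
    rw [abs_div, Nat.abs_cast]
  have key := two_jet m (fun l => dd u (List.replicate l (p1 - p0) ++ L) p0 / (l.factorial : ℝ))
    (fun l => dd u (List.replicate l (p1 - p0) ++ L) p1 / (l.factorial : ℝ))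
    ((L.length.factorial : ℝ) * η) (by positivity) ?_ ?_ ?_ ?_ J hJ
  · simp only [habs] at key
    rw [div_le_iff₀ (by positivity)] at key
    refine key.trans ?_
    have h4 : J.factorial * L.length.factorial ≤ (J + L.length).factorial :=
      Nat.le_of_dvd (Nat.factorial_pos _) (Nat.factorial_mul_factorial_dvd_factorial_add _ _)
    have h5 : (J.factorial : ℝ) * L.length.factorial ≤ (J + L.length).factorial := by exact_mod_cast h4
    calc _ = (J.factorial : ℝ) * L.length.factorial * (8 * 16 ^ m * η) := by ring
      _ ≤ _ := by gcongr
  · intro l hl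
    simp only [habs]
    refine (rep_bound H.hU H.hu (H.hVU hp0) hL hr hLr l).trans ?_
    exact mul_le_mul_of_nonneg_left (h1 l hl) (by positivity)
  · intro l hl
    simp only [habs]
    refine (rep_bound H.hU H.hu (H.hVU hp1) hL hr hLr l).trans ?_
    exact mul_le_mul_of_nonneg_left (h2 l hl) (by positivity)
  · intro l hl
    simp only [habs]
    refine (rep_bound H.hU H.hu (H.hVU hp0) hL hr hLr l).trans ?_
    rw [mul_assoc]
    exact mul_le_mul_of_nonneg_left (h3 l hl) (by positivity)
  · intro j hj
    have h4 := H.taylor hp0 hp1 (L := List.replicate j (p1 - p0) ++ L) (by simp [hL]) hr (by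
      intro v hv
      rw [List.mem_append] at hv
      rcases hv with hv | hv
      · rw [List.eq_of_mem_replicate hv]; exact hr
      · exact hLr v hv) hrS
    have h5 := h4.div_const (j.factorial : ℝ)
    have h6 : (fun l : ℕ => dd u (List.replicate l (p1 - p0) ++ (List.replicate j (p1 - p0) ++ L)) p0 /
        (l.factorial : ℝ) / (j.factorial : ℝ)) = fun l => (((l+j).choose j : ℕ) : ℝ) *
        (dd u (List.replicate (l+j) (p1 - p0) ++ L) p0 / ((l+j).factorial : ℝ)) := by
      funext l
      rw [← List.append_assoc, List.replicate_append_replicate]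
      have h7 : (l+j).choose j * j.factorial * l.factorial = (l+j).factorial := by
        have := Nat.choose_mul_factorial_mul_factorial (n := l+j) (k := j) (by omega)
        simpa using this
      have h8 : ((l+j).factorial : ℝ) = ((l+j).choose j : ℕ) * j.factorial * l.factorial := by
        exact_mod_cast h7.symm
      have h9 : (((l+j).choose j : ℕ) : ℝ) ≠ 0 := by
        have := Nat.choose_pos (n := l+j) (k := j) (by omega)
        positivity
      rw [h8]
      field_simp
    rw [h6] at h5
    have h10 := (hasSum_nat_add_iff (f := fun l => ((l.choose j : ℕ) : ℝ) *
        (dd u (List.replicate l (p1 - p0) ++ L) p0 / (l.factorial : ℝ))) j).1 h5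
    have h11 : ∑ i ∈ Finset.range j, ((i.choose j : ℕ) : ℝ) *
        (dd u (List.replicate i (p1 - p0) ++ L) p0 / (i.factorial : ℝ)) = 0 := by
      apply Finset.sum_eq_zero
      intro i hi
      rw [Nat.choose_eq_zero_of_lt (Finset.mem_range.1 hi)]; simp
    rw [h11, add_zero] at h10
    exact h10

end

lemma pigeon {m : ℕ} (le : List (Fin m)) (h : le ≠ []) : ∃ i, le.length ≤ m * le.count i ∧
    ∃ l', le.Perm (List.replicate (le.count i) i ++ l') := by
  have hm : 0 < m := by
    obtain ⟨i, hi⟩ := List.exists_mem_of_ne_nil le h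
    exact i.pos
  have h1 : ∑ i : Fin m, le.count i = le.length := by
    have := Multiset.sum_count_eq_card (s := (Finset.univ : Finset (Fin m))) (m := (le : Multiset (Fin m)))
      (by simp)
    simpa using this
  haveI : Nonempty (Fin m) := ⟨⟨0, hm⟩⟩
  obtain ⟨i, hi⟩ : ∃ i, le.length ≤ m * le.count i := by
    by_contra hcon
    push Not at hcon
    have h2 : ∑ i : Fin m, m * le.count i < ∑ i : Fin m, le.length :=
      Finset.sum_lt_sum_of_nonempty Finset.univ_nonempty fun i _ => hcon i
    rw [← Finset.mul_sum, h1] at h2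
    simp at h2
  refine ⟨i, hi, le.filter (fun x => ! (x == i)), ?_⟩
  have := List.filter_append_perm (fun x => x == i) le
  rw [List.filter_beq] at this
  exact this.symm

lemma pow_le_rpow_sq {x σ : ℝ} {k : ℕ} (hx : 1 ≤ x) (hk : (k:ℝ) ≤ 2 * σ) : x ^ k ≤ (x ^ 2) ^ σ := by
  rw [← Real.rpow_natCast x k, ← Real.rpow_natCast x 2, ← Real.rpow_mul (by linarith)]
  apply Real.rpow_le_rpow_of_exponent_le hx
  simpa using hk

set_option maxHeartbeats 4000000 in
lemma key_lemma {m : ℕ} {U V : Set (EuclideanSpace ℝ (Fin (m+1)))} {G S : ℝ}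
    {u : EuclideanSpace ℝ (Fin (m+1)) → ℝ} (H : TS u U V G S) (hu : ContDiffOn ℝ (⊤ : ℕ∞) u U)
    {p0 : EuclideanSpace ℝ (Fin (m+1))} (hp0 : p0 ∈ V) (p : Fin m → EuclideanSpace ℝ (Fin (m+1)))
    (hp : ∀ i, p i ∈ V) {r σ θ ε W : ℝ} {k : ℕ} (hε0 : 0 < ε) (hεm : 10 * ε * (m+1) = 1)
    (hε1 : ε ≤ 1/10) (hεσ : 2 ≤ ε * σ) (hσ20 : 20 ≤ σ) (hθ0 : 0 < θ) (hθ15 : 2 ^ 15 * θ ≤ 1)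
    (hpr : ∀ i, ‖p i - p0‖ ≤ r) (hrS4 : S * (4 * r) ≤ 1) (hr : 0 < r) (hW : 0 < W)
    (hlo0 : ∀ k : ℕ, (k:ℝ) ≤ (1 - 2 * ε) * σ → bc u p0 k * r ^ k ≤ θ ^ σ * W)
    (hloi : ∀ i, ∀ k : ℕ, (k:ℝ) ≤ (1 - 2 * ε) * σ →
      bc u (p i) k * r ^ k ≤ θ ^ σ * (2 * 16 ^ σ * W))
    (hhi : ∀ k : ℕ, (1 + 2 * ε) * σ ≤ k → bc u p0 k * r ^ k ≤ θ ^ k * W)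
    (hkup : (k:ℝ) ≤ (1 + ε) * σ) (hk2' : 2 ≤ k)
    (T : List (EuclideanSpace ℝ (Fin (m+1)))) (le : List (Fin m)) (hT1 : T.length ≤ 1)
    (hTr : ∀ v ∈ T, ‖v‖ ≤ r) (hlen : T.length + le.length = k) :
    |dd u (T ++ le.map fun i => p i - p0) p0| ≤ (k.factorial : ℝ) * (16 * (512 * θ) ^ σ * W) := by
  have h32 : 0 < (32 * θ) ^ σ := by positivity
  have hη0 : 0 ≤ 2 * (32 * θ) ^ σ * W := by positivity
  have hle : le ≠ [] := by rintro rfl; simp at hlen; omega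
  obtain ⟨i, hi1, l', hl'⟩ := pigeon le hle
  set c := le.count i with hcdef
  have hc1 : 1 ≤ c := by
    rcases Nat.eq_zero_or_pos c with h | h
    · rw [h] at hi1; simp at hi1; exact absurd hi1 hle
    · exact h
  have hlelen : le.length = c + l'.length := by
    have := hl'.length_eq; simpa using this
  have hperm : (T ++ le.map fun i => p i - p0).Perm
      (List.replicate (c - 1) (p i - p0) ++ ((p i - p0) :: (T ++ l'.map fun i => p i - p0))) := by
    have h1 : (le.map fun i => p i - p0).Perm
        (List.replicate c (p i - p0) ++ l'.map fun i => p i - p0) := by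
      have := hl'.map (fun i => p i - p0)
      simpa using this
    refine (h1.append_left T).trans ?_
    have h2 : List.replicate c (p i - p0) = List.replicate (c-1) (p i - p0) ++ [p i - p0] := by
      conv_lhs => rw [show c = (c - 1) + 1 by omega]
      rw [List.replicate_succ']
    rw [h2, List.append_assoc]
    refine (List.perm_append_comm_assoc _ _ _).trans ?_
    refine List.Perm.append_left _ ?_
    simp only [List.cons_append, List.nil_append]
    exact List.perm_middle
  rw [dd_perm H.hU hu hperm (H.hVU hp0)]
  set L := (p i - p0) :: (T ++ l'.map fun i => p i - p0) with hL
  have hLlen : (c - 1) + L.length = k := by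
    simp [hL]; omega
  have hLr : ∀ v ∈ L, ‖v‖ ≤ r := by
    intro v hv
    rw [hL, List.mem_cons, List.mem_append, List.mem_map] at hv
    rcases hv with rfl | hv | ⟨j, _, rfl⟩
    · exact hpr i
    · exact hTr v hv
    · exact hpr j
  have hLR : (L.length : ℝ) = k - c + 1 := by
    have : (((c - 1) + L.length : ℕ) : ℝ) = k := by exact_mod_cast hLlen
    push_cast [Nat.cast_sub hc1] at this
    linarith
  have hcR : 10 * ε * (k - 1) ≤ c := by
    have h1 : k - 1 ≤ m * c := by omega
    have h2 : (k:ℝ) - 1 ≤ m * c := by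
      have : ((k - 1 : ℕ) : ℝ) ≤ ((m * c : ℕ) : ℝ) := by exact_mod_cast h1
      push_cast [Nat.cast_sub (by omega : 1 ≤ k)] at this
      exact this
    have h3 : (k:ℝ) - 1 ≤ (m + 1) * c := by
      have : (0:ℝ) ≤ c := Nat.cast_nonneg c
      linarith
    calc 10 * ε * (k - 1) ≤ 10 * ε * ((m+1) * c) := by gcongr
      _ = (10 * ε * (m+1)) * c := by ring
      _ = c := by rw [hεm, one_mul]
  have hb : (L.length : ℝ) ≤ (1 - 9 * ε) * σ + 2 := by
    rw [hLR]
    have h1 : (k:ℝ) * (1 - 10 * ε) ≤ (1 + ε) * σ * (1 - 10 * ε) := by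
      apply mul_le_mul_of_nonneg_right hkup; linarith
    nlinarith [mul_pos (mul_pos hε0 hε0) (by linarith : 0 < σ)]
  set m' := ⌊(1 - 2 * ε) * σ - L.length⌋₊ with hm'
  have hnn : 0 ≤ (1 - 2 * ε) * σ - L.length := by nlinarith
  have hm'1 : (m':ℝ) ≤ (1 - 2 * ε) * σ - L.length := Nat.floor_le hnn
  have hm'2 : (1 - 2 * ε) * σ - L.length < m' + 1 := Nat.lt_floor_add_one _
  have hm'3 : (1 + 2 * ε) * σ ≤ 2 * m' + L.length := by nlinarith
  have hm'σ : (m':ℝ) ≤ σ := by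
    have : (0:ℝ) ≤ L.length := Nat.cast_nonneg _
    nlinarith
  have hpow2 : ∀ k' : ℕ, (k':ℝ) ≤ (1 - 2 * ε) * σ → (2:ℝ) ^ k' ≤ 2 ^ σ := by
    intro k' hk'
    rw [← Real.rpow_natCast]
    exact Real.rpow_le_rpow_of_exponent_le (by norm_num) (by nlinarith)
  have hsplit : (32 * θ) ^ σ = 2 ^ σ * 16 ^ σ * θ ^ σ := by
    rw [← Real.mul_rpow (by norm_num) (by norm_num), ← Real.mul_rpow (by norm_num) hθ0.le]
    norm_num
  have hlen' : ∀ l < m', ((l + L.length : ℕ) : ℝ) ≤ (1 - 2 * ε) * σ := by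
    intro l hl
    have : (l:ℝ) ≤ m' := by exact_mod_cast hl.le
    push_cast
    linarith
  have est := H.rep_est hp0 (hp i) (hpr i) (by linarith) (L := L) (by simp [hL]) hLr m' (c - 1) hη0
    ?_ ?_ ?_ ?_
  · rw [hLlen] at est
    refine est.trans ?_
    apply mul_le_mul_of_nonneg_left _ (by positivity)
    have h1 : (16:ℝ) ^ m' ≤ 16 ^ σ := by
      rw [← Real.rpow_natCast]
      exact Real.rpow_le_rpow_of_exponent_le (by norm_num) hm'σ
    have h2 : (512 * θ) ^ σ = 16 ^ σ * (32 * θ) ^ σ := by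
      rw [← Real.mul_rpow (by norm_num) (by positivity)]
      congr 1; ring
    rw [h2]
    calc _ ≤ 8 * 16 ^ σ * (2 * (32 * θ) ^ σ * W) := by gcongr
      _ = _ := by ring
  · intro l hl
    have h1 := hlo0 _ (hlen' l hl)
    have h2 := hpow2 _ (hlen' l hl)
    rw [hsplit]
    have h3 : (1:ℝ) ≤ 16 ^ σ := Real.one_le_rpow (by norm_num) (by linarith)
    calc _ ≤ 2 ^ σ * (θ ^ σ * W) := by
            have := bc_nonneg u p0 (l + L.length)
            gcongr
      _ ≤ (2 * 16 ^ σ) * (2 ^ σ * (θ ^ σ * W)) := by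
          have : 0 ≤ 2 ^ σ * (θ ^ σ * W) := by positivity
          nlinarith
      _ = _ := by ring
  · intro l hl
    have h1 := hloi i _ (hlen' l hl)
    have h2 := hpow2 _ (hlen' l hl)
    rw [hsplit]
    calc _ ≤ 2 ^ σ * (θ ^ σ * (2 * 16 ^ σ * W)) := by
            have := bc_nonneg u (p i) (l + L.length)
            gcongr
      _ = _ := by ring
  · intro l hl
    have hbig : (1 + 2 * ε) * σ ≤ ((l + L.length : ℕ) : ℝ) := by
      have : ((2 * m' : ℕ) : ℝ) ≤ l := by exact_mod_cast hl
      push_cast at this ⊢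
      linarith
    have hkl : l ≤ l + L.length := by omega
    generalize l + L.length = k' at *
    have h1 := hhi k' hbig
    have h8 : (8 * θ) ^ k' ≤ (32 * θ) ^ σ := by
      calc (8 * θ) ^ k' = (8 * θ) ^ (k':ℝ) := (Real.rpow_natCast _ _).symm
        _ ≤ (8 * θ) ^ σ := Real.rpow_le_rpow_of_exponent_ge (by positivity) (by linarith)
            (by nlinarith)
        _ ≤ (32 * θ) ^ σ := Real.rpow_le_rpow (by positivity) (by linarith) (by linarith)
    have h9 : (1/4:ℝ) ^ k' ≤ (1/4) ^ l :=
      pow_le_pow_of_le_one (by norm_num) (by norm_num) hkl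
    calc _ ≤ 2 ^ k' * (θ ^ k' * W) := by gcongr
      _ = (8 * θ) ^ k' * (1/4) ^ k' * W := by
          rw [← mul_pow, ← mul_assoc, ← mul_pow]; congr 2; ring
      _ ≤ (32 * θ) ^ σ * (1/4) ^ l * W := by gcongr
      _ ≤ 2 * ((32 * θ) ^ σ * (1/4) ^ l * W) := by
          have : 0 ≤ (32 * θ) ^ σ * (1/4) ^ l * W := by positivity
          linarith
      _ = _ := by ring
  · have : ((c - 1 : ℕ) : ℝ) < ((2 * m' : ℕ) : ℝ) := by
      push_cast [Nat.cast_sub hc1]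
      nlinarith
    exact_mod_cast this

set_option maxHeartbeats 4000000 in
theorem unit_lemma {m : ℕ} {U V : Set (EuclideanSpace ℝ (Fin (m+1)))} {G S : ℝ}
    {u : EuclideanSpace ℝ (Fin (m+1)) → ℝ} (H : TS u U V G S) (hu : IsHarmonicOn u U)
    (b : OrthonormalBasis (Fin (m+1)) ℝ (EuclideanSpace ℝ (Fin (m+1))))
    {p0 : EuclideanSpace ℝ (Fin (m+1))} (hp0 : p0 ∈ V) (p : Fin m → EuclideanSpace ℝ (Fin (m+1)))
    (hp : ∀ i, p i ∈ V) {r K σ Λ ε : ℝ} (hε : ε = 1 / (10 * (m+1))) (hr : 0 < r)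
    (hpr : ∀ i, ‖p i - p0‖ ≤ r) (hΛ : 1 ≤ Λ)
    (hc : ∀ i, i ≠ Fin.last m → ∃ c : Fin m → ℝ, r • b i = ∑ j, c j • (p j - p0) ∧ ∑ j, |c j| ≤ Λ)
    (hK1 : 1 ≤ K) (hK : 2 ^ 15 * (m+1) ^ 4 * Λ ^ 2 ≤ K ^ ε) (hKS : S * (K * r) ≤ 1)
    (hσ : 20 * (m+1) ≤ σ) (hW : 0 < ww u p0 r)
    (hup : ww u p0 (K * r) ≤ K ^ σ * ww u p0 r)
    (hlow0 : ww u p0 (r / K) ≤ K ^ (-((1 - ε) * σ)) * ww u p0 r)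
    (hlow : ∀ i, ww u (p i) (r / K) ≤ K ^ (-((1 - ε) * σ)) * ww u (p i) r) : False := by
  have hm0 : (0:ℝ) ≤ m := Nat.cast_nonneg m
  have hm1 : (1:ℝ) ≤ (m:ℝ) + 1 := by linarith
  have hε0 : 0 < ε := by rw [hε]; positivity
  have hεm : 10 * ε * (m+1) = 1 := by rw [hε]; field_simp
  have hε1 : ε ≤ 1/10 := by nlinarith
  have hεσ : 2 ≤ ε * σ := by nlinarith
  have hσ20 : 20 ≤ σ := by nlinarith
  have hK0 : 0 < K := by linarith
  have hS := H.hS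
  set W := ww u p0 r with hWdef
  set θ := K ^ (-ε) with hθdef
  have hθ0 : 0 < θ := Real.rpow_pos_of_pos hK0 _
  have hKθ : K ^ ε * θ = 1 := by rw [hθdef, ← Real.rpow_add hK0]; simp
  have hθs : 2 ^ 15 * (m+1) ^ 4 * Λ ^ 2 * θ ≤ 1 := by
    calc _ ≤ K ^ ε * θ := by gcongr
      _ = 1 := hKθ
  have hmΛ : (1:ℝ) ≤ (m+1) ^ 4 * Λ ^ 2 := by
    have h1 : (1:ℝ) ≤ (m+1) ^ 4 := one_le_pow₀ hm1
    have h2 : (1:ℝ) ≤ Λ ^ 2 := one_le_pow₀ hΛ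
    nlinarith
  have hθ15 : 2 ^ 15 * θ ≤ 1 := by
    have : 0 ≤ 2 ^ 15 * θ := by positivity
    nlinarith
  have hK16 : 16 ≤ K := by
    have h1 : K ^ ε ≤ K := by
      calc K ^ ε ≤ K ^ (1:ℝ) := Real.rpow_le_rpow_of_exponent_le hK1 (by linarith)
        _ = K := Real.rpow_one K
    nlinarith
  have hθσ : K ^ (-(ε * σ)) = θ ^ σ := by
    rw [hθdef, ← Real.rpow_mul hK0.le]; congr 1; ring
  have hθσ2 : θ ^ σ ≤ 1/2 := by
    calc θ ^ σ ≤ θ ^ (1:ℝ) := Real.rpow_le_rpow_of_exponent_ge hθ0 (by linarith) (by linarith)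
      _ = θ := Real.rpow_one θ
      _ ≤ 1/2 := by linarith
  have hrS4 : S * (4 * r) ≤ 1 := by
    have : S * (4 * r) ≤ S * (K * r) := by gcongr; linarith
    linarith
  -- upper bound at p0
  have hi : ∀ k : ℕ, bc u p0 k * r ^ k ≤ K ^ (σ - k) * W := by
    intro k
    have h1 := (H.le_ww hp0 (by positivity : 0 ≤ K * r) hKS k).trans hup
    rw [mul_pow] at h1
    rw [Real.rpow_sub hK0, Real.rpow_natCast, div_mul_eq_mul_div, le_div_iff₀ (by positivity)]
    linarith
  have hlo : ∀ q ∈ V, ∀ Y, ww u q (r / K) ≤ K ^ (-((1 - ε) * σ)) * Y → ∀ k : ℕ,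
      bc u q k * r ^ k ≤ K ^ (k - (1 - ε) * σ) * Y := by
    intro q hq Y hY k
    have hrK : r / K ≤ K * r := by
      rw [div_le_iff₀ hK0]
      have h1 : 1 ≤ K * K := by nlinarith
      have h2 := mul_le_mul_of_nonneg_left h1 hr.le
      linarith
    have h1 := (H.le_ww hq (by positivity : 0 ≤ r / K)
      (le_trans (by gcongr) hKS) k).trans hY
    rw [div_pow] at h1
    rw [sub_eq_add_neg, Real.rpow_add hK0, Real.rpow_natCast]
    have h2 : bc u q k * r ^ k = bc u q k * (r ^ k / K ^ k) * K ^ k := by field_simp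
    rw [h2]
    calc _ ≤ K ^ (-((1 - ε) * σ)) * Y * K ^ k := by gcongr
      _ = _ := by ring
  have hlowexp : ∀ k : ℕ, (k:ℝ) ≤ (1 - 2 * ε) * σ → K ^ ((k:ℝ) - (1 - ε) * σ) ≤ θ ^ σ := by
    intro k hk
    rw [← hθσ]
    exact Real.rpow_le_rpow_of_exponent_le hK1 (by linarith)
  have hhighexp : ∀ k : ℕ, (1 + 2 * ε) * σ ≤ k → K ^ (σ - (k:ℝ)) ≤ θ ^ k := by
    intro k hk
    rw [← Real.rpow_natCast θ, hθdef, ← Real.rpow_mul hK0.le]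
    apply Real.rpow_le_rpow_of_exponent_le hK1
    have h1 : (1 - ε) * ((1 + 2 * ε) * σ) ≤ (1 - ε) * k := by
      apply mul_le_mul_of_nonneg_left hk; linarith
    have h2 : σ ≤ (1 - ε) * ((1 + 2 * ε) * σ) := by nlinarith [mul_pos hε0 (by linarith : 0 < σ)]
    linarith
  have h16 : (0:ℝ) < 16 ^ σ := by positivity
  have h4r : ww u p0 (4 * r) ≤ 16 ^ σ * W := by
    apply ww_le
    intro k
    rw [mul_pow]
    have hbk := bc_nonneg u p0 k
    rcases le_or_gt (k:ℝ) (2 * σ) with hk | hk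
    · have h1 := H.le_ww hp0 hr.le (le_trans (by nlinarith) hrS4) k
      have h2 := pow_le_rpow_sq (x := 4) (by norm_num) hk
      norm_num at h2
      calc bc u p0 k * (4 ^ k * r ^ k) = 4 ^ k * (bc u p0 k * r ^ k) := by ring
        _ ≤ 16 ^ σ * W := by gcongr
    · have h1 := hi k
      have h2 : K ^ (σ - k) ≤ 16 ^ (σ - k) :=
        Real.rpow_le_rpow_of_nonpos (by norm_num) hK16 (by linarith)
      have h3 : (16:ℝ) ^ (σ - k) * 4 ^ k ≤ 16 ^ σ := by
        rw [Real.rpow_sub (by norm_num), Real.rpow_natCast, div_mul_eq_mul_div,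
          div_le_iff₀ (by positivity)]
        gcongr
        norm_num
      calc bc u p0 k * (4 ^ k * r ^ k) = 4 ^ k * (bc u p0 k * r ^ k) := by ring
        _ ≤ 4 ^ k * (K ^ (σ - k) * W) := by gcongr
        _ ≤ 4 ^ k * (16 ^ (σ - k) * W) := by gcongr
        _ = (16 ^ (σ - k) * 4 ^ k) * W := by ring
        _ ≤ 16 ^ σ * W := by gcongr
  have hwi : ∀ i, ww u (p i) r ≤ 2 * 16 ^ σ * W := by
    intro i
    have := H.ww_compare (hp i) hp0 hr (hpr i) hrS4
    linarith
  have hloi : ∀ i, ∀ k : ℕ, (k:ℝ) ≤ (1 - 2 * ε) * σ →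
      bc u (p i) k * r ^ k ≤ θ ^ σ * (2 * 16 ^ σ * W) := by
    intro i k hk
    refine (hlo (p i) (hp i) _ (hlow i) k).trans ?_
    have := hwi i
    have h2 := hlowexp k hk
    have h3 : 0 ≤ ww u (p i) r := ww_nonneg hr.le
    gcongr
  have hlo0 : ∀ k : ℕ, (k:ℝ) ≤ (1 - 2 * ε) * σ → bc u p0 k * r ^ k ≤ θ ^ σ * W := by
    intro k hk
    refine (hlo p0 hp0 _ hlow0 k).trans ?_
    have h2 := hlowexp k hk
    gcongr
  -- the peak index
  obtain ⟨k, hk⟩ : ∃ k, W / 2 < bc u p0 k * r ^ k := exists_lt_of_lt_ciSup (by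
    show W / 2 < ww u p0 r
    linarith)
  have hkup : (k:ℝ) ≤ (1 + ε) * σ := by
    by_contra hcon
    push Not at hcon
    have h1 := hi k
    have h2 : K ^ (σ - (k:ℝ)) ≤ θ ^ σ := by
      rw [← hθσ]
      exact Real.rpow_le_rpow_of_exponent_le hK1 (by linarith)
    nlinarith
  have hklo : (1 - 2 * ε) * σ ≤ k := by
    by_contra hcon
    push Not at hcon
    have h1 := hlo0 k hcon.le
    nlinarith
  have hk2 : (2:ℝ) ≤ k := by nlinarith
  have hk2' : 2 ≤ k := by exact_mod_cast hk2
  set X : ℝ := 16 * (512 * θ) ^ σ * W with hX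
  have hX0 : 0 ≤ X := by positivity
  have key : ∀ (T : List (EuclideanSpace ℝ (Fin (m+1)))) (le : List (Fin m)), T.length ≤ 1 →
      (∀ v ∈ T, ‖v‖ ≤ r) → T.length + le.length = k →
      |dd u (T ++ le.map fun i => p i - p0) p0| ≤ (k.factorial : ℝ) * X := by
    intro T le hT1 hTr hlen
    exact key_lemma H hu.1 hp0 p hp hε0 hεm hε1 hεσ hσ20 hθ0 hθ15 hpr hrS4 hr hW hlo0 hloi
      (fun k' hbig => (hi k').trans (mul_le_mul_of_nonneg_right (hhighexp k' hbig) hW.le))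
      hkup hk2' T le hT1 hTr hlen
  have full := full_expand H.hU hu (H.hVU hp0) b hr (X := (k.factorial : ℝ) * X) (by positivity) hΛ
    (fun i => p i - p0) hc (k := k) (by
      intro le hle
      have := key [] le (by simp) (by simp) (by simpa using hle)
      simpa using this) (by
      intro le hle
      have := key [r • b (Fin.last m)] le (by simp) (by
        intro v hv
        rw [List.mem_singleton] at hv
        rw [hv, norm_smul, b.orthonormal.1, mul_one, Real.norm_of_nonneg hr.le]) (by simp; omega)
      simpa using this)
  have hfin : bc u p0 k * r ^ k ≤ (m+1) ^ k * ((m+1) ^ k * (Λ ^ k * X)) := by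
    refine bc_le_of_dd H.hU hu.1 (H.hVU hp0) hr (by positivity) ?_
    intro l hl hv
    refine (full l hl hv).trans (le_of_eq ?_)
    ring
  have hk2σ : (k:ℝ) ≤ 2 * σ := by nlinarith
  have h1 := pow_le_rpow_sq hm1 hk2σ
  have h2 := pow_le_rpow_sq hΛ hk2σ
  have h3 : (((m:ℝ)+1) ^ 2) ^ σ * ((((m:ℝ)+1) ^ 2) ^ σ * ((Λ ^ 2) ^ σ * X)) =
      16 * (((m:ℝ)+1) ^ 2 * (((m:ℝ)+1) ^ 2 * (Λ ^ 2 * (512 * θ)))) ^ σ * W := by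
    rw [Real.mul_rpow (by positivity) (by positivity), Real.mul_rpow (by positivity) (by positivity),
      Real.mul_rpow (by positivity) (by positivity), hX]
    ring
  have h4 : (((m:ℝ)+1) ^ 2 * (((m:ℝ)+1) ^ 2 * (Λ ^ 2 * (512 * θ)))) ≤ 1/64 := by
    have : (((m:ℝ)+1) ^ 2 * (((m:ℝ)+1) ^ 2 * (Λ ^ 2 * (512 * θ)))) =
      (2 ^ 15 * (m+1) ^ 4 * Λ ^ 2 * θ) / 64 := by ring
    rw [this]; linarith
  have h5 : (((m:ℝ)+1) ^ 2 * (((m:ℝ)+1) ^ 2 * (Λ ^ 2 * (512 * θ)))) ^ σ ≤ 1/64 := by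
    calc _ ≤ (((m:ℝ)+1) ^ 2 * (((m:ℝ)+1) ^ 2 * (Λ ^ 2 * (512 * θ)))) ^ (1:ℝ) :=
          Real.rpow_le_rpow_of_exponent_ge (by positivity) (by linarith) (by linarith)
      _ = _ := Real.rpow_one _
      _ ≤ _ := h4
  have h6 : bc u p0 k * r ^ k ≤ 16 * (1/64) * W := by
    calc _ ≤ _ := hfin
      _ ≤ (((m:ℝ)+1) ^ 2) ^ σ * ((((m:ℝ)+1) ^ 2) ^ σ * ((Λ ^ 2) ^ σ * X)) := by gcongr
      _ = _ := h3
      _ ≤ _ := by gcongr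
  linarith

section
variable {E : Type*} [NormedAddCommGroup E] [NormedSpace ℝ E] {u : E → ℝ} {U V : Set E} {G S : ℝ}

lemma TS.fderiv_le (H : TS u U V G S) {x y : E} (hx : x ∈ V) (hy : y ∈ V) {d : ℝ} (hd : 0 < d)
    (hxy : ‖y - x‖ ≤ d) (hS : S * (4 * d) ≤ 1) : ‖fderiv ℝ u y‖ ≤ 2 / d * ww u x (4 * d) := by
  have h0 : 0 ≤ ww u x (4 * d) := ww_nonneg (by positivity)
  refine ContinuousLinearMap.opNorm_le_bound' _ (by positivity) ?_
  intro v hv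
  have hv0 : 0 < ‖v‖ := lt_of_le_of_ne (norm_nonneg v) (Ne.symm hv)
  have hn : ‖(d / ‖v‖) • v‖ ≤ d := by
    rw [norm_smul, Real.norm_of_nonneg (by positivity)]
    exact le_of_eq (by field_simp)
  have h1 := H.dd_compare hy hx hxy hS (L := [(d / ‖v‖) • v]) (by simp) (by simpa using hn)
  simp only [dd_cons, dd_nil, List.length_singleton, Nat.factorial_one, Nat.cast_one, one_mul,
    map_smul, smul_eq_mul, abs_mul] at h1
  rw [abs_of_nonneg (by positivity), div_mul_eq_mul_div, div_le_iff₀ hv0] at h1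
  rw [Real.norm_eq_abs, div_mul_eq_mul_div, div_mul_eq_mul_div, le_div_iff₀ hd]
  linarith

lemma ww_exists {x : E} {r : ℝ} (hr : 0 ≤ r) (h : 0 < ww u x r) : ∃ k, 0 < bc u x k := by
  by_contra hcon
  push Not at hcon
  have : ww u x r ≤ 0 := ww_le fun k => by
    have := mul_le_mul_of_nonneg_right (hcon k) (by positivity : 0 ≤ r ^ k)
    simpa using this
  linarith

lemma TS.ww_pos (H : TS u U V G S) {x : E} (hx : x ∈ V) (h : ∃ k, 0 < bc u x k) {r : ℝ} (hr : 0 < r)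
    (hS : S * r ≤ 1) : 0 < ww u x r := by
  obtain ⟨k, hk⟩ := h
  exact lt_of_lt_of_le (by positivity) (H.le_ww hx hr.le hS k)

lemma TS.convex (H : TS u U V G S) {x : E} (hx : x ∈ V) (h : ∃ k, 0 < bc u x k) :
    ConvexOn ℝ {t : ℝ | S * Real.exp t ≤ 1} (fun t => Real.log (ww u x (Real.exp t))) := by
  have hS := H.hS
  have hset : {t : ℝ | S * Real.exp t ≤ 1} = Iic (Real.log (1 / S)) := by
    ext t
    simp only [mem_ofPred_eq, mem_Iic]
    rw [Real.le_log_iff_exp_le (by positivity), le_div_iff₀ hS, mul_comm]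
  refine ⟨by rw [hset]; exact convex_Iic _, ?_⟩
  intro s hs t ht α β hα hβ hαβ
  have hs' := H.ww_pos hx h (Real.exp_pos s) hs
  have ht' := H.ww_pos hx h (Real.exp_pos t) ht
  have hst : S * Real.exp (α • s + β • t) ≤ 1 := by
    have : α • s + β • t ∈ {t : ℝ | S * Real.exp t ≤ 1} := by
      rw [hset] at *
      exact (convex_Iic _) hs ht hα hβ hαβ
    exact this
  have hp := H.ww_pos hx h (Real.exp_pos (α • s + β • t)) hst
  show Real.log _ ≤ α • Real.log _ + β • Real.log _
  rw [Real.log_le_iff_le_exp hp]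
  apply ww_le
  intro k
  rcases (bc_nonneg u x k).eq_or_lt with h0 | h0
  · rw [← h0, zero_mul]; positivity
  have e1 := Real.log_le_log (by positivity) (H.le_ww hx (Real.exp_pos s).le hs k)
  have e2 := Real.log_le_log (by positivity) (H.le_ww hx (Real.exp_pos t).le ht k)
  rw [← Real.log_le_iff_le_exp (by positivity)]
  rw [Real.log_mul h0.ne' (by positivity), Real.log_pow, Real.log_exp] at e1 e2 ⊢
  simp only [smul_eq_mul]
  have e3 := mul_le_mul_of_nonneg_left e1 hα
  have e4 := mul_le_mul_of_nonneg_left e2 hβ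
  have e5 : Real.log (bc u x k) = (α + β) * Real.log (bc u x k) := by rw [hαβ, one_mul]
  rw [e5]
  nlinarith

lemma TS.slope_mono (H : TS u U V G S) {x : E} (hx : x ∈ V) (h : ∃ k, 0 < bc u x k) {a b c d : ℝ}
    (ha : 0 < a) (hab : a < b) (hcd : c < d) (hac : a ≤ c) (hbd : b ≤ d) (hd : S * d ≤ 1) :
    (Real.log (ww u x b) - Real.log (ww u x a)) / (Real.log b - Real.log a) ≤
    (Real.log (ww u x d) - Real.log (ww u x c)) / (Real.log d - Real.log c) := by
  have hS := H.hS
  have hb : 0 < b := ha.trans hab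
  have hc : 0 < c := by linarith
  have hd0 : 0 < d := by linarith
  have hmem : ∀ y, 0 < y → y ≤ d → Real.log y ∈ {t : ℝ | S * Real.exp t ≤ 1} := by
    intro y hy hyd
    simp only [mem_ofPred_eq]
    rw [Real.exp_log hy]
    exact le_trans (by gcongr) hd
  have hcv := H.convex hx h
  have l1 : Real.log a < Real.log b := Real.log_lt_log ha hab
  have l2 : Real.log c < Real.log d := Real.log_lt_log hc hcd
  have l3 : Real.log a ≤ Real.log c := Real.log_le_log ha hac
  have l4 : Real.log b ≤ Real.log d := Real.log_le_log hb hbd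
  have k1 := hcv.secant_mono (hmem a ha (by linarith)) (hmem b hb hbd) (hmem d hd0 le_rfl)
    l1.ne' (by linarith [l1, l4] : Real.log a < Real.log d).ne' l4
  have k2 := hcv.secant_mono (hmem d hd0 le_rfl) (hmem a ha (by linarith)) (hmem c hc (by linarith))
    (by linarith [l1, l4] : Real.log a < Real.log d).ne l2.ne l3
  simp only [Real.exp_log ha, Real.exp_log hb, Real.exp_log hc, Real.exp_log hd0] at k1 k2
  rw [← neg_div_neg_eq, neg_sub, neg_sub, ← neg_div_neg_eq (_ - _) (Real.log c - _), neg_sub, neg_sub] at k2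
  exact k1.trans k2

end

section
variable {n : ℕ} {u : EuclideanSpace ℝ (Fin n) → ℝ} {U V : Set (EuclideanSpace ℝ (Fin n))} {G S : ℝ}

lemma supGrad_nonneg (s : Set (EuclideanSpace ℝ (Fin n))) : 0 ≤ supGrad u s := by
  apply Real.sSup_nonneg
  rintro _ ⟨x, _, rfl⟩
  positivity

lemma supGrad_le {s : Set (EuclideanSpace ℝ (Fin n))} {B : ℝ} (hB : 0 ≤ B)
    (h : ∀ y ∈ s, ‖fderiv ℝ u y‖ ≤ B) : supGrad u s ≤ B := by
  apply Real.sSup_le _ hB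
  rintro _ ⟨x, hx, rfl⟩
  exact h x hx

lemma le_supGrad {s : Set (EuclideanSpace ℝ (Fin n))} {B : ℝ}
    (h : ∀ y ∈ s, ‖fderiv ℝ u y‖ ≤ B) {y : EuclideanSpace ℝ (Fin n)} (hy : y ∈ s) :
    ‖fderiv ℝ u y‖ ≤ supGrad u s := by
  apply le_csSup
  · refine ⟨B, ?_⟩
    rintro _ ⟨x, hx, rfl⟩
    exact h x hx
  · exact ⟨y, hy, rfl⟩

lemma TS.supGrad_le_ww (H : TS u U V G S) {x : EuclideanSpace ℝ (Fin n)} {r : ℝ} (hr : 0 < r)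
    (hV : ball x r ⊆ V) (hS : S * (4 * r) ≤ 1) :
    supGrad u (ball x r) ≤ 2 / r * ww u x (4 * r) := by
  have h0 : 0 ≤ ww u x (4 * r) := ww_nonneg (by positivity)
  apply supGrad_le (by positivity)
  intro y hy
  refine H.fderiv_le (hV (mem_ball_self hr)) (hV hy) hr ?_ hS
  rw [mem_ball_iff_norm] at hy
  exact hy.le

lemma ww_le_supGrad (hn : 0 < n) {x : EuclideanSpace ℝ (Fin n)} {r B : ℝ} (hr : 0 < r)
    (hu : IsHarmonicOn u (ball x r)) (hB : ∀ y ∈ ball x r, ‖fderiv ℝ u y‖ ≤ B) :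
    ww u x (r / Lam n) ≤ r / Lam n * supGrad u (ball x r) :=
  ww_le fun k => cauchy hn hr (supGrad_nonneg _) hu (fun _ hy => le_supGrad hB hy) k

end

/-- `J` splits into at most `P` classes of diameter at most `R` -/
def Splits {n : ℕ} {ι : Type} (x : ι → EuclideanSpace ℝ (Fin n)) (J : Finset ι) (P : ℕ) (R : ℝ) : Prop :=
  ∃ (k : ℕ) (f : ι → Fin k → ℤ) (s : Finset (Fin k → ℤ)), s.card ≤ P ∧ (∀ i ∈ J, f i ∈ s) ∧
    ∀ i ∈ J, ∀ j ∈ J, f i = f j → ‖x i - x j‖ ≤ R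

section
variable {n : ℕ} {ι : Type}

lemma cells {k D : ℕ} (hD : 0 < D) {r : ℝ} (hr : 0 < r) {τ : Fin k → EuclideanSpace ℝ (Fin n)}
    (hτ : Orthonormal ℝ τ) (p0 : EuclideanSpace ℝ (Fin n)) (J : Finset ι)
    (x : ι → EuclideanSpace ℝ (Fin n)) (hJ : ∀ i ∈ J, ‖x i - p0‖ ≤ r)
    (hres : ∀ i ∈ J, ‖(x i - p0) - ∑ l, ⟪τ l, x i - p0⟫ • τ l‖ ≤ r / D) :
    Splits x J ((2 * D + 1) ^ k) ((k + 2) * (r / D)) := by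
  have hD0 : (0:ℝ) < D := by exact_mod_cast hD
  have hrD : 0 < r / D := by positivity
  refine ⟨k, fun i l => ⌊⟪τ l, x i - p0⟫ / (r / D)⌋,
    Fintype.piFinset fun _ => Finset.Icc (-(D:ℤ)) D, ?_, ?_, ?_⟩
  · rw [Fintype.card_piFinset]
    simp only [Int.card_Icc, Finset.prod_const, Finset.card_univ, Fintype.card_fin]
    apply Nat.pow_le_pow_left
    omega
  · intro i hi
    rw [Fintype.mem_piFinset]
    intro l
    rw [Finset.mem_Icc]
    have h1 : |⟪τ l, x i - p0⟫| ≤ r := by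
      refine (abs_real_inner_le_norm _ _).trans ?_
      rw [hτ.1, one_mul]; exact hJ i hi
    rw [abs_le] at h1
    have h2 : r = D * (r / D) := by field_simp
    constructor
    · rw [Int.le_floor, le_div_iff₀ hrD]; push_cast; linarith
    · have h3 : ⟪τ l, x i - p0⟫ / (r / D) ≤ ((D:ℤ):ℝ) := by
        rw [div_le_iff₀ hrD]; push_cast; linarith
      exact_mod_cast (Int.floor_le _).trans h3
  · intro i hi j hj hij
    have h1 : x i - x j = ((x i - p0) - ∑ l, ⟪τ l, x i - p0⟫ • τ l) -
        ((x j - p0) - ∑ l, ⟪τ l, x j - p0⟫ • τ l) +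
        ∑ l, (⟪τ l, x i - p0⟫ - ⟪τ l, x j - p0⟫) • τ l := by
      simp only [sub_smul, Finset.sum_sub_distrib]; abel
    have h2 : ‖∑ l, (⟪τ l, x i - p0⟫ - ⟪τ l, x j - p0⟫) • τ l‖ ≤ k * (r / D) := by
      calc _ ≤ ∑ l, ‖(⟪τ l, x i - p0⟫ - ⟪τ l, x j - p0⟫) • τ l‖ := norm_sum_le _ _
        _ ≤ ∑ _l : Fin k, (r / D) := by
            refine Finset.sum_le_sum fun l _ => ?_
            rw [norm_smul, hτ.1, mul_one, Real.norm_eq_abs]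
            have h3 := Int.abs_sub_lt_one_of_floor_eq_floor (congrFun hij l)
            rw [← sub_div, abs_div, abs_of_pos hrD, div_lt_one hrD] at h3
            exact h3.le
        _ = _ := by simp
    rw [h1]
    have h4 := norm_add_le (((x i - p0) - ∑ l, ⟪τ l, x i - p0⟫ • τ l) -
        ((x j - p0) - ∑ l, ⟪τ l, x j - p0⟫ • τ l))
        (∑ l, (⟪τ l, x i - p0⟫ - ⟪τ l, x j - p0⟫) • τ l)
    have h5 := norm_sub_le ((x i - p0) - ∑ l, ⟪τ l, x i - p0⟫ • τ l)
        ((x j - p0) - ∑ l, ⟪τ l, x j - p0⟫ • τ l)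
    have h6 := hres i hi
    have h7 := hres j hj
    linarith

lemma cells_any {D : ℕ} (hD : 0 < D) {r : ℝ} (hr : 0 < r) (J : Finset ι)
    (x : ι → EuclideanSpace ℝ (Fin n)) (hJ : ∀ i ∈ J, ∀ j ∈ J, ‖x i - x j‖ ≤ r) :
    Splits x J ((2 * D + 1) ^ n) ((n + 2) * (r / D)) := by
  rcases J.eq_empty_or_nonempty with rfl | ⟨i0, hi0⟩
  · exact ⟨0, fun _ => 0, ∅, by simp, by simp, by simp⟩
  have b := EuclideanSpace.basisFun (Fin n) ℝ
  refine cells hD hr b.orthonormal (x i0) J x (fun i hi => hJ i hi i0 hi0) fun i _ => ?_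
  rw [b.sum_repr' (x i - x i0), sub_self, norm_zero]
  positivity

/-- constants of the greedy procedure -/
noncomputable def LamG (D : ℕ) : ℕ → ℝ
  | 0 => 1
  | j + 1 => D * (1 + j * LamG D j) + LamG D j

lemma LamG_ge (D j : ℕ) : 1 ≤ LamG D j := by
  induction j with
  | zero => exact le_rfl
  | succ j ih =>
    have : (0:ℝ) ≤ D * (1 + j * LamG D j) := by positivity
    simp only [LamG]; linarith

lemma greedy {D : ℕ} (hD : 0 < D) {r : ℝ} (hr : 0 < r) (p0 : EuclideanSpace ℝ (Fin n)) (J : Finset ι)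
    (x : ι → EuclideanSpace ℝ (Fin n)) (hJ : ∀ i ∈ J, ‖x i - p0‖ ≤ r) (j : ℕ) :
    (∃ j' < j, ∃ τ : Fin j' → EuclideanSpace ℝ (Fin n), Orthonormal ℝ τ ∧
      ∀ i ∈ J, ‖(x i - p0) - ∑ l, ⟪τ l, x i - p0⟫ • τ l‖ ≤ r / D) ∨
    (∃ τ : Fin j → EuclideanSpace ℝ (Fin n), Orthonormal ℝ τ ∧ ∃ q : Fin j → ι, (∀ l, q l ∈ J) ∧
      ∀ l, ∃ c : Fin j → ℝ, r • τ l = ∑ i, c i • (x (q i) - p0) ∧ ∑ i, |c i| ≤ LamG D j) := by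
  induction j with
  | zero =>
    right
    exact ⟨fun i => i.elim0, ⟨fun i => i.elim0, fun i => i.elim0⟩, fun i => i.elim0,
      fun i => i.elim0, fun i => i.elim0⟩
  | succ j ih =>
    rcases ih with ⟨j', hj', h⟩ | ⟨τ, hτ, q, hq, hc⟩
    · left; exact ⟨j', by omega, h⟩
    by_cases hall : ∀ i ∈ J, ‖(x i - p0) - ∑ l, ⟪τ l, x i - p0⟫ • τ l‖ ≤ r / D
    · left; exact ⟨j, by omega, τ, hτ, hall⟩
    right
    push Not at hall
    obtain ⟨i, hi, hbig⟩ := hall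
    have hD0 : (0:ℝ) < D := by exact_mod_cast hD
    choose c hc1 hc2 using hc
    set w := x i - p0 with hw
    have hwr : ‖w‖ ≤ r := hJ i hi
    set v := w - ∑ l, ⟪τ l, w⟫ • τ l with hv
    have hv0 : 0 < ‖v‖ := lt_trans (by positivity) hbig
    have horth : ∀ l, ⟪τ l, v⟫ = 0 := by
      intro l
      rw [hv, inner_sub_right, hτ.inner_right_fintype, sub_self]
    have hΛ := LamG_ge D j
    refine ⟨Fin.snoc τ (‖v‖⁻¹ • v), ?_, Fin.snoc q i, ?_, ?_⟩
    · constructor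
      · intro l
        refine Fin.lastCases ?_ (fun l => ?_) l
        · rw [Fin.snoc_last, norm_smul, norm_inv, norm_norm, inv_mul_cancel₀ hv0.ne']
        · rw [Fin.snoc_castSucc]; exact hτ.1 l
      · intro a b
        refine Fin.lastCases ?_ (fun a => ?_) a <;> refine Fin.lastCases ?_ (fun b => ?_) b <;> intro hab
        · exact absurd rfl hab
        · rw [Fin.snoc_last, Fin.snoc_castSucc, inner_smul_left, real_inner_comm, horth, mul_zero]
        · rw [Fin.snoc_last, Fin.snoc_castSucc, inner_smul_right, horth, mul_zero]
        · rw [Fin.snoc_castSucc, Fin.snoc_castSucc]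
          exact hτ.2 (by rintro rfl; exact hab rfl)
    · intro l
      refine Fin.lastCases ?_ (fun l => ?_) l
      · rw [Fin.snoc_last]; exact hi
      · rw [Fin.snoc_castSucc]; exact hq l
    · intro l
      refine Fin.lastCases ?_ (fun l => ?_) l
      · refine ⟨Fin.snoc (fun a => -(r / ‖v‖) * ∑ l, (⟪τ l, w⟫ / r) * c l a) (r / ‖v‖), ?_, ?_⟩
        · rw [Fin.snoc_last, Fin.sum_univ_castSucc]
          simp only [Fin.snoc_castSucc, Fin.snoc_last]
          have h1 : ∀ l, ⟪τ l, w⟫ • τ l = ∑ a, ((⟪τ l, w⟫ / r) * c l a) • (x (q a) - p0) := by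
            intro l
            have : ⟪τ l, w⟫ • τ l = (⟪τ l, w⟫ / r) • (r • τ l) := by
              rw [smul_smul]; congr 1; field_simp
            rw [this, hc1 l, Finset.smul_sum]
            simp only [smul_smul]
          have h2 : ∑ l, ⟪τ l, w⟫ • τ l =
              ∑ a, (∑ l, (⟪τ l, w⟫ / r) * c l a) • (x (q a) - p0) := by
            simp only [Finset.sum_smul]
            rw [Finset.sum_comm]
            exact Finset.sum_congr rfl fun l _ => h1 l
          have h3 : ∑ a, (-(r / ‖v‖) * ∑ l, (⟪τ l, w⟫ / r) * c l a) • (x (q a) - p0) =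
              -(r / ‖v‖) • ∑ l, ⟪τ l, w⟫ • τ l := by
            rw [h2, Finset.smul_sum]; simp only [smul_smul]
          rw [h3, ← hw, smul_smul, ← div_eq_mul_inv, hv, smul_sub, neg_smul]
          abel
        · rw [Fin.sum_univ_castSucc]
          simp only [Fin.snoc_castSucc, Fin.snoc_last]
          have hrv : r / ‖v‖ ≤ D := by
            rw [div_le_iff₀ hv0]
            rw [div_lt_iff₀ hD0] at hbig
            linarith
          have hrv0 : 0 < r / ‖v‖ := by positivity
          have h1 : ∑ a, |∑ l, (⟪τ l, w⟫ / r) * c l a| ≤ j * LamG D j := by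
            calc _ ≤ ∑ a, ∑ l, |c l a| := by
                  refine Finset.sum_le_sum fun a _ => (Finset.abs_sum_le_sum_abs _ _).trans ?_
                  refine Finset.sum_le_sum fun l _ => ?_
                  rw [abs_mul, abs_div, abs_of_pos hr]
                  have h4 : |⟪τ l, w⟫| ≤ r := by
                    refine (abs_real_inner_le_norm _ _).trans ?_
                    rw [hτ.1, one_mul]; exact hwr
                  exact mul_le_of_le_one_left (abs_nonneg _) ((div_le_one hr).2 h4)
              _ = ∑ l, ∑ a, |c l a| := Finset.sum_comm
              _ ≤ ∑ _l : Fin j, LamG D j := Finset.sum_le_sum fun l _ => hc2 l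
              _ = _ := by simp
          simp only [abs_mul, abs_neg, abs_of_pos hrv0, ← Finset.mul_sum]
          have h5 : (0:ℝ) ≤ j * LamG D j := by positivity
          simp only [LamG]
          calc _ ≤ r / ‖v‖ * (j * LamG D j) + r / ‖v‖ := by gcongr
            _ = r / ‖v‖ * (1 + j * LamG D j) := by ring
            _ ≤ D * (1 + j * LamG D j) := by gcongr
            _ ≤ _ := by linarith
      · refine ⟨Fin.snoc (c l) 0, ?_, ?_⟩
        · rw [Fin.snoc_castSucc, Fin.sum_univ_castSucc]
          simp only [Fin.snoc_castSucc, Fin.snoc_last, zero_smul, add_zero]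
          exact hc1 l
        · rw [Fin.sum_univ_castSucc]
          simp only [Fin.snoc_castSucc, Fin.snoc_last, abs_zero, add_zero, LamG]
          have : (0:ℝ) ≤ D * (1 + j * LamG D j) := by positivity
          linarith [hc2 l]

end

/-- logarithmic slope -/
noncomputable def sl {E : Type*} [NormedAddCommGroup E] [NormedSpace ℝ E] (u : E → ℝ) (x : E)
    (K r : ℝ) : ℝ := (Real.log (ww u x (K * r)) - Real.log (ww u x r)) / Real.log K

lemma Splits.mono {n : ℕ} {ι : Type} {x : ι → EuclideanSpace ℝ (Fin n)} {J : Finset ι} {P Q : ℕ} {R T : ℝ}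
    (h : Splits x J P R) (hPQ : P ≤ Q) (hRT : R ≤ T) : Splits x J Q T := by
  obtain ⟨k, f, s, h1, h2, h3⟩ := h
  exact ⟨k, f, s, h1.trans hPQ, h2, fun i hi j hj hij => (h3 i hi j hj hij).trans hRT⟩

theorem good_cell {m : ℕ} {ι : Type} {U V : Set (EuclideanSpace ℝ (Fin (m+1)))} {G S : ℝ}
    {u : EuclideanSpace ℝ (Fin (m+1)) → ℝ} (H : TS u U V G S) (hu : IsHarmonicOn u U) {D : ℕ}
    (hD : 0 < D) {r K ε : ℝ} (hr : 0 < r) (J : Finset ι) (hne : J.Nonempty)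
    (x : ι → EuclideanSpace ℝ (Fin (m+1))) (hxV : ∀ i ∈ J, x i ∈ V)
    (hJ : ∀ i ∈ J, ∀ j ∈ J, ‖x i - x j‖ ≤ r) (hpos : ∀ i ∈ J, ∃ k, 0 < bc u (x i) k)
    (hε : ε = 1 / (10 * (m+1))) (hK1 : 1 < K)
    (hK : 2 ^ 15 * (m+1) ^ 4 * (LamG D m) ^ 2 ≤ K ^ ε) (hKS : S * (K * r) ≤ 1)
    (hσ : ∀ i ∈ J, 20 * (m+1) ≤ sl u (x i) K r)
    (hgood : ∀ i ∈ J, (1 - ε) * sl u (x i) K r ≤ sl u (x i) K (r / K)) :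
    0 < m ∧ Splits x J ((2 * D + 1) ^ (m - 1)) ((m + 3) * (r / D)) := by
  obtain ⟨i0, hi0, hmin⟩ := J.exists_min_image (fun i => sl u (x i) K r) hne
  have hD0 : (0:ℝ) < D := by exact_mod_cast hD
  rcases greedy hD hr (x i0) J x (fun i hi => hJ i hi i0 hi0) m with
    ⟨j', hj', τ, hτ, hres⟩ | ⟨τ, hτ, q, hq, hc⟩
  · refine ⟨by omega, (cells hD hr hτ (x i0) J x (fun i hi => hJ i hi i0 hi0) hres).mono ?_ ?_⟩
    · exact Nat.pow_le_pow_right (by omega) (by omega)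
    · have : (j':ℝ) ≤ m := by exact_mod_cast hj'.le
      have h2 : 0 < r / D := by positivity
      apply mul_le_mul_of_nonneg_right _ h2.le
      linarith
  exfalso
  have hK0 : 0 < K := by linarith
  have hlK : 0 < Real.log K := Real.log_pos hK1
  have hS := H.hS
  have hle1 : r ≤ K * r := by nlinarith
  have hle2 : r / K ≤ r := div_le_self hr.le hK1.le
  have hε1 : ε ≤ 1 := by
    rw [hε, div_le_one (by positivity)]
    have : (0:ℝ) ≤ m := Nat.cast_nonneg m
    linarith
  have p1 : ∀ i ∈ J, 0 < ww u (x i) (K * r) := fun i hi =>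
    H.ww_pos (hxV i hi) (hpos i hi) (by positivity) hKS
  have p2 : ∀ i ∈ J, 0 < ww u (x i) r := fun i hi =>
    H.ww_pos (hxV i hi) (hpos i hi) hr (le_trans (by gcongr) hKS)
  have p3 : ∀ i ∈ J, 0 < ww u (x i) (r / K) := fun i hi =>
    H.ww_pos (hxV i hi) (hpos i hi) (by positivity) (le_trans (by gcongr; linarith) hKS)
  set σ := sl u (x i0) K r with hσdef
  have low : ∀ i ∈ J, ww u (x i) (r / K) ≤ K ^ (-((1 - ε) * σ)) * ww u (x i) r := by
    intro i hi
    have h1 : (1 - ε) * σ ≤ sl u (x i) K (r / K) :=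
      (mul_le_mul_of_nonneg_left (hmin i hi) (by linarith)).trans (hgood i hi)
    rw [sl, mul_div_cancel₀ _ hK0.ne', le_div_iff₀ hlK] at h1
    rw [← Real.log_le_log_iff (p3 i hi) (mul_pos (Real.rpow_pos_of_pos hK0 _) (p2 i hi)),
      Real.log_mul (Real.rpow_pos_of_pos hK0 _).ne' (p2 i hi).ne', Real.log_rpow hK0]
    linarith
  obtain ⟨b, hb⟩ := Orthonormal.exists_orthonormalBasis_extension_of_card_eq (𝕜 := ℝ)
    (E := EuclideanSpace ℝ (Fin (m+1))) (ι := Fin (m+1)) (by simp)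
    (v := fun i => if h : (i:ℕ) < m then τ ⟨i, h⟩ else 0) (s := {i | (i:ℕ) < m}) (by
      constructor
      · rintro ⟨i, hi⟩
        have hi' : (i:ℕ) < m := hi
        simp only [Set.domRestrict_apply, hi', dif_pos]
        exact hτ.1 _
      · rintro ⟨i, hi⟩ ⟨j, hj⟩ hij
        have hi' : (i:ℕ) < m := hi
        have hj' : (j:ℕ) < m := hj
        simp only [Set.domRestrict_apply, hi', hj', dif_pos]
        apply hτ.2
        intro h
        apply hij
        rw [Fin.mk.injEq] at h
        exact Subtype.ext (Fin.ext h))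
  refine unit_lemma H hu b (hxV i0 hi0) (fun l => x (q l)) (fun l => hxV _ (hq l)) hε hr
    (fun l => hJ _ (hq l) _ hi0) (LamG_ge D m) ?_ hK1.le hK hKS (hσ i0 hi0) (p2 i0 hi0) ?_
    (low i0 hi0) (fun l => low _ (hq l))
  · intro i hi
    have hi' : (i:ℕ) < m := by
      rcases lt_or_ge (i:ℕ) m with h | h
      · exact h
      · exact absurd (Fin.ext (by simp; omega)) hi
    rw [hb i hi', dif_pos hi']
    exact hc _
  · rw [← Real.log_le_log_iff (p1 i0 hi0) (mul_pos (Real.rpow_pos_of_pos hK0 _) (p2 i0 hi0)),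
      Real.log_mul (Real.rpow_pos_of_pos hK0 _).ne' (p2 i0 hi0).ne', Real.log_rpow hK0, sl,
      div_mul_cancel₀ _ hlK.ne']
    linarith

lemma counting {n : ℕ} {ι : Type} (x : ι → EuclideanSpace ℝ (Fin n)) (R : ℕ → ℝ) (P Q C m : ℕ) (hP : 1 ≤ P) (hQ : 1 ≤ Q)
    (good : ℕ → ι → Prop) (I : Finset ι)
    (hgood : ∀ k < m, ∀ J ⊆ I, (∀ i ∈ J, ∀ j ∈ J, ‖x i - x j‖ ≤ R k) → (∀ i ∈ J, good k i) →
      Splits x J P (R (k+1)))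
    (hany : ∀ k < m, ∀ J ⊆ I, (∀ i ∈ J, ∀ j ∈ J, ‖x i - x j‖ ≤ R k) → Splits x J Q (R (k+1)))
    (hend : ∀ J ⊆ I, (∀ i ∈ J, ∀ j ∈ J, ‖x i - x j‖ ≤ R m) → J.card ≤ C) [∀ k i, Decidable (good k i)] :
    ∀ (s : ℕ), s ≤ m → ∀ (b : ℕ), ∀ J ⊆ I, (∀ i ∈ J, ∀ j ∈ J, ‖x i - x j‖ ≤ R (m - s)) →
      (∀ i ∈ J, ((Finset.Ico (m - s) m).filter fun k => ¬ good k i).card ≤ b) →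
      J.card ≤ C * (2 * P) ^ s * Q ^ b := by
  classical
  intro s
  induction s with
  | zero =>
    intro _ b J hJI hJ hb
    rcases J.eq_empty_or_nonempty with rfl | ⟨i, hi⟩
    · simp
    have h1 := hend J hJI (by simpa using hJ)
    calc J.card ≤ C * 1 * 1 := by simpa using h1
      _ ≤ _ := by gcongr
                  · simp
                  · exact Nat.one_le_pow _ _ hQ
  | succ s ih =>
    intro hs b J hJI hJ hb
    have hk : m - (s+1) < m := by omega
    have hk1 : m - (s+1) + 1 = m - s := by omega
    have hsub : ∀ i, ((Finset.Ico (m - s) m).filter fun k => ¬ good k i) ⊆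
        ((Finset.Ico (m - (s+1)) m).filter fun k => ¬ good k i) := by
      intro i
      apply Finset.filter_subset_filter
      apply Finset.Ico_subset_Ico_left
      omega
    have step : ∀ J' ⊆ J, ∀ P' b', Splits x J' P' (R (m - s)) →
        (∀ i ∈ J', ((Finset.Ico (m - s) m).filter fun k => ¬ good k i).card ≤ b') →
        J'.card ≤ (C * (2 * P) ^ s * Q ^ b') * P' := by
      intro J' hJ' P' b' hsp hb'
      obtain ⟨k, f, t, h1, h2, h3⟩ := hsp
      refine (Finset.card_le_mul_card_image_of_maps_to h2 (C * (2 * P) ^ s * Q ^ b') ?_).trans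
        (Nat.mul_le_mul_left _ h1)
      intro y _
      refine ih (by omega) b' _ ((Finset.filter_subset _ _).trans (hJ'.trans hJI)) ?_ ?_
      · intro i hi j hj
        rw [Finset.mem_filter] at hi hj
        exact h3 i hi.1 j hj.1 (hi.2.trans hj.2.symm)
      · intro i hi
        rw [Finset.mem_filter] at hi
        exact hb' i hi.1
    set k := m - (s+1) with hkdef
    have hg := step (J.filter fun i => good k i) (Finset.filter_subset _ _) P b (by
      rw [← hk1]
      refine hgood k hk _ ((Finset.filter_subset _ _).trans hJI) ?_ ?_
      · intro i hi j hj
        exact hJ i (Finset.mem_filter.1 hi).1 j (Finset.mem_filter.1 hj).1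
      · intro i hi
        exact (Finset.mem_filter.1 hi).2) (by
      intro i hi
      exact (Finset.card_le_card (hsub i)).trans (hb i (Finset.mem_filter.1 hi).1))
    have hbd : (J.filter fun i => ¬ good k i).card ≤ C * (2 * P) ^ s * Q ^ b := by
      have hlt : ∀ i ∈ J.filter (fun i => ¬ good k i),
          ((Finset.Ico (m - s) m).filter fun k => ¬ good k i).card + 1 ≤ b := by
        intro i hi
        rw [Finset.mem_filter] at hi
        refine le_trans ?_ (hb i hi.1)
        apply Finset.card_lt_card
        refine ⟨hsub i, fun h => ?_⟩
        have := h (Finset.mem_filter.2 ⟨Finset.mem_Ico.2 ⟨le_rfl, hk⟩, hi.2⟩)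
        rw [Finset.mem_filter, Finset.mem_Ico] at this
        omega
      rcases Nat.eq_zero_or_pos b with rfl | hb0
      · rw [Finset.filter_eq_empty_iff.2]
        · simp
        · intro i hi hng
          have := hlt i (Finset.mem_filter.2 ⟨hi, hng⟩)
          omega
      have := step (J.filter fun i => ¬ good k i) (Finset.filter_subset _ _) Q (b - 1) (by
        rw [← hk1]
        refine hany k hk _ ((Finset.filter_subset _ _).trans hJI) ?_
        intro i hi j hj
        exact hJ i (Finset.mem_filter.1 hi).1 j (Finset.mem_filter.1 hj).1) (by
        intro i hi
        have := hlt i hi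
        omega)
      refine this.trans (le_of_eq ?_)
      rw [mul_assoc, ← pow_succ, Nat.sub_add_cancel hb0]
    have hsum := Finset.card_filter_add_card_filter_not (s := J) (fun i => good k i)
    calc J.card ≤ C * (2 * P) ^ s * Q ^ b * P + C * (2 * P) ^ s * Q ^ b := by omega
      _ = C * (2 * P) ^ s * Q ^ b * (P + 1) := by ring
      _ ≤ C * (2 * P) ^ s * Q ^ b * (2 * P) := by gcongr; omega
      _ = _ := by ring

lemma bad_count (f : ℕ → ℝ) (a m : ℕ) {ε νmin νmax : ℝ} (hε : 0 < ε) (hmin : 0 < νmin)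
    (h0 : ∀ k < m + a, νmin ≤ f k) (hmax : ∀ k < a, f k ≤ νmax) (anti : ∀ k < m, f (k + a) ≤ f k)
    (s : Finset ℕ) (hs : ∀ k ∈ s, k < m ∧ f (k + a) < (1 - ε) * f k) :
    s.card * (ε * νmin) ≤ a * νmax := by
  have hsub : s ⊆ Finset.range m := fun k hk => Finset.mem_range.2 (hs k hk).1
  have h1 : ∑ k ∈ s, ε * νmin ≤ ∑ k ∈ s, (f k - f (k + a)) := by
    refine Finset.sum_le_sum fun k hk => ?_
    obtain ⟨hkm, hk⟩ := hs k hk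
    have := mul_le_mul_of_nonneg_left (h0 k (by omega)) hε.le
    linarith
  have h2 : ∑ k ∈ s, (f k - f (k + a)) ≤ ∑ k ∈ Finset.range m, (f k - f (k + a)) :=
    Finset.sum_le_sum_of_subset_of_nonneg hsub fun k hk _ => by
      have := anti k (Finset.mem_range.1 hk)
      linarith
  have e1 := Finset.sum_range_add f m a
  have e2 := Finset.sum_range_add f a m
  rw [add_comm a m, e1] at e2
  have h3 : ∑ k ∈ Finset.range a, f k ≤ a * νmax := by
    calc _ ≤ ∑ _k ∈ Finset.range a, νmax := Finset.sum_le_sum fun k hk => hmax k (Finset.mem_range.1 hk)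
      _ = _ := by simp
  have h4 : 0 ≤ ∑ k ∈ Finset.range a, f (m + k) := Finset.sum_nonneg fun k hk => by
    have := h0 (m + k) (by have := Finset.mem_range.1 hk; omega)
    linarith
  have h6 : ∑ k ∈ Finset.range m, (f k - f (k + a)) = ∑ k ∈ Finset.range m, f k -
      ∑ k ∈ Finset.range m, f (k + a) := by rw [Finset.sum_sub_distrib]
  have h5 : ∑ k ∈ Finset.range m, f (k + a) = ∑ k ∈ Finset.range m, f (a + k) :=
    Finset.sum_congr rfl fun k _ => by rw [add_comm]
  rw [Finset.sum_const, nsmul_eq_mul] at h1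
  linarith

section
variable {n : ℕ} {u : EuclideanSpace ℝ (Fin n) → ℝ}

lemma Lam_ge (hn : 0 < n) : 12 * (n:ℝ) ≤ Lam n := by
  have : (1:ℝ) ≤ n := by exact_mod_cast hn
  unfold Lam
  have : (1:ℝ) ≤ n ^ 2 := one_le_pow₀ this
  nlinarith

lemma Lam_ge' (hn : 0 < n) : 12 ≤ Lam n := by
  have : (1:ℝ) ≤ n := by exact_mod_cast hn
  linarith [Lam_ge hn]

lemma setup (hn : 0 < n) {cQ : EuclideanSpace ℝ (Fin n)} {ℓ : ℝ} (hℓ : 0 < ℓ)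
    (hu : IsHarmonicOn u (ball cQ (100 * n * ℓ))) : ∃ G B : ℝ,
    TS u (ball cQ (100 * n * ℓ)) (ball cQ (50 * n * ℓ)) G (Lam n / (10 * n * ℓ)) ∧
    ∀ y ∈ ball cQ (60 * n * ℓ), ‖fderiv ℝ u y‖ ≤ B := by
  have hn0 : (0:ℝ) < n := by exact_mod_cast hn
  have hL := Lam_ge' hn
  have hc : ContinuousOn (fun y => ‖fderiv ℝ u y‖) (closedBall cQ (60 * n * ℓ)) := by
    have h1 : ContinuousOn (fderiv ℝ u) (ball cQ (100 * n * ℓ)) :=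
      hu.1.continuousOn_fderiv_of_isOpen isOpen_ball (by exact_mod_cast le_top)
    exact (h1.mono (closedBall_subset_ball (by nlinarith [mul_pos hn0 hℓ]))).norm
  obtain ⟨B, hB⟩ := (isCompact_closedBall cQ (60 * n * ℓ)).exists_bound_of_continuousOn hc
  have hB' : ∀ y ∈ ball cQ (60 * n * ℓ), ‖fderiv ℝ u y‖ ≤ B := fun y hy => by
    simpa using hB y (ball_subset_closedBall hy)
  have hnl := mul_pos hn0 hℓ
  have hB0 : 0 ≤ B := (norm_nonneg _).trans (hB' cQ (mem_ball_self (by positivity)))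
  refine ⟨10 * n * ℓ / Lam n * B, B, ⟨isOpen_ball, hu.1, ball_subset_ball (by nlinarith),
    convex_ball _ _, by positivity, by positivity, ?_⟩, hB'⟩
  intro y hy k
  have hsub : ball y (10 * n * ℓ) ⊆ ball cQ (60 * n * ℓ) := by
    apply ball_subset_ball'
    rw [mem_ball] at hy
    nlinarith
  have h1 := cauchy hn (r := 10 * n * ℓ) (by positivity) hB0
    (harm_mono (hsub.trans (ball_subset_ball (by nlinarith))) hu) (fun z hz => hB' z (hsub hz)) k
  have h2 : (0:ℝ) < (10 * n * ℓ / Lam n) ^ k := by positivity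
  rw [← le_div_iff₀ h2] at h1
  refine h1.trans (le_of_eq ?_)
  rw [div_eq_mul_inv, ← inv_pow, inv_div]

/-- lower bound for the slope coming from a large doubling index -/
lemma lower_slope (hn : 0 < n) {U V : Set (EuclideanSpace ℝ (Fin n))} {G S B : ℝ} (H : TS u U V G S)
    (hu : IsHarmonicOn u U) {x : EuclideanSpace ℝ (Fin n)} {r N : ℝ} (hr : 0 < r) (hN : 0 < N)
    (hV : ball x (10 * n * r) ⊆ V) (hB : ∀ y ∈ ball x r, ‖fderiv ℝ u y‖ ≤ B)
    (hS : S * (40 * n * r) ≤ 1)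
    (hlog : N < Real.log (supGrad u (ball x (10 * n * r)) / supGrad u (ball x r))) :
    (∃ k, 0 < bc u x k) ∧ N / Real.log (40 * n * Lam n) ≤
      (Real.log (ww u x (40 * n * r)) - Real.log (ww u x (r / Lam n))) /
        (Real.log (40 * n * r) - Real.log (r / Lam n)) := by
  have hn1 : (1:ℝ) ≤ n := by exact_mod_cast hn
  have hn0 : (0:ℝ) < n := by linarith
  have hL := Lam_ge' hn
  have hL0 : 0 < Lam n := by linarith
  have hS0 := H.hS
  have hnr : r ≤ n * r := by nlinarith
  have hxV : x ∈ V := hV (mem_ball_self (by positivity))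
  have hsub : ball x r ⊆ ball x (10 * n * r) := ball_subset_ball (by linarith)
  have g0 : 0 ≤ supGrad u (ball x r) := supGrad_nonneg _
  have gpos : 0 < supGrad u (ball x r) := by
    rcases g0.eq_or_lt with h | h
    · rw [← h] at hlog; simp at hlog; linarith
    · exact h
  have h4 := H.supGrad_le_ww hr (hsub.trans hV) (le_trans (by gcongr; linarith) hS)
  have hwpos : 0 < ww u x (4 * r) := by
    have : 0 < 2 / r * ww u x (4 * r) := lt_of_lt_of_le gpos h4
    exact pos_of_mul_pos_right this (by positivity)
  have hex := ww_exists (by positivity) hwpos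
  refine ⟨hex, ?_⟩
  have hrL : r / Lam n ≤ 40 * n * r := by
    have : r / Lam n ≤ r := div_le_self hr.le (by linarith)
    linarith
  have p1 := H.ww_pos hxV hex (by positivity : 0 < r / Lam n) (le_trans (by gcongr) hS)
  have p2 := H.ww_pos hxV hex (by positivity : 0 < 40 * n * r) hS
  have h5 := H.supGrad_le_ww (r := 10 * n * r) (by positivity) hV (by
    rw [show 4 * (10 * n * r) = 40 * n * r by ring]; exact hS)
  rw [show 4 * (10 * n * r) = 40 * n * r by ring] at h5
  have h6 := ww_le_supGrad hn hr (harm_mono ((hsub.trans hV).trans H.hVU) hu) hB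
  have hrat : supGrad u (ball x (10 * n * r)) / supGrad u (ball x r) ≤
      ww u x (40 * n * r) / ww u x (r / Lam n) := by
    rw [div_le_div_iff₀ gpos p1]
    calc _ ≤ (2 / (10 * n * r) * ww u x (40 * n * r)) * (r / Lam n * supGrad u (ball x r)) := by
          gcongr
      _ = (2 / (10 * n * Lam n)) * (ww u x (40 * n * r) * supGrad u (ball x r)) := by field_simp
      _ ≤ 1 * (ww u x (40 * n * r) * supGrad u (ball x r)) := by
          gcongr
          rw [div_le_one (by positivity)]
          nlinarith
      _ = _ := one_mul _
  have hG : 0 < supGrad u (ball x (10 * n * r)) / supGrad u (ball x r) := by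
    have g1 : 0 ≤ supGrad u (ball x (10 * n * r)) := supGrad_nonneg _
    rcases (div_nonneg g1 g0).eq_or_lt with h | h
    · rw [← h] at hlog; simp at hlog; linarith
    · exact h
  have hl := Real.log_le_log hG hrat
  rw [Real.log_div p2.ne' p1.ne'] at hl
  have hd : Real.log (40 * n * r) - Real.log (r / Lam n) = Real.log (40 * n * Lam n) := by
    rw [← Real.log_div (by positivity) (by positivity)]
    congr 1; field_simp
  rw [hd]
  have : 0 < Real.log (40 * n * Lam n) := Real.log_pos (by nlinarith)
  gcongr
  linarith

/-- upper bound for the slope coming from doubling bounds -/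
lemma upper_slope (hn : 0 < n) {U V : Set (EuclideanSpace ℝ (Fin n))} {G S B ℓ : ℝ} (H : TS u U V G S)
    (hu : IsHarmonicOn u U) {x : EuclideanSpace ℝ (Fin n)} {r K N : ℝ} {t : ℕ} (hr : 0 < r) (hN : 1 ≤ N)
    (hK : 1 < K) (hx : ∃ k, 0 < bc u x k) (hℓ : 0 < ℓ)
    (hV : ball x (10 * n * ℓ) ⊆ V) (hB : ∀ y ∈ ball x (10 * n * ℓ), ‖fderiv ℝ u y‖ ≤ B)
    (hS : S * (10 * n * ℓ / Lam n) ≤ 1) (ht : 4 * Lam n * K ≤ (10 * n) ^ t)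
    (htr : (10 * n) ^ t * (r / 4) ≤ 10 * n * ℓ)
    (hdb : ∀ r, 0 < r → r ≤ ℓ → Real.log (supGrad u (ball x (10 * n * r)) / supGrad u (ball x r)) ≤ 2 * N) :
    sl u x K r ≤ N * (t * (Real.log (10 * n) + 2) / Real.log K) := by
  have hn1 : (1:ℝ) ≤ n := by exact_mod_cast hn
  have hn0 : (0:ℝ) < n := by linarith
  have hL := Lam_ge' hn
  have hL0 : 0 < Lam n := by linarith
  have hS0 := H.hS
  have hxV : x ∈ V := hV (mem_ball_self (by positivity))
  have hlK : 0 < Real.log K := Real.log_pos hK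
  have hn10 : (1:ℝ) ≤ 10 * n := by linarith
  have hrad : ∀ i ≤ t, (10 * (n:ℝ)) ^ i * (r / 4) ≤ 10 * n * ℓ := by
    intro i hi
    refine le_trans ?_ htr
    gcongr
  have hsub : ∀ i ≤ t, ball x ((10 * (n:ℝ)) ^ i * (r / 4)) ⊆ ball x (10 * n * ℓ) := fun i hi =>
    ball_subset_ball (hrad i hi)
  have hlamr : (10 * n) ^ t * (r / 4) / Lam n ≤ 10 * n * ℓ / Lam n := by gcongr
  have hKr : K * r ≤ (10 * n) ^ t * (r / 4) / Lam n := by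
    rw [le_div_iff₀ hL0]
    have := mul_le_mul_of_nonneg_right ht (by positivity : 0 ≤ r / 4)
    linarith
  have hKS : S * (K * r) ≤ 1 := le_trans (by gcongr; exact hKr.trans hlamr) hS
  have hrK : r ≤ K * r := by nlinarith
  have hrS : S * r ≤ 1 := le_trans (by gcongr) hKS
  have p1 := H.ww_pos hxV hx hr hrS
  have p2 := H.ww_pos hxV hx (by positivity : 0 < K * r) hKS
  have gpos : ∀ i ≤ t, 0 < supGrad u (ball x ((10 * (n:ℝ)) ^ i * (r / 4))) := by
    intro i hi
    have h1 := ww_le_supGrad hn (by positivity : 0 < (10 * (n:ℝ)) ^ i * (r / 4))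
      (harm_mono (((hsub i hi).trans hV).trans H.hVU) hu) (fun y hy => hB y (hsub i hi hy))
    have h2 := H.ww_pos hxV hx (by positivity : 0 < (10 * (n:ℝ)) ^ i * (r / 4) / Lam n)
      (le_trans (mul_le_mul_of_nonneg_left (div_le_div_of_nonneg_right (hrad i hi) hL0.le) hS0.le) hS)
    exact pos_of_mul_pos_right (lt_of_lt_of_le h2 h1) (by positivity)
  have hit : ∀ i ≤ t, supGrad u (ball x ((10 * (n:ℝ)) ^ i * (r / 4))) ≤
      Real.exp (i * (2 * N)) * supGrad u (ball x (r / 4)) := by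
    intro i
    induction i with
    | zero => intro _; simp
    | succ i ih =>
      intro hi
      have h1 := ih (by omega)
      have h2 := gpos i (by omega)
      have h3 := hrad (i+1) hi
      rw [pow_succ] at h3
      have h4 := hdb ((10 * (n:ℝ)) ^ i * (r / 4)) (by positivity) (by
        have : 10 * n * ((10 * (n:ℝ)) ^ i * (r / 4)) ≤ 10 * n * ℓ := by linarith
        exact le_of_mul_le_mul_left this (by positivity))
      have h5 := (Real.le_exp_log _).trans (Real.exp_le_exp.2 h4)
      rw [div_le_iff₀ h2] at h5
      rw [show (10 * (n:ℝ)) ^ (i+1) * (r / 4) = 10 * n * ((10 * (n:ℝ)) ^ i * (r / 4)) by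
        rw [pow_succ]; ring]
      refine h5.trans ?_
      have h6 : Real.exp ((i+1 : ℕ) * (2 * N)) = Real.exp (2 * N) * Real.exp (i * (2 * N)) := by
        rw [← Real.exp_add]; congr 1; push_cast; ring
      rw [h6, mul_assoc]
      gcongr
  have h7 := (H.ww_mono hxV (by positivity) hKr (le_trans (by gcongr) hS)).trans
    (ww_le_supGrad hn (by positivity : 0 < (10 * (n:ℝ)) ^ t * (r / 4))
      (harm_mono (((hsub t le_rfl).trans hV).trans H.hVU) hu) (fun y hy => hB y (hsub t le_rfl hy)))
  have h8 := hit t le_rfl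
  have h0 := hsub 0 (by omega)
  rw [pow_zero, one_mul] at h0
  have h9 := H.supGrad_le_ww (by positivity : 0 < r / 4) (h0.trans hV) (by
    rw [show 4 * (r / 4) = r by ring]; exact hrS)
  rw [show 4 * (r / 4) = r by ring] at h9
  have h10 : ww u x (K * r) ≤ (10 * n) ^ t * Real.exp (t * (2 * N)) * ww u x r := by
    calc _ ≤ _ := h7
      _ ≤ (10 * n) ^ t * (r / 4) / Lam n * (Real.exp (t * (2 * N)) * (2 / (r / 4) * ww u x r)) := by
          gcongr
          exact h8.trans (by gcongr)
      _ = 2 / Lam n * ((10 * n) ^ t * Real.exp (t * (2 * N)) * ww u x r) := by field_simp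
      _ ≤ 1 * ((10 * n) ^ t * Real.exp (t * (2 * N)) * ww u x r) := by
          gcongr
          rw [div_le_one hL0]; linarith
      _ = _ := one_mul _
  have h11 := Real.log_le_log p2 h10
  rw [Real.log_mul (by positivity) p1.ne', Real.log_mul (by positivity) (by positivity), Real.log_pow,
    Real.log_exp] at h11
  rw [sl, mul_div_assoc', div_le_div_iff_of_pos_right hlK]
  have h12 : 0 ≤ Real.log (10 * n) := Real.log_nonneg hn10
  have h13 : (t:ℝ) * Real.log (10 * n) ≤ N * (t * Real.log (10 * n)) :=
    le_mul_of_one_le_left (by positivity) hN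
  linarith

end

lemma TS.chain {E : Type*} [NormedAddCommGroup E] [NormedSpace ℝ E] {u : E → ℝ} {U V : Set E} {G S : ℝ}
    (H : TS u U V G S) {x1 : E} (hx1 : x1 ∈ V) (hex : ∃ k, 0 < bc u x1 k) {d : ℝ} (hd : 0 < d)
    (hS : S * (16 * d) ≤ 1) (t : ℕ) : ∃ c : ℝ, 0 < c ∧ ∀ q ∈ V, ‖q - x1‖ ≤ t * d → c ≤ ww u q d := by
  have hS0 := H.hS
  have hS1 : S * d ≤ 1 := le_trans (by gcongr; linarith) hS
  have hS4 : S * (4 * d) ≤ 1 := le_trans (by gcongr; linarith) hS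
  induction t with
  | zero =>
    refine ⟨ww u x1 d, H.ww_pos hx1 hex hd hS1, fun q _ hq => ?_⟩
    have : q = x1 := by
      have h : ‖q - x1‖ ≤ 0 := by simpa using hq
      exact sub_eq_zero.1 (norm_le_zero_iff.1 h)
    rw [this]
  | succ t ih =>
    obtain ⟨c, hc, ih⟩ := ih
    have hG := H.hG
    refine ⟨c ^ 2 / (4 * (G + 1)), by positivity, fun q hq hqd => ?_⟩
    have ht : (0:ℝ) < t + 1 := by positivity
    push_cast at hqd
    have hp : x1 + ((t:ℝ) / (t + 1)) • (q - x1) ∈ V := by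
      apply H.hV.add_smul_sub_mem hx1 hq
      exact ⟨by positivity, by rw [div_le_one ht]; linarith⟩
    set p := x1 + ((t:ℝ) / (t + 1)) • (q - x1) with hpdef
    have h1 : ‖p - x1‖ ≤ t * d := by
      rw [hpdef, add_sub_cancel_left, norm_smul, Real.norm_of_nonneg (by positivity)]
      calc (t:ℝ) / (t+1) * ‖q - x1‖ ≤ t / (t+1) * ((t+1) * d) := by gcongr
        _ = t * d := by field_simp
    have h2 : ‖p - q‖ ≤ d := by
      have e : p - q = (-(1 / ((t:ℝ) + 1))) • (q - x1) := by
        have : (t:ℝ) / (t + 1) = 1 + -(1 / ((t:ℝ) + 1)) := by field_simp; ring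
        rw [hpdef, this, add_smul, one_smul]; abel
      rw [e, norm_smul, norm_neg, Real.norm_of_nonneg (by positivity)]
      calc 1 / ((t:ℝ)+1) * ‖q - x1‖ ≤ 1 / (t+1) * ((t+1) * d) := by gcongr
        _ = d := by field_simp
    have h3 := (ih p hp h1).trans (H.ww_compare hp hq hd h2 hS4)
    have p4 : 0 < ww u q (4 * d) := by linarith
    have hq' := ww_exists (by positivity) p4
    have p1 := H.ww_pos hq hq' hd hS1
    have p16 := H.ww_pos hq hq' (by positivity) hS
    have h5 := H.slope_mono hq hq' hd (by linarith : d < 4 * d) (by linarith : 4 * d < 16 * d)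
      (by linarith) (by linarith) hS
    have e1 : Real.log (4 * d) - Real.log d = Real.log 4 := by
      rw [Real.log_mul (by norm_num) hd.ne']; ring
    have e2 : Real.log (16 * d) - Real.log (4 * d) = Real.log 4 := by
      rw [show 16 * d = 4 * (4 * d) by ring, Real.log_mul (by norm_num) (by positivity)]; ring
    rw [e1, e2, div_le_div_iff_of_pos_right (Real.log_pos (by norm_num))] at h5
    have h6 : ww u q (4 * d) * ww u q (4 * d) ≤ ww u q d * ww u q (16 * d) := by
      rw [← Real.log_le_log_iff (by positivity) (by positivity), Real.log_mul p4.ne' p4.ne',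
        Real.log_mul p1.ne' p16.ne']
      linarith
    have h7 := H.ww_le_G hq (by positivity) hS
    rw [div_le_iff₀ (by positivity)]
    have h8 : ww u q d * ww u q (16 * d) ≤ ww u q d * (G + 1) := by gcongr; linarith
    nlinarith

lemma cube_dist {n : ℕ} {c x : EuclideanSpace ℝ (Fin n)} {ℓ : ℝ} (hx : x ∈ cube c ℓ) :
    ‖x - c‖ ≤ n * (ℓ / 2) := norm_le_of_coord fun j => by simpa using hx j

section
variable {n : ℕ} {u : EuclideanSpace ℝ (Fin n) → ℝ}

lemma bdd (hn : 0 < n) {cQ : EuclideanSpace ℝ (Fin n)} {ℓ G B : ℝ} (hℓ : 0 < ℓ)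
    (hu : IsHarmonicOn u (ball cQ (100 * n * ℓ)))
    (H : TS u (ball cQ (100 * n * ℓ)) (ball cQ (50 * n * ℓ)) G (Lam n / (10 * n * ℓ)))
    (hB : ∀ y ∈ ball cQ (60 * n * ℓ), ‖fderiv ℝ u y‖ ≤ B)
    {x1 : EuclideanSpace ℝ (Fin n)} (hx1 : x1 ∈ cube cQ ℓ) (hex : ∃ k, 0 < bc u x1 k) :
    BddAbove {t | ∃ x ∈ cube cQ ℓ, ∃ r : ℝ, 0 < r ∧ r ≤ ℓ ∧
      t = Real.log (supGrad u (ball x (10 * n * r)) / supGrad u (ball x r))} := by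
  have hn1 : (1:ℝ) ≤ n := by exact_mod_cast hn
  have hn0 : (0:ℝ) < n := by linarith
  have hL := Lam_ge' hn
  have hL0 : 0 < Lam n := by linarith
  have hS0 := H.hS
  have hnl : ℓ ≤ n * ℓ := by nlinarith
  have hnl0 : 0 < n * ℓ := by positivity
  have hQV : ∀ x ∈ cube cQ ℓ, ∀ ρ ≤ 10 * n * ℓ, ball x ρ ⊆ ball cQ (50 * n * ℓ) := by
    intro x hx ρ hρ
    apply ball_subset_ball'
    rw [dist_eq_norm]
    linarith [cube_dist hx]
  have hQ : ∀ x ∈ cube cQ ℓ, x ∈ ball cQ (50 * n * ℓ) := fun x hx =>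
    hQV x hx (10 * n * ℓ) le_rfl (mem_ball_self (by positivity))
  have h56 : ball cQ (50 * n * ℓ) ⊆ ball cQ (60 * n * ℓ) := ball_subset_ball (by linarith)
  set S := Lam n / (10 * n * ℓ) with hSdef
  set d := 1 / (40 * n * Lam n * S) with hd
  have hd0 : 0 < d := by positivity
  have hSd : S * (40 * n * Lam n * d) = 1 := by rw [hd]; field_simp
  have hS16 : S * (16 * d) ≤ 1 := by
    rw [← hSd]
    have : (1:ℝ) ≤ n * Lam n := by nlinarith
    have : 16 * d ≤ 40 * n * Lam n * d := by gcongr; linarith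
    gcongr
  obtain ⟨t, ht⟩ := exists_nat_ge (n * ℓ / d)
  obtain ⟨c, hc, hch⟩ := H.chain (hQ x1 hx1) hex hd0 hS16 t
  have hlow : ∀ x ∈ cube cQ ℓ, c ≤ ww u x d := by
    intro x hx
    apply hch x (hQ x hx)
    rw [div_le_iff₀ hd0] at ht
    have := norm_sub_le_norm_sub_add_norm_sub x cQ x1
    rw [norm_sub_rev cQ x1] at this
    linarith [cube_dist hx, cube_dist hx1]
  have hB0 : 0 ≤ B := (norm_nonneg _).trans (hB cQ (mem_ball_self (by positivity)))
  refine ⟨max (B / (Lam n / ℓ * c)) (max 1 (Real.log G - Real.log c) + 1), ?_⟩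
  rintro _ ⟨x, hx, r, hr, hrℓ, rfl⟩
  have hnr : n * r ≤ n * ℓ := by gcongr
  have hV : ball x (10 * n * r) ⊆ ball cQ (50 * n * ℓ) := hQV x hx _ (by linarith)
  have hVr : ball x r ⊆ ball cQ (50 * n * ℓ) := hQV x hx _ (by linarith)
  rcases le_or_gt (Lam n * d) r with hcase | hcase
  · apply le_trans _ (le_max_left _ _)
    refine (Real.log_le_self (div_nonneg (supGrad_nonneg _) (supGrad_nonneg _))).trans ?_
    have h1 : supGrad u (ball x (10 * n * r)) ≤ B := supGrad_le hB0 fun y hy => hB y (h56 (hV hy))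
    have hdr : d ≤ r / Lam n := by rw [le_div_iff₀ hL0]; linarith
    have hSr : S * (r / Lam n) ≤ 1 := by
      have : S * (r / Lam n) = r / (10 * n * ℓ) := by rw [hSdef]; field_simp
      rw [this, div_le_one (by positivity)]
      linarith
    have h2 := (hlow x hx).trans (H.ww_mono (hQ x hx) hd0.le hdr hSr)
    have h3 := h2.trans (ww_le_supGrad hn hr (harm_mono (hVr.trans H.hVU) hu) (fun y hy => hB y (h56 (hVr hy))))
    have h4 : Lam n / ℓ * c ≤ supGrad u (ball x r) := by
      have : c ≤ ℓ / Lam n * supGrad u (ball x r) := h3.trans (by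
        have := supGrad_nonneg (u := u) (ball x r)
        gcongr)
      calc Lam n / ℓ * c ≤ Lam n / ℓ * (ℓ / Lam n * supGrad u (ball x r)) := by gcongr
        _ = _ := by field_simp
    gcongr
  · apply le_trans _ (le_max_right _ _)
    by_contra hcon
    push Not at hcon
    have hS40 : S * (40 * n * r) ≤ 1 := by
      rw [← hSd, show 40 * n * Lam n * d = 40 * n * (Lam n * d) by ring]
      gcongr
    obtain ⟨hexx, h1⟩ := lower_slope hn H hu hr (by positivity) hV (fun y hy => hB y (h56 (hVr hy))) hS40 hcon
    have h2 := H.slope_mono (hQ x hx) hexx (a := r / Lam n) (b := 40 * n * r) (c := d) (d := 40 * n * Lam n * d)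
      (by positivity) ?_ ?_ ?_ ?_ hSd.le
    · have e : Real.log (40 * n * Lam n * d) - Real.log d = Real.log (40 * n * Lam n) := by
        rw [Real.log_mul (by positivity) hd0.ne']; ring
      rw [e] at h2
      have h3 := h1.trans h2
      rw [div_le_div_iff_of_pos_right (Real.log_pos (by nlinarith))] at h3
      have h4 := Real.log_le_log hc (hlow x hx)
      have h5 := Real.log_le_log (H.ww_pos (hQ x hx) hexx (by positivity) hSd.le)
        (H.ww_le_G (hQ x hx) (by positivity) hSd.le)
      linarith [le_max_right 1 (Real.log G - Real.log c)]
    · have : r / Lam n ≤ r := div_le_self hr.le (by linarith)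
      nlinarith
    · have : (1:ℝ) < 40 * n * Lam n := by nlinarith
      nlinarith
    · rw [div_le_iff₀ hL0]; linarith
    · rw [show 40 * n * Lam n * d = 40 * n * (Lam n * d) by ring]
      gcongr
end

section
variable {n : ℕ}

lemma subCenter_apply (c : EuclideanSpace ℝ (Fin n)) (ℓ : ℝ) (M : ℕ) (k : Fin n → Fin M) (i : Fin n) :
    subCenter c ℓ M k i = c i + (((k i : ℝ) + 1 / 2) / M - 1 / 2) * ℓ := rfl

lemma sub_cube (c : EuclideanSpace ℝ (Fin n)) {ℓ : ℝ} (hℓ : 0 < ℓ) {M : ℕ} (hM : 0 < M) (k : Fin n → Fin M) :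
    cube (subCenter c ℓ M k) (ℓ / M) ⊆ cube c ℓ := by
  intro x hx i
  have h := hx i
  rw [subCenter_apply] at h
  have hM0 : (0:ℝ) < M := by exact_mod_cast hM
  have h1 : ((k i : ℕ) : ℝ) + 1 ≤ M := by exact_mod_cast (k i).2
  have h0 : (0:ℝ) ≤ ((k i : ℕ) : ℝ) := by positivity
  set κ : ℝ := ((k i : ℕ) : ℝ)
  have e : ((κ + 1 / 2) / M - 1 / 2) * ℓ = κ * (ℓ / M) + ℓ / M / 2 - ℓ / 2 := by field_simp
  rw [e] at h
  have hs : 0 < ℓ / M := by positivity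
  have h2 : (κ + 1) * (ℓ / M) ≤ ℓ := by
    calc (κ + 1) * (ℓ / M) ≤ M * (ℓ / M) := by gcongr
      _ = ℓ := by field_simp
  have h3 : 0 ≤ κ * (ℓ / M) := by positivity
  rw [abs_le] at h ⊢
  constructor <;> linarith [h.1, h.2]

lemma end_count (c : EuclideanSpace ℝ (Fin n)) {ℓ R : ℝ} (hℓ : 0 < ℓ) {M : ℕ} (hM : 0 < M)
    (x : (Fin n → Fin M) → EuclideanSpace ℝ (Fin n)) (J : Finset (Fin n → Fin M))
    (hx : ∀ k ∈ J, x k ∈ cube (subCenter c ℓ M k) (ℓ / M))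
    (hJ : ∀ i ∈ J, ∀ j ∈ J, ‖x i - x j‖ ≤ R) (B : ℕ) (hR : R + ℓ / M ≤ B * (ℓ / M)) :
    J.card ≤ (2 * B + 1) ^ n := by
  rcases J.eq_empty_or_nonempty with rfl | ⟨k0, hk0⟩
  · simp
  have hM0 : (0:ℝ) < M := by exact_mod_cast hM
  have hs : 0 < ℓ / M := by positivity
  have hcard : (Fintype.piFinset fun _ : Fin n => Finset.Icc (-(B:ℤ)) B).card = (2 * B + 1) ^ n := by
    rw [Fintype.card_piFinset]
    simp
    congr 1
    omega
  rw [← hcard]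
  apply Finset.card_le_card_of_injOn (fun k i => ((k i : ℕ) : ℤ) - ((k0 i : ℕ) : ℤ))
  · intro k hk
    have hk : k ∈ J := hk
    simp only [Fintype.coe_piFinset, Finset.coe_Icc, Set.mem_pi, Set.mem_Icc]
    intro i _
    rw [← abs_le]
    have h1 := hx k hk i
    have h2 := hx k0 hk0 i
    rw [subCenter_apply] at h1 h2
    have h3 : |x k i - x k0 i| ≤ R := by
      have := (PiLp.norm_apply_le (x k - x k0) i).trans (hJ k hk k0 hk0)
      simpa using this
    have e : ∀ κ : ℝ, ((κ + 1 / 2) / M - 1 / 2) * ℓ = κ * (ℓ / M) + ℓ / M / 2 - ℓ / 2 := fun κ => by field_simp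
    rw [e] at h1 h2
    have h4 : |((k i : ℕ) : ℝ) - ((k0 i : ℕ) : ℝ)| * (ℓ / M) ≤ B * (ℓ / M) := by
      rw [← abs_of_pos hs, ← abs_mul, abs_of_pos hs]
      refine le_trans ?_ hR
      rw [abs_le] at h1 h2 h3 ⊢
      constructor <;> linarith [h1.1, h1.2, h2.1, h2.2, h3.1, h3.2]
    have h5 := le_of_mul_le_mul_right h4 hs
    exact_mod_cast h5
  · intro k _ k' _ h
    funext i
    have := congrFun h i
    simp only at this
    apply Fin.ext
    omega
end

lemma good_cell' {n p : ℕ} (hnp : n = p + 1) {ι : Type} {U V : Set (EuclideanSpace ℝ (Fin n))} {G S : ℝ}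
    {u : EuclideanSpace ℝ (Fin n) → ℝ} (H : TS u U V G S) (hu : IsHarmonicOn u U) {D : ℕ}
    (hD : 0 < D) {r K ε : ℝ} (hr : 0 < r) (J : Finset ι) (hne : J.Nonempty)
    (x : ι → EuclideanSpace ℝ (Fin n)) (hxV : ∀ i ∈ J, x i ∈ V)
    (hJ : ∀ i ∈ J, ∀ j ∈ J, ‖x i - x j‖ ≤ r) (hpos : ∀ i ∈ J, ∃ k, 0 < bc u (x i) k)
    (hε : ε = 1 / (10 * n)) (hK1 : 1 < K)
    (hK : 2 ^ 15 * (n:ℝ) ^ 4 * (LamG D p) ^ 2 ≤ K ^ ε) (hKS : S * (K * r) ≤ 1)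
    (hσ : ∀ i ∈ J, 20 * n ≤ sl u (x i) K r)
    (hgood : ∀ i ∈ J, (1 - ε) * sl u (x i) K r ≤ sl u (x i) K (r / K)) :
    0 < p ∧ Splits x J ((2 * D + 1) ^ (p - 1)) ((n + 2) * (r / D)) := by
  subst hnp
  push_cast at *
  have := good_cell H hu hD hr J hne x hxV hJ hpos hε hK1 hK hKS hσ hgood
  rw [show (p:ℝ) + 1 + 2 = p + 3 by ring]
  exact this

lemma TS.sl_mono {E : Type*} [NormedAddCommGroup E] [NormedSpace ℝ E] {u : E → ℝ} {U V : Set E} {G S : ℝ}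
    (H : TS u U V G S) {x : E} (hx : x ∈ V) (h : ∃ k, 0 < bc u x k) {K r r' : ℝ} (hK : 1 < K)
    (hr : 0 < r) (hrr : r ≤ r') (hS : S * (K * r') ≤ 1) : sl u x K r ≤ sl u x K r' := by
  have e : ∀ ρ : ℝ, 0 < ρ → Real.log K = Real.log (K * ρ) - Real.log ρ := fun ρ hρ => by
    rw [Real.log_mul (by positivity) hρ.ne']; ring
  have := H.slope_mono hx h hr (by nlinarith : r < K * r) (by nlinarith : r' < K * r') hrr
    (by gcongr) hS
  rw [← e r hr, ← e r' (by linarith)] at this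
  exact this

set_option maxHeartbeats 1000000 in
lemma core {n p : ℕ} (hnp : n = p + 1) {cQ : EuclideanSpace ℝ (Fin n)} {ℓ G B : ℝ} (hℓ : 0 < ℓ)
    {u : EuclideanSpace ℝ (Fin n) → ℝ}
    (hu : IsHarmonicOn u (ball cQ (100 * n * ℓ)))
    (H : TS u (ball cQ (100 * n * ℓ)) (ball cQ (50 * n * ℓ)) G (Lam n / (10 * n * ℓ)))
    (hB : ∀ y ∈ ball cQ (60 * n * ℓ), ‖fderiv ℝ u y‖ ≤ B) {N L1 ε : ℝ} (hL1 : L1 = Real.log (40 * n * Lam n))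
    (hε : ε = 1 / (10 * n)) (hN1 : 1 ≤ N) (hN : 20 * n * L1 ≤ N)
    (hdb : ∀ x ∈ cube cQ ℓ, ∀ r, 0 < r → r ≤ ℓ →
      Real.log (supGrad u (ball x (10 * n * r)) / supGrad u (ball x r)) ≤ 2 * N)
    {c : EuclideanSpace ℝ (Fin n)} {L : ℝ} (hL : 0 < L) {M : ℕ} (hM : 0 < M) (hq : cube c L ⊆ cube cQ ℓ)
    (hLM : L * M ≤ ℓ) (I : Finset (Fin n → Fin M)) (x : (Fin n → Fin M) → EuclideanSpace ℝ (Fin n))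
    (ρ : (Fin n → Fin M) → ℝ)
    (hI : ∀ k ∈ I, x k ∈ cube (subCenter c L M k) (L / M) ∧ 0 < ρ k ∧ ρ k ≤ L / M ∧
      N < Real.log (supGrad u (ball (x k) (10 * n * ρ k)) / supGrad u (ball (x k) (ρ k))))
    {κ a t b m D : ℕ} (hκ : 40 ≤ κ) (ha : 1 ≤ a) (hD : D = (n + 2) * κ) {K : ℝ} (hKκ : K = (κ:ℝ) ^ a)
    (hK : 2 ^ 15 * (n:ℝ) ^ 4 * (LamG D p) ^ 2 ≤ K ^ ε) (ht : 4 * Lam n * K ≤ (10 * n) ^ t)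
    (htM : (10 * (n:ℝ)) ^ t ≤ 40 * M) (hm : κ ^ (m + a) ≤ M) (hm' : M ≤ κ ^ (m + a + 1))
    (hb : a * (t * (Real.log (10 * n) + 2) / Real.log K) * L1 / ε ≤ b) :
    (p = 0 → b < m → I = ∅) ∧ I.card ≤ (2 * (n * κ ^ (a + 1) + 1) + 1) ^ n *
      (2 * (2 * D + 1) ^ (p - 1)) ^ m * ((2 * D + 1) ^ n) ^ b := by
  classical
  have hn : 0 < n := by omega
  have hn1 : (1:ℝ) ≤ n := by exact_mod_cast hn
  have hn0 : (0:ℝ) < n := by linarith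
  have hLam := Lam_ge' hn
  have hL0 : 0 < Lam n := by linarith
  have hκ40 : (40:ℝ) ≤ κ := by exact_mod_cast hκ
  have hκ0 : (0:ℝ) < κ := by linarith
  have hK1 : 1 < K := by rw [hKκ]; exact one_lt_pow₀ (by linarith) (by omega)
  have hK0 : 0 < K := by linarith
  have hlK : 0 < Real.log K := Real.log_pos hK1
  have hM0 : (0:ℝ) < M := by exact_mod_cast hM
  have hM1 : (1:ℝ) ≤ M := by exact_mod_cast hM
  have hLℓ : L ≤ ℓ := le_trans (le_mul_of_one_le_right hL.le hM1) hLM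
  have hL1p : 0 < L1 := by rw [hL1]; exact Real.log_pos (by nlinarith)
  have hε0 : 0 < ε := by rw [hε]; positivity
  have hDpos : 0 < D := by rw [hD]; positivity
  have hnl : ℓ ≤ n * ℓ := by nlinarith
  have hnl0 : 0 < n * ℓ := by positivity
  have hQV : ∀ x ∈ cube cQ ℓ, ∀ ρ ≤ 10 * n * ℓ, ball x ρ ⊆ ball cQ (50 * n * ℓ) := by
    intro x hx ρ hρ
    apply ball_subset_ball'
    rw [dist_eq_norm]
    linarith [cube_dist hx]
  have h56 : ball cQ (50 * n * ℓ) ⊆ ball cQ (60 * n * ℓ) := ball_subset_ball (by linarith)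
  set S := Lam n / (10 * n * ℓ) with hSdef
  have hS0 : 0 < S := H.hS
  -- radii
  set R : ℕ → ℝ := fun k => n * L / (κ:ℝ) ^ k with hR
  have hR0 : ∀ k, 0 < R k := fun k => by simp only [hR]; positivity
  have hRanti : ∀ k l, k ≤ l → R l ≤ R k := fun k l hkl => by
    simp only [hR]
    gcongr
    linarith
  have hRz : R 0 = n * L := by simp [hR]
  have hRa : ∀ k, R (k + a) = R k / K := fun k => by simp only [hR, hKκ, pow_add]; field_simp
  have hRs : ∀ k, R (k + 1) = R k / κ := fun k => by simp only [hR, pow_succ]; field_simp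
  have hKS0 : S * (K * R 0) ≤ 1 := by
    rw [hRz, hSdef]
    have e : Lam n / (10 * n * ℓ) * (K * (n * L)) = Lam n * K * L / (10 * ℓ) := by field_simp
    rw [e, div_le_one (by positivity)]
    have : Lam n * K ≤ 10 * M := by linarith
    calc Lam n * K * L ≤ 10 * M * L := by gcongr
      _ ≤ 10 * ℓ := by linarith
  have hKS : ∀ k, S * (K * R k) ≤ 1 := fun k => by
    refine le_trans ?_ hKS0
    have := hRanti 0 k (by omega)
    gcongr
  -- points
  have hxq : ∀ k ∈ I, x k ∈ cube c L := fun k hk => sub_cube c hL hM k (hI k hk).1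
  have hxQ : ∀ k ∈ I, x k ∈ cube cQ ℓ := fun k hk => hq (hxq k hk)
  have hxV : ∀ k ∈ I, x k ∈ ball cQ (50 * n * ℓ) := fun k hk =>
    hQV _ (hxQ k hk) (10 * n * ℓ) le_rfl (mem_ball_self (by positivity))
  have hpw : ∀ i ∈ I, ∀ j ∈ I, ‖x i - x j‖ ≤ R 0 := by
    intro i hi j hj
    have := norm_sub_le_norm_sub_add_norm_sub (x i) c (x j)
    rw [norm_sub_rev c (x j)] at this
    rw [hRz]
    linarith [cube_dist (hxq i hi), cube_dist (hxq j hj)]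
  have hlow : ∀ i ∈ I, (∃ k, 0 < bc u (x i) k) ∧ ∀ k < m + a, N / L1 ≤ sl u (x i) K (R k) := by
    intro i hi
    obtain ⟨h1, h2, h3, h4⟩ := hI i hi
    have hρR : ∀ k < m + a, 40 * n * ρ i ≤ R k := by
      intro k hk
      have hkM : 40 * (κ:ℝ) ^ k ≤ M := by
        calc 40 * (κ:ℝ) ^ k ≤ κ * (κ:ℝ) ^ k := by gcongr
          _ = (κ:ℝ) ^ (k + 1) := by ring
          _ ≤ (κ:ℝ) ^ (m + a) := pow_le_pow_right₀ (by linarith) (by omega)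
          _ ≤ M := by exact_mod_cast hm
      simp only [hR]
      rw [le_div_iff₀ (by positivity)]
      calc 40 * n * ρ i * (κ:ℝ) ^ k ≤ 40 * n * (L / M) * (κ:ℝ) ^ k := by gcongr
        _ = n * (L / M) * (40 * (κ:ℝ) ^ k) := by ring
        _ ≤ n * (L / M) * M := by gcongr
        _ = n * L := by field_simp
    have hρ0 := hρR 0 (by omega)
    have hSρ : S * (40 * n * ρ i) ≤ 1 := by
      refine le_trans ?_ hKS0
      exact mul_le_mul_of_nonneg_left (hρ0.trans (le_mul_of_one_le_left (hR0 0).le hK1.le)) hS0.le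
    have hρℓ : 10 * n * ρ i ≤ 10 * n * ℓ := by
      have : n * ρ i ≤ n * ℓ := by
        gcongr
        exact h3.trans ((div_le_self hL.le hM1).trans hLℓ)
      linarith
    have hρn : ρ i ≤ 10 * n * ρ i := le_mul_of_one_le_left h2.le (by linarith)
    obtain ⟨hex, hs⟩ := lower_slope hn H hu h2 (by linarith) (hQV _ (hxQ i hi) _ hρℓ)
      (fun y hy => hB y (h56 (hQV _ (hxQ i hi) _ (hρn.trans hρℓ) hy))) hSρ h4
    refine ⟨hex, fun k hk => ?_⟩
    rw [← hL1] at hs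
    refine hs.trans ?_
    have hRk := hR0 k
    have hRK : R k < K * R k := lt_mul_of_one_lt_left hRk hK1
    have hρL : ρ i / Lam n ≤ ρ i := div_le_self h2.le (by linarith)
    have hρk := hρR k hk
    have := H.slope_mono (hxV i hi) hex (a := ρ i / Lam n) (b := 40 * n * ρ i) (c := R k) (d := K * R k)
      (by positivity) (by linarith) hRK (by linarith) (by linarith) (hKS k)
    rw [Real.log_mul hK0.ne' hRk.ne', add_sub_cancel_right] at this
    rw [sl]
    exact this
  set Ct := t * (Real.log (10 * n) + 2) / Real.log K with hCt
  have hupp : ∀ i ∈ I, sl u (x i) K (R 0) ≤ N * Ct := by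
    intro i hi
    refine upper_slope hn H hu (hR0 0) hN1 hK1 (hlow i hi).1 hℓ (hQV _ (hxQ i hi) _ le_rfl)
      (fun y hy => hB y (h56 (hQV _ (hxQ i hi) _ le_rfl hy))) ?_ ht ?_ (hdb _ (hxQ i hi))
    · rw [hSdef]
      exact le_of_eq (by field_simp)
    · rw [hRz]
      calc (10 * (n:ℝ)) ^ t * (n * L / 4) ≤ 40 * M * (n * L / 4) := by gcongr
        _ = 10 * n * (L * M) := by ring
        _ ≤ 10 * n * ℓ := by gcongr
  have hmono : ∀ i ∈ I, ∀ k l, k ≤ l → sl u (x i) K (R l) ≤ sl u (x i) K (R k) := fun i hi k l hkl =>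
    H.sl_mono (hxV i hi) (hlow i hi).1 hK1 (hR0 l) (hRanti k l hkl) (hKS k)
  let good : ℕ → (Fin n → Fin M) → Prop := fun k i =>
    (1 - ε) * sl u (x i) K (R k) ≤ sl u (x i) K (R (k + a))
  have hbad : ∀ i ∈ I, ((Finset.Ico (m - m) m).filter fun k => ¬ good k i).card ≤ b := by
    intro i hi
    have h1 := bad_count (fun k => sl u (x i) K (R k)) a m hε0 (by positivity : 0 < N / L1)
      (hlow i hi).2 (fun k _ => (hmono i hi 0 k (by omega)).trans (hupp i hi))
      (fun k _ => hmono i hi k (k + a) (by omega)) ((Finset.Ico (m - m) m).filter fun k => ¬ good k i) (by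
        intro k hk
        rw [Finset.mem_filter, Finset.mem_Ico] at hk
        exact ⟨hk.1.2, not_le.1 hk.2⟩)
    set Z := ((Finset.Ico (m - m) m).filter fun k => ¬ good k i).card
    have h2 : (Z:ℝ) ≤ b := by
      refine le_trans ?_ hb
      rw [le_div_iff₀ hε0]
      have hN0 : 0 < N := by linarith
      have h3 : (Z:ℝ) * ε * (N / L1) ≤ a * Ct * L1 * (N / L1) := by
        have e : a * Ct * L1 * (N / L1) = a * (N * Ct) := by field_simp
        rw [e]; linarith
      exact le_of_mul_le_mul_right h3 (by positivity)
    exact_mod_cast h2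
  have hcell : ∀ k < m, ∀ J ⊆ I, J.Nonempty → (∀ i ∈ J, ∀ j ∈ J, ‖x i - x j‖ ≤ R k) → (∀ i ∈ J, good k i) →
      0 < p ∧ Splits x J ((2 * D + 1) ^ (p - 1)) ((n + 2) * (R k / D)) := by
    intro k hk J hJI hne hJ hg
    refine good_cell' hnp H hu hDpos (hR0 k) J hne x (fun i hi => hxV i (hJI hi)) hJ
      (fun i hi => (hlow i (hJI hi)).1) hε hK1 hK (hKS k) (fun i hi => ?_) (fun i hi => ?_)
    · refine le_trans ?_ ((hlow i (hJI hi)).2 k (by omega))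
      rw [le_div_iff₀ hL1p]; exact hN
    · rw [← hRa]; exact hg i hi
  have hRD : ∀ k, (n + 2) * (R k / D) = R (k + 1) := fun k => by
    rw [hRs, hD]; push_cast; field_simp
  refine ⟨fun hp hbm => ?_, ?_⟩
  · rw [Finset.eq_empty_iff_forall_notMem]
    intro i hi
    have h1 := hbad i hi
    have h2 : ∃ k ∈ Finset.Ico (m - m) m, good k i := by
      by_contra hcon
      push Not at hcon
      rw [Finset.filter_true_of_mem hcon, Nat.card_Ico] at h1
      omega
    obtain ⟨k, hk, hg⟩ := h2
    rw [Finset.mem_Ico] at hk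
    have := (hcell k hk.2 {i} (by simpa using hi) (by simp) (by
      simp only [Finset.mem_singleton]
      rintro _ rfl _ rfl
      simpa using (hR0 k).le) (by
      simp only [Finset.mem_singleton]
      rintro _ rfl
      exact hg)).1
    omega
  · refine counting x R ((2 * D + 1) ^ (p - 1)) ((2 * D + 1) ^ n) ((2 * (n * κ ^ (a + 1) + 1) + 1) ^ n) m
      (Nat.one_le_pow _ _ (by omega)) (Nat.one_le_pow _ _ (by omega)) good I ?_ ?_ ?_ m le_rfl b I
      (Finset.Subset.refl _) (by simpa using hpw) hbad
    · intro k hk J hJI hJ hg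
      rcases J.eq_empty_or_nonempty with rfl | hne
      · exact ⟨0, fun _ => 0, ∅, by simp, by simp, by simp⟩
      · rw [← hRD]; exact (hcell k hk J hJI hne hJ hg).2
    · intro k hk J hJI hJ
      rw [← hRD]
      exact cells_any hDpos (hR0 k) J x hJ
    · intro J hJI hJ
      refine end_count c hL hM x J (fun k hk => (hI k (hJI hk)).1) hJ _ ?_
      have h1 : (M:ℝ) ≤ (κ:ℝ) ^ m * (κ:ℝ) ^ (a + 1) := by
        rw [← pow_add]; exact_mod_cast hm'
      have h2 : R m ≤ n * (κ:ℝ) ^ (a + 1) * (L / M) := by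
        simp only [hR]
        rw [div_le_iff₀ (by positivity)]
        calc n * L = n * (L / M) * M := by field_simp
          _ ≤ n * (L / M) * ((κ:ℝ) ^ m * (κ:ℝ) ^ (a + 1)) := by gcongr
          _ = _ := by ring
      push_cast
      linarith

lemma params (n p : ℕ) (hnp : n = p + 1) {δ : ℝ} (hδ : 0 < δ) : ∃ κ a t b M0 : ℕ, 40 ≤ κ ∧ 1 ≤ a ∧
    2 ^ 15 * (n:ℝ) ^ 4 * (LamG ((n + 2) * κ) p) ^ 2 ≤ ((κ:ℝ) ^ a) ^ ((1:ℝ) / (10 * n)) ∧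
    4 * Lam n * (κ:ℝ) ^ a ≤ (10 * n) ^ t ∧
    a * (t * (Real.log (10 * n) + 2) / Real.log ((κ:ℝ) ^ a)) * Real.log (40 * n * Lam n) / (1 / (10 * n)) ≤ b ∧
    2 * (2 * (((n:ℝ) + 2) * κ) + 1) ^ (p - 1) ≤ (κ:ℝ) ^ (((p - 1 : ℕ) : ℝ) + δ / 2) ∧
    ∀ M : ℕ, M0 ≤ M → (10 * (n:ℝ)) ^ t ≤ 40 * M ∧ κ ^ (a + b + 1) ≤ M ∧ 4 * Lam n ≤ M ∧
      2 * ((2 * (n * κ ^ (a + 1) + 1) + 1) ^ n * ((2 * (((n:ℝ) + 2) * κ) + 1) ^ n) ^ b) ≤ (M:ℝ) ^ (δ / 2) := by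
  have hn1 : (1:ℝ) ≤ n := by rw [hnp]; push_cast; linarith [(Nat.cast_nonneg p : (0:ℝ) ≤ p)]
  have hpow : Filter.Tendsto (fun k : ℕ => (k:ℝ) ^ (δ / 2)) Filter.atTop Filter.atTop :=
    (tendsto_rpow_atTop (by positivity)).comp tendsto_natCast_atTop_atTop
  obtain ⟨κ, h1, hκ⟩ := ((hpow.eventually_ge_atTop (2 * (3 * ((n:ℝ) + 2)) ^ (p - 1))).and
    (Filter.eventually_ge_atTop 40)).exists
  have hκ40 : (40:ℝ) ≤ κ := by exact_mod_cast hκ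
  have hκ0 : (0:ℝ) < κ := by linarith
  have hκε : 1 < (κ:ℝ) ^ ((1:ℝ) / (10 * n)) := Real.one_lt_rpow (by linarith) (by positivity)
  obtain ⟨a, h2, ha⟩ := (((tendsto_pow_atTop_atTop_of_one_lt hκε).eventually_ge_atTop
    (2 ^ 15 * (n:ℝ) ^ 4 * (LamG ((n + 2) * κ) p) ^ 2)).and (Filter.eventually_ge_atTop 1)).exists
  obtain ⟨t, ht⟩ := pow_unbounded_of_one_lt (4 * Lam n * (κ:ℝ) ^ a) (by linarith : 1 < 10 * (n:ℝ))
  obtain ⟨b, hb⟩ := exists_nat_ge (a * (t * (Real.log (10 * n) + 2) / Real.log ((κ:ℝ) ^ a)) *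
    Real.log (40 * n * Lam n) / (1 / (10 * n)))
  have hnat := tendsto_natCast_atTop_atTop (R := ℝ)
  obtain ⟨M0, hM0⟩ := Filter.eventually_atTop.1
    ((((hnat.eventually_ge_atTop ((10 * (n:ℝ)) ^ t / 40)).and (Filter.eventually_ge_atTop (κ ^ (a + b + 1)))).and
      (hnat.eventually_ge_atTop (4 * Lam n))).and (hpow.eventually_ge_atTop
        (2 * ((2 * (n * κ ^ (a + 1) + 1) + 1) ^ n * ((2 * (((n:ℝ) + 2) * κ) + 1) ^ n) ^ b))))
  refine ⟨κ, a, t, b, M0, hκ, ha, ?_, ht.le, hb, ?_, fun M hM => ?_⟩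
  · refine h2.trans (le_of_eq ?_)
    rw [← Real.rpow_natCast, ← Real.rpow_natCast, ← Real.rpow_mul hκ0.le, ← Real.rpow_mul hκ0.le, mul_comm]
  · rw [Real.rpow_add hκ0, Real.rpow_natCast]
    have : 2 * (((n:ℝ) + 2) * κ) + 1 ≤ 3 * (n + 2) * κ := by nlinarith
    calc 2 * (2 * (((n:ℝ) + 2) * κ) + 1) ^ (p - 1) ≤ 2 * (3 * (n + 2) * κ) ^ (p - 1) := by gcongr
      _ = (κ:ℝ) ^ (p - 1) * (2 * (3 * (n + 2)) ^ (p - 1)) := by rw [mul_pow]; ring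
      _ ≤ _ := by gcongr
  · obtain ⟨⟨⟨g1, g2⟩, g3⟩, g4⟩ := hM0 M hM
    exact ⟨by linarith, g2, g3, g4⟩

set_option maxHeartbeats 1000000 in
lemma final_M {n p : ℕ} (hnp : n = p + 1) {δ : ℝ} (hδ : 0 < δ) {κ a t b M : ℕ} (hκ : 40 ≤ κ) (ha : 1 ≤ a)
    (hK : 2 ^ 15 * (n:ℝ) ^ 4 * (LamG ((n + 2) * κ) p) ^ 2 ≤ ((κ:ℝ) ^ a) ^ ((1:ℝ) / (10 * n)))
    (ht : 4 * Lam n * (κ:ℝ) ^ a ≤ (10 * n) ^ t)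
    (hb : a * (t * (Real.log (10 * n) + 2) / Real.log ((κ:ℝ) ^ a)) * Real.log (40 * n * Lam n) / (1 / (10 * n)) ≤ b)
    (hP : 2 * (2 * (((n:ℝ) + 2) * κ) + 1) ^ (p - 1) ≤ (κ:ℝ) ^ (((p - 1 : ℕ) : ℝ) + δ / 2))
    (htM : (10 * (n:ℝ)) ^ t ≤ 40 * M) (hMκ : κ ^ (a + b + 1) ≤ M) (hM4 : 4 * Lam n ≤ M)
    (hMδ : 2 * ((2 * (n * κ ^ (a + 1) + 1) + 1) ^ n * ((2 * (((n:ℝ) + 2) * κ) + 1) ^ n) ^ b) ≤ (M:ℝ) ^ (δ / 2))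
    {N c : ℝ} (hN1 : 1 ≤ N) (hN : 20 * n * Real.log (40 * n * Lam n) ≤ N) (hc : c < 1)
    (cQ : EuclideanSpace ℝ (Fin n)) {ℓ : ℝ} (hℓ : 0 < ℓ) (u : EuclideanSpace ℝ (Fin n) → ℝ)
    (hu : IsHarmonicOn u (ball cQ (100 * n * ℓ))) (hQ : cubeDoublingIndex u cQ ℓ ≤ (1 + c) * N)
    {j : ℕ} (hj : 1 ≤ j) (k : Fin n → Fin (M ^ j)) :
    (Set.ncard {k' : Fin n → Fin M | N < cubeDoublingIndex u
      (subCenter (subCenter cQ ℓ (M ^ j) k) (ℓ / (M:ℝ) ^ j) M k') (ℓ / (M:ℝ) ^ (j + 1))} : ℝ) ≤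
      (1 / 2) * (M:ℝ) ^ ((n : ℝ) - 2 + δ) := by
  classical
  have hn : 0 < n := by omega
  have hn1 : (1:ℝ) ≤ n := by exact_mod_cast hn
  have hn0 : (0:ℝ) < n := by linarith
  have hLam := Lam_ge' hn
  have hκ40 : (40:ℝ) ≤ κ := by exact_mod_cast hκ
  have hκ0 : (0:ℝ) < κ := by linarith
  have hM0 : (0:ℝ) < M := by linarith
  have hM : 0 < M := by exact_mod_cast hM0
  have hM1 : (1:ℝ) ≤ M := by exact_mod_cast hM
  obtain ⟨L, hLdef⟩ : ∃ L : ℝ, L = ℓ / (M:ℝ) ^ j := ⟨_, rfl⟩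
  have hL : 0 < L := by rw [hLdef]; positivity
  have hLM1 : ℓ / (M:ℝ) ^ (j + 1) = L / M := by rw [hLdef, pow_succ, div_div]
  have hLM : L * M ≤ ℓ := by
    rw [hLdef, div_mul_eq_mul_div, div_le_iff₀ (by positivity)]
    have : (M:ℝ) ^ 1 ≤ (M:ℝ) ^ j := pow_le_pow_right₀ hM1 hj
    rw [pow_one] at this
    gcongr
  have hLℓ : L / M ≤ ℓ / M := by
    have : L ≤ ℓ := le_trans (le_mul_of_one_le_right hL.le hM1) hLM
    gcongr
  have hq : cube (subCenter cQ ℓ (M ^ j) k) L ⊆ cube cQ ℓ := by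
    have := sub_cube cQ hℓ (Nat.pow_pos hM : 0 < M ^ j) k
    rw [Nat.cast_pow, ← hLdef] at this
    exact this
  rw [← hLdef, hLM1]
  obtain ⟨cc, hcc⟩ : ∃ cc, cc = subCenter cQ ℓ (M ^ j) k := ⟨_, rfl⟩
  rw [← hcc] at hq ⊢
  have hbadpt : ∀ k' ∈ {k' : Fin n → Fin M | N < cubeDoublingIndex u (subCenter cc L M k') (L / M)},
      ∃ y : EuclideanSpace ℝ (Fin n) × ℝ, y.1 ∈ cube (subCenter cc L M k') (L / M) ∧ 0 < y.2 ∧ y.2 ≤ L / M ∧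
        N < Real.log (supGrad u (ball y.1 (10 * n * y.2)) / supGrad u (ball y.1 y.2)) := by
    intro k' hk'
    rw [mem_ofPred_eq, cubeDoublingIndex] at hk'
    obtain ⟨_, ⟨x, hx, r, hr, hr', rfl⟩, hlt⟩ := exists_lt_of_lt_csSup (by
      refine ⟨_, subCenter cc L M k', ?_, L / M, by positivity, le_rfl, rfl⟩
      intro i
      rw [sub_self, abs_zero]; positivity) hk'
    exact ⟨(x, r), hx, hr, hr', hlt⟩
  have hrhs : 0 ≤ (1 / 2) * (M:ℝ) ^ ((n : ℝ) - 2 + δ) := by positivity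
  rcases Set.eq_empty_or_nonempty {k' : Fin n → Fin M | N < cubeDoublingIndex u (subCenter cc L M k') (L / M)}
    with hemp | ⟨k1, hk1⟩
  · rw [hemp, Set.ncard_empty, Nat.cast_zero]
    exact hrhs
  obtain ⟨G, B, H, hB⟩ := setup hn hℓ hu
  have hnl : ℓ ≤ n * ℓ := by nlinarith
  have hnl0 : 0 < n * ℓ := by positivity
  have hdb : ∀ x ∈ cube cQ ℓ, ∀ r, 0 < r → r ≤ ℓ →
      Real.log (supGrad u (ball x (10 * n * r)) / supGrad u (ball x r)) ≤ 2 * N := by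
    obtain ⟨⟨x1, r1⟩, hx1, hr1, hr1', hlog⟩ := hbadpt k1 hk1
    simp only at hx1 hr1 hr1' hlog
    have hx1Q : x1 ∈ cube cQ ℓ := hq (sub_cube cc hL hM k1 hx1)
    have hr1M : r1 * M ≤ ℓ := by rw [← le_div_iff₀ hM0]; linarith
    have hr1ℓ : r1 ≤ ℓ := le_trans (le_mul_of_one_le_right hr1.le hM1) hr1M
    have hnr : n * r1 ≤ n * ℓ := by gcongr
    have hV : ball x1 (10 * n * r1) ⊆ ball cQ (50 * n * ℓ) := by
      apply ball_subset_ball'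
      rw [dist_eq_norm]
      linarith [cube_dist hx1Q]
    have hr1n : r1 ≤ 10 * n * r1 := le_mul_of_one_le_left hr1.le (by linarith)
    have hS : Lam n / (10 * n * ℓ) * (40 * n * r1) ≤ 1 := by
      have e : Lam n / (10 * n * ℓ) * (40 * n * r1) = 4 * Lam n * r1 / ℓ := by field_simp; ring
      rw [e, div_le_one hℓ]
      calc 4 * Lam n * r1 ≤ M * r1 := by gcongr
        _ ≤ ℓ := by linarith
    have hex := (lower_slope hn H hu hr1 (by linarith) hV (fun y hy => hB y
      (ball_subset_ball (by linarith) (hV (ball_subset_ball hr1n hy)))) hS hlog).1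
    have hbd := bdd hn hℓ hu H hB hx1Q hex
    intro x hx r hr hrℓ
    have h1 := le_csSup hbd ⟨x, hx, r, hr, hrℓ, rfl⟩
    have h2 : (1 + c) * N ≤ 2 * N := by
      have : 0 < N := by linarith
      gcongr; linarith
    exact h1.trans (le_trans hQ h2)
  choose! y hy using hbadpt
  set Bad : Set (Fin n → Fin M) := {k' | N < cubeDoublingIndex u (subCenter cc L M k') (L / M)} with hBad
  have hfin : Bad.Finite := Set.toFinite _
  rw [Set.ncard_eq_toFinset_card Bad hfin]
  have hlogκ : a + b + 1 ≤ Nat.log κ M := (Nat.le_log_iff_pow_le (by omega) hM.ne').2 hMκ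
  obtain ⟨m, hm⟩ : ∃ m, m + a = Nat.log κ M := ⟨Nat.log κ M - a, by omega⟩
  obtain ⟨h0, hcard⟩ := core hnp hℓ hu H hB rfl rfl hN1 hN hdb hL hM hq hLM hfin.toFinset
    (fun k' => (y k').1) (fun k' => (y k').2) (fun k' hk' => hy k' (hfin.mem_toFinset.1 hk')) hκ ha rfl rfl hK ht htM
    (m := m) (by rw [hm]; exact Nat.pow_log_le_self κ hM.ne')
    (by rw [hm]; exact (Nat.lt_pow_succ_log_self (by omega) M).le) hb
  rcases Nat.eq_zero_or_pos p with hp | hp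
  · rw [h0 hp (by omega), Finset.card_empty, Nat.cast_zero]
    exact hrhs
  have hκm : (κ:ℝ) ^ m ≤ M := by
    have h1 : κ ^ m ≤ κ ^ (m + a) := Nat.pow_le_pow_right (by omega) (by omega)
    rw [hm] at h1
    exact_mod_cast h1.trans (Nat.pow_log_le_self κ hM.ne')
  have hcard' : (hfin.toFinset.card : ℝ) ≤ (2 * (n * κ ^ (a + 1) + 1) + 1) ^ n *
      (2 * (2 * (((n:ℝ) + 2) * κ) + 1) ^ (p - 1)) ^ m * ((2 * (((n:ℝ) + 2) * κ) + 1) ^ n) ^ b := by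
    exact_mod_cast hcard
  have hX : (2 * (2 * (((n:ℝ) + 2) * κ) + 1) ^ (p - 1)) ^ m ≤ (M:ℝ) ^ (((p - 1 : ℕ) : ℝ) + δ / 2) := by
    calc _ ≤ ((κ:ℝ) ^ (((p - 1 : ℕ) : ℝ) + δ / 2)) ^ m := by gcongr
      _ = ((κ:ℝ) ^ m) ^ (((p - 1 : ℕ) : ℝ) + δ / 2) := by
          rw [← Real.rpow_natCast, ← Real.rpow_natCast, ← Real.rpow_mul hκ0.le, ← Real.rpow_mul hκ0.le, mul_comm]
      _ ≤ _ := Real.rpow_le_rpow (by positivity) hκm (by positivity)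
  have hexp : (n:ℝ) - 2 + δ = (((p - 1 : ℕ) : ℝ) + δ / 2) + δ / 2 := by
    rw [hnp, Nat.cast_sub hp]; push_cast; ring
  rw [hexp, Real.rpow_add hM0]
  refine hcard'.trans ?_
  set X := (2 * (2 * (((n:ℝ) + 2) * κ) + 1) ^ (p - 1)) ^ m
  set C1 : ℝ := (2 * (n * κ ^ (a + 1) + 1) + 1) ^ n
  set Q1 := ((2 * (((n:ℝ) + 2) * κ) + 1) ^ n) ^ b
  have hC1 : 0 ≤ C1 := by positivity
  have hQ1 : 0 ≤ Q1 := by positivity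
  calc C1 * X * Q1 = X * (C1 * Q1) := by ring
    _ ≤ (M:ℝ) ^ (((p - 1 : ℕ) : ℝ) + δ / 2) * (C1 * Q1) := by gcongr
    _ ≤ (M:ℝ) ^ (((p - 1 : ℕ) : ℝ) + δ / 2) * ((M:ℝ) ^ (δ / 2) / 2) := by gcongr; linarith
    _ = _ := by ring

/-- **Bound on the number of bad children cubes of descendant cubes.** There are `η, c₀ > 0`
and, for each small `(η, c)` with `c < c₀`, a `j₀ = j₀(η,c)` such that for `A` large enough
(depending on `δ, n, η`) and `N` larger than a dimensional constant the following holds: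
if `N(Q) ≤ (1+c)N` and `q` is a `j`-th generation subcube of `Q` with `j ≥ j₀`, then at most
`(1/2)(2A+1)^{n-2+δ}` of the `(2A+1)ⁿ` children of `q` have doubling index greater
than `N`. -/
theorem bad_children_bound (n : ℕ) (hn : 0 < n) :
    ∃ N₀ : ℝ, 0 < N₀ ∧
    ∀ δ : ℝ, 0 < δ →
    ∃ η c₀ : ℝ, 0 < η ∧ 0 < c₀ ∧
      ∀ c : ℝ, 0 < c → c < c₀ →
      ∃ j₀ A₀ : ℕ,
        ∀ A : ℕ, A₀ < A → (∃ i : ℕ, 2 * A + 1 = 3 ^ i) →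
        ∀ N : ℝ, N₀ < N →
        ∀ (cQ : EuclideanSpace ℝ (Fin n)) (ℓ : ℝ), 0 < ℓ →
        ∀ u : EuclideanSpace ℝ (Fin n) → ℝ,
          IsHarmonicOn u (ball cQ (100 * n * ℓ)) →
          cubeDoublingIndex u cQ ℓ ≤ (1 + c) * N →
        ∀ j : ℕ, j₀ ≤ j →
        ∀ k : Fin n → Fin ((2 * A + 1) ^ j),
          (Set.ncard {k' : Fin n → Fin (2 * A + 1) |
              N < cubeDoublingIndex u
                (subCenter (subCenter cQ ℓ ((2 * A + 1) ^ j) k)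
                  (ℓ / (2 * (A : ℝ) + 1) ^ j) (2 * A + 1) k')
                (ℓ / (2 * (A : ℝ) + 1) ^ (j + 1))} : ℝ) ≤
            (1 / 2) * (2 * (A : ℝ) + 1) ^ ((n : ℝ) - 2 + δ) := by
  obtain ⟨p, hnp⟩ : ∃ p, n = p + 1 := ⟨n - 1, by omega⟩
  have hn1 : (1:ℝ) ≤ n := by exact_mod_cast hn
  have hlog : 0 ≤ Real.log (40 * n * Lam n) := Real.log_nonneg (by nlinarith [Lam_ge' hn])
  refine ⟨20 * n * Real.log (40 * n * Lam n) + 1, by positivity, fun δ hδ => ?_⟩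
  refine ⟨1, 1, one_pos, one_pos, fun c _ hc1 => ?_⟩
  obtain ⟨κ, a, t, b, M0, h1, h2, h3, h4, h5, h6, h7⟩ := params n p hnp hδ
  refine ⟨1, M0, fun A hA _ N hN cQ ℓ hℓ u hu hQ j hj k => ?_⟩
  obtain ⟨g1, g2, g3, g4⟩ := h7 (2 * A + 1) (by omega)
  have hpos : 0 ≤ 20 * n * Real.log (40 * n * Lam n) := by positivity
  have := final_M hnp hδ h1 h2 h3 h4 h5 h6 g1 g2 g3 g4 (N := N) (by linarith) (by linarith) hc1 cQ hℓ u hu hQ hj k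
  have e : ((2 * A + 1 : ℕ) : ℝ) = 2 * (A:ℝ) + 1 := by push_cast; ring
  rw [e] at this
  exact this
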